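/- Let r ≥ 1 and let G_r be the group of ℂ-algebra automorphisms f of ℂ[x,y,z] such that f(z) = z and f(x) − x and f(y) − y both lie in the ideal generated by z^r. Let σ be the ring automorphism of ℂ[x,y,z] that conjugates the coefficients of a polynomial, and for g ∈ G_r set ḡ = σ ∘ g ∘ σ (which again lies in G_r). Then for every ν ∈ G_r with ν ∘ ν̄ = id there exists β ∈ G_r such that ν = β⁻¹ ∘ β̄; that is, H¹(Gal(ℂ/ℝ), G_r) is trivial. -/

import Mathlib

open MvPolynomial

/-- Coefficientwise complex conjugation on `ℂ[x,y,z]`. -/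
noncomputable def coeffConj18 (P : MvPolynomial (Fin 3) ℂ) : MvPolynomial (Fin 3) ℂ :=
  MvPolynomial.map (starRingEnd ℂ) P

/-- Membership in the group `G_r` of automorphisms of `ℂ[x,y,z]` fixing `z` and
congruent to the identity modulo `z^r`. -/
def MemGr (r : ℕ) (f : MvPolynomial (Fin 3) ℂ ≃ₐ[ℂ] MvPolynomial (Fin 3) ℂ) : Prop :=
  f (X 2) = X 2 ∧
  f (X 0) - X 0 ∈ Ideal.span {(X 2 : MvPolynomial (Fin 3) ℂ) ^ r} ∧
  f (X 1) - X 1 ∈ Ideal.span {(X 2 : MvPolynomial (Fin 3) ℂ) ^ r}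


set_option linter.unusedSectionVars false
set_option linter.unusedVariables false


abbrev P2 (R : Type*) [CommSemiring R] := MvPolynomial (Fin 2) R
abbrev Aut2 (R : Type*) [CommRing R] := P2 R ≃ₐ[R] P2 R

section basics
variable {R S T : Type*} [CommRing R] [CommRing S] [CommRing T] [Algebra R S] [Algebra R T]

noncomputable def ev (F G : S) : P2 R →ₐ[R] S := aeval ![F, G]

@[simp] lemma ev_X0 (F G : S) : ev (R := R) F G (X 0) = F := by simp [ev]
@[simp] lemma ev_X1 (F G : S) : ev (R := R) F G (X 1) = G := by simp [ev]

lemma hom_ext2 {f g : P2 R →ₐ[R] S} (h0 : f (X 0) = g (X 0)) (h1 : f (X 1) = g (X 1)) : f = g := by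
  apply MvPolynomial.algHom_ext
  intro i; fin_cases i
  · exact h0
  · exact h1

lemma hom_eq_ev (f : P2 R →ₐ[R] S) (P : P2 R) : f P = ev (f (X 0)) (f (X 1)) P := by
  have : f = ev (f (X 0)) (f (X 1)) := hom_ext2 (by simp) (by simp)
  exact DFunLike.congr_fun this P

lemma hom_ev (f : S →ₐ[R] T) (F G : S) (P : P2 R) : f (ev F G P) = ev (f F) (f G) P := by
  have := hom_eq_ev (f.comp (ev (R := R) F G)) P
  simpa using this

lemma aut_eq_ev (f : Aut2 R) (P : P2 R) : f P = ev (f (X 0)) (f (X 1)) P :=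
  hom_eq_ev (f : P2 R →ₐ[R] P2 R) P

lemma aut_ev (f : Aut2 R) (F G : P2 R) (P : P2 R) : f (ev F G P) = ev (f F) (f G) P :=
  hom_ev (f : P2 R →ₐ[R] P2 R) F G P

@[simp] lemma ev_id (P : P2 R) : ev (X 0 : P2 R) (X 1) P = P :=
  (hom_eq_ev (AlgHom.id R (P2 R)) P).symm

lemma aut_ext {f g : Aut2 R} (h0 : f (X 0) = g (X 0)) (h1 : f (X 1) = g (X 1)) : f = g := by
  ext P
  rw [aut_eq_ev f, aut_eq_ev g, h0, h1]

lemma aut_C (f : Aut2 R) (a : R) : f (C a) = C a := f.commutes a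
lemma ev_C (F G : P2 R) (a : R) : ev F G (C a : P2 R) = C a := (ev F G).commutes a

noncomputable def mkAut (F G A B : P2 R) (h1 : ev F G A = X 0) (h2 : ev F G B = X 1)
    (h3 : ev A B F = X 0) (h4 : ev A B G = X 1) : Aut2 R :=
  AlgEquiv.ofAlgHom (ev F G) (ev A B) (hom_ext2 (by simpa using h1) (by simpa using h2))
    (hom_ext2 (by simpa using h3) (by simpa using h4))

@[simp] lemma mkAut_X0 (F G A B : P2 R) (h1 h2 h3 h4) : mkAut F G A B h1 h2 h3 h4 (X 0) = F := by
  simp [mkAut]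
@[simp] lemma mkAut_X1 (F G A B : P2 R) (h1 h2 h3 h4) : mkAut F G A B h1 h2 h3 h4 (X 1) = G := by
  simp [mkAut]

/-- polynomial in one variable evaluated at an element -/
lemma hom_aeval (f : P2 R →ₐ[R] S) (p : Polynomial R) (a : P2 R) :
    f (Polynomial.aeval a p) = Polynomial.aeval (f a) p := by
  rw [Polynomial.aeval_algHom_apply]

lemma aut_aeval (f : Aut2 R) (p : Polynomial R) (a : P2 R) :
    f (Polynomial.aeval a p) = Polynomial.aeval (f a) p :=
  hom_aeval (f : P2 R →ₐ[R] P2 R) p a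

noncomputable def elemA (p : Polynomial R) : Aut2 R :=
  mkAut (X 0 + Polynomial.aeval (X 1) p) (X 1) (X 0 - Polynomial.aeval (X 1) p) (X 1)
    (by simp [hom_aeval]) (by simp) (by simp [hom_aeval]) (by simp)
noncomputable def swapA : Aut2 R :=
  mkAut (X 1) (X 0) (X 1) (X 0) (by simp) (by simp) (by simp) (by simp)
noncomputable def torusA (a b : R) (h : a * b = 1) : Aut2 R :=
  mkAut (C a * X 0) (X 1) (C b * X 0) (X 1)
    (by rw [map_mul, ev_C, ev_X0, ← mul_assoc, ← C_mul, mul_comm b, h]; simp) (by simp)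
    (by rw [map_mul, ev_C, ev_X0, ← mul_assoc, ← C_mul, h]; simp) (by simp)

@[simp] lemma elemA_X0 (p : Polynomial R) : elemA p (X 0) = X 0 + Polynomial.aeval (X 1) p := by
  simp [elemA]
@[simp] lemma elemA_X1 (p : Polynomial R) : elemA p (X 1) = X 1 := by simp [elemA]
@[simp] lemma swapA_X0 : (swapA : Aut2 R) (X 0) = X 1 := by simp [swapA]
@[simp] lemma swapA_X1 : (swapA : Aut2 R) (X 1) = X 0 := by simp [swapA]
@[simp] lemma torusA_X0 (a b : R) (h) : torusA a b h (X 0) = C a * X 0 := by simp [torusA]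
@[simp] lemma torusA_X1 (a b : R) (h) : torusA a b h (X 1) = X 1 := by simp [torusA]

end basics

section basechange
variable {R S : Type*} [CommRing R] [CommRing S] (σ : R →+* S)

lemma map_ev (F G P : P2 R) : map σ (ev F G P) = ev (map σ F) (map σ G) (map σ P) := by
  induction P using MvPolynomial.induction_on with
  | C a => simp
  | add p q hp hq => simp [hp, hq]
  | mul_X p i hp =>
    rw [map_mul, map_mul, hp, map_mul, map_mul]
    congr 1
    fin_cases i <;> simp

lemma map_aeval1 (F : P2 R) (p : Polynomial R) :
    map σ (Polynomial.aeval F p) = Polynomial.aeval (map σ F) (p.map σ) := by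
  rw [Polynomial.aeval_def, Polynomial.hom_eval₂, Polynomial.aeval_def, Polynomial.eval₂_map]
  congr 1
  ext a; simp [MvPolynomial.algebraMap_eq]

noncomputable def bc : Aut2 R →* Aut2 S where
  toFun f := mkAut (map σ (f (X 0))) (map σ (f (X 1))) (map σ (f.symm (X 0))) (map σ (f.symm (X 1)))
    (by rw [← map_ev, ← aut_eq_ev]; simp) (by rw [← map_ev, ← aut_eq_ev]; simp)
    (by rw [← map_ev, ← aut_eq_ev]; simp) (by rw [← map_ev, ← aut_eq_ev]; simp)
  map_one' := aut_ext (by simp) (by simp)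
  map_mul' f g := aut_ext
    (by simp only [mkAut_X0, AlgEquiv.mul_apply]
        rw [aut_eq_ev f (g (X 0)), map_ev, aut_eq_ev (mkAut _ _ _ _ _ _ _ _)]; simp)
    (by simp only [mkAut_X1, AlgEquiv.mul_apply]
        rw [aut_eq_ev f (g (X 1)), map_ev, aut_eq_ev (mkAut _ _ _ _ _ _ _ _)]; simp)

@[simp] lemma bc_X0 (f : Aut2 R) : bc σ f (X 0) = map σ (f (X 0)) := by simp [bc]
@[simp] lemma bc_X1 (f : Aut2 R) : bc σ f (X 1) = map σ (f (X 1)) := by simp [bc]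
lemma bc_map (f : Aut2 R) (P : P2 R) : bc σ f (map σ P) = map σ (f P) := by
  rw [aut_eq_ev, bc_X0, bc_X1, ← map_ev, ← aut_eq_ev]

end basechange

section jac
variable {R : Type*} [CommRing R]

lemma der_ev (D : Derivation R (P2 R) (P2 R)) (F G P : P2 R) :
    D (ev F G P) = ev F G (pderiv 0 P) * D F + ev F G (pderiv 1 P) * D G := by
  induction P using MvPolynomial.induction_on with
  | C a => simp
  | add p q hp hq => simp only [map_add, hp, hq]; ring
  | mul_X p i hp =>
    rw [map_mul, D.leibniz, hp]
    fin_cases i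
    · simp [pderiv_X]; ring
    · simp [pderiv_X]; ring

/-- Jacobian determinant -/
noncomputable def jac (F G : P2 R) : P2 R := pderiv 0 F * pderiv 1 G - pderiv 1 F * pderiv 0 G

/-- bracket derivation -/
noncomputable def jd (F : P2 R) : Derivation R (P2 R) (P2 R) :=
  pderiv 0 F • pderiv 1 - pderiv 1 F • pderiv 0

lemma jd_apply (F G : P2 R) : jd F G = jac F G := by simp [jd, jac]

@[simp] lemma jac_self (F : P2 R) : jac F F = 0 := by simp [jac]; ring
lemma jac_swap (F G : P2 R) : jac F G = - jac G F := by simp [jac]; ring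

lemma jac_ev_right (F G P : P2 R) : jac F (ev F G P) = ev F G (pderiv 1 P) * jac F G := by
  rw [← jd_apply, der_ev]; simp [jd_apply]

lemma jac_comp (F G P Q : P2 R) : jac (ev F G P) (ev F G Q) = ev F G (jac P Q) * jac F G := by
  simp only [jac, der_ev, map_sub, map_mul]; ring

lemma jac_aut_unit (f : Aut2 R) : IsUnit (jac (f (X 0)) (f (X 1))) := by
  have h := jac_comp (f (X 0)) (f (X 1)) (f.symm (X 0)) (f.symm (X 1))
  rw [← aut_eq_ev, ← aut_eq_ev] at h
  have h1 : jac (X 0 : P2 R) (X 1) = 1 := by simp [jac, pderiv_X]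
  rw [AlgEquiv.apply_symm_apply, AlgEquiv.apply_symm_apply, h1] at h
  exact IsUnit.of_mul_eq_one_right _ h.symm

end jac


section grading
variable {R : Type*} [CommRing R]

noncomputable def gr (a b : ℕ) : P2 R →ₐ[R] Polynomial (P2 R) :=
  ev (Polynomial.monomial a (X 0)) (Polynomial.monomial b (X 1))

lemma monomial_eq2 (s : Fin 2 →₀ ℕ) (c : R) :
    (monomial s c : P2 R) = C c * (X 0 ^ s 0 * X 1 ^ s 1) := by
  rw [monomial_eq, Finsupp.prod_fintype _ _ (by simp)]
  simp

lemma ev_monomial {S : Type*} [CommRing S] [Algebra R S] (F G : S) (s : Fin 2 →₀ ℕ) (c : R) :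
    ev F G (monomial s c : P2 R) = algebraMap R S c * (F ^ s 0 * G ^ s 1) := by
  rw [monomial_eq2, map_mul, map_mul, map_pow, map_pow, ev_X0, ev_X1]
  congr 1
  exact (ev F G).commutes c

lemma gr_monomial (a b : ℕ) (s : Fin 2 →₀ ℕ) (c : R) :
    gr a b (monomial s c) = Polynomial.monomial (a * s 0 + b * s 1) (monomial s c) := by
  rw [gr, ev_monomial, Polynomial.monomial_pow, Polynomial.monomial_pow,
    Polynomial.monomial_mul_monomial, monomial_eq2]
  rw [IsScalarTower.algebraMap_apply R (P2 R) (Polynomial (P2 R)), Polynomial.algebraMap_eq,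
    Polynomial.C_mul_monomial, MvPolynomial.algebraMap_eq]

noncomputable def wc (a b d : ℕ) (P : P2 R) : P2 R := (gr a b P).coeff d
noncomputable def wdeg (a b : ℕ) (P : P2 R) : ℕ := (gr a b P).natDegree
noncomputable def tdeg (P : P2 R) : ℕ := wdeg 1 1 P

lemma wc_add (a b d : ℕ) (P Q : P2 R) : wc a b d (P + Q) = wc a b d P + wc a b d Q := by
  simp [wc]
lemma wc_sub (a b d : ℕ) (P Q : P2 R) : wc a b d (P - Q) = wc a b d P - wc a b d Q := by
  simp [wc]

lemma wc_monomial (a b d : ℕ) (s : Fin 2 →₀ ℕ) (c : R) :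
    wc a b d (monomial s c) = if a * s 0 + b * s 1 = d then monomial s c else 0 := by
  rw [wc, gr_monomial, Polynomial.coeff_monomial]

lemma coeff_wc (a b d : ℕ) (P : P2 R) (s : Fin 2 →₀ ℕ) :
    coeff s (wc a b d P) = if a * s 0 + b * s 1 = d then coeff s P else 0 := by
  classical
  induction P using MvPolynomial.induction_on' with
  | monomial t c =>
    rw [wc_monomial]
    by_cases hts : t = s
    · subst hts; split_ifs <;> simp
    · split_ifs <;> simp [coeff_monomial, hts]
  | add p q hp hq => rw [wc_add, coeff_add, hp, hq, coeff_add]; split_ifs <;> simp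

lemma wdeg_le_iff (a b D : ℕ) (P : P2 R) :
    wdeg a b P ≤ D ↔ ∀ s, coeff s P ≠ 0 → a * s 0 + b * s 1 ≤ D := by
  rw [wdeg, Polynomial.natDegree_le_iff_coeff_eq_zero]
  constructor
  · intro h s hs
    by_contra hlt
    push Not at hlt
    have := congrArg (coeff s) (h _ hlt)
    rw [← wc, coeff_wc, if_pos rfl] at this
    exact hs (by simpa using this)
  · intro h N hN
    ext s
    rw [← wc, coeff_wc]
    split_ifs with h1
    · by_contra hc
      have := h s (by simpa using hc)
      omega
    · simp

lemma le_wdeg {a b : ℕ} {P : P2 R} {s : Fin 2 →₀ ℕ} (h : coeff s P ≠ 0) :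
    a * s 0 + b * s 1 ≤ wdeg a b P := (wdeg_le_iff a b _ P).1 le_rfl s h

lemma le_wdeg_of_wc {a b d : ℕ} {P : P2 R} (h : wc a b d P ≠ 0) : d ≤ wdeg a b P :=
  Polynomial.le_natDegree_of_ne_zero h

lemma gr_injective (a b : ℕ) : Function.Injective (gr (R := R) a b) := by
  intro P Q h
  ext s
  have := congrArg (fun p => coeff s (Polynomial.coeff p (a * s 0 + b * s 1))) h
  change coeff s (wc a b _ P) = coeff s (wc a b _ Q) at this
  simpa only [coeff_wc, if_true] using this

lemma wc_wdeg_ne {a b : ℕ} {P : P2 R} (h : P ≠ 0) : wc a b (wdeg a b P) P ≠ 0 := by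
  rw [wc, wdeg, Polynomial.coeff_natDegree, Polynomial.leadingCoeff_ne_zero]
  intro h0
  exact h (gr_injective a b (by simpa using h0))

lemma wdeg_add_le {a b : ℕ} {P Q : P2 R} {D : ℕ} (h1 : wdeg a b P ≤ D) (h2 : wdeg a b Q ≤ D) :
    wdeg a b (P + Q) ≤ D := by
  rw [wdeg, map_add]; exact Polynomial.natDegree_add_le_of_degree_le h1 h2
lemma wdeg_sub_le {a b : ℕ} {P Q : P2 R} {D : ℕ} (h1 : wdeg a b P ≤ D) (h2 : wdeg a b Q ≤ D) :
    wdeg a b (P - Q) ≤ D := by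
  rw [wdeg, map_sub]; exact Polynomial.natDegree_sub_le_of_le h1 h2 |>.trans (by simp)
lemma wdeg_mul_le {a b : ℕ} {P Q : P2 R} {D E : ℕ} (h1 : wdeg a b P ≤ D) (h2 : wdeg a b Q ≤ E) :
    wdeg a b (P * Q) ≤ D + E := by
  rw [wdeg, map_mul]; exact Polynomial.natDegree_mul_le_of_le h1 h2
lemma wdeg_mul [IsDomain R] {a b : ℕ} {P Q : P2 R} (h1 : P ≠ 0) (h2 : Q ≠ 0) :
    wdeg a b (P * Q) = wdeg a b P + wdeg a b Q := by
  have h : ∀ P : P2 R, P ≠ 0 → gr a b P ≠ 0 := fun P hP h0 =>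
    hP (gr_injective a b (by simpa using h0))
  rw [wdeg, map_mul, Polynomial.natDegree_mul (h _ h1) (h _ h2)]; rfl
lemma wdeg_pow [IsDomain R] {a b : ℕ} {P : P2 R} (n : ℕ) :
    wdeg a b (P ^ n) = n * wdeg a b P := by
  rw [wdeg, map_pow, Polynomial.natDegree_pow]; rfl
@[simp] lemma wdeg_C (a b : ℕ) (c : R) : wdeg a b (C c) = 0 := by
  rw [← Nat.le_zero, wdeg_le_iff]
  intro s hs
  rw [coeff_C] at hs
  by_cases h : 0 = s
  · subst h; simp
  · simp [h] at hs
@[simp] lemma wdeg_zero (a b : ℕ) : wdeg a b (0 : P2 R) = 0 := by simp [wdeg]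

lemma wc_ev {F G P : P2 R} {n m D : ℕ} (hF : tdeg F ≤ n) (hG : tdeg G ≤ m) (hP : wdeg n m P ≤ D) :
    tdeg (ev F G P) ≤ D ∧ wc 1 1 D (ev F G P) = ev (wc 1 1 n F) (wc 1 1 m G) (wc n m D P) := by
  have key : ∀ s : Fin 2 →₀ ℕ, ∀ c : R, n * s 0 + m * s 1 ≤ D →
      tdeg (ev F G (monomial s c)) ≤ D ∧
      wc 1 1 D (ev F G (monomial s c)) = ev (wc 1 1 n F) (wc 1 1 m G) (wc n m D (monomial s c)) := by
    intro s c hs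
    have e1 : gr 1 1 (ev F G (monomial s c)) =
        Polynomial.C (C c) * (gr 1 1 F ^ s 0 * gr 1 1 G ^ s 1) := by
      rw [ev_monomial, map_mul, map_mul, map_pow, map_pow]; congr 1
      rw [AlgHom.commutes]; rfl
    have d1 : (gr 1 1 F ^ s 0).natDegree ≤ n * s 0 := by
      rw [mul_comm]; exact Polynomial.natDegree_pow_le_of_le _ hF
    have d2 : (gr 1 1 G ^ s 1).natDegree ≤ m * s 1 := by
      rw [mul_comm]; exact Polynomial.natDegree_pow_le_of_le _ hG
    have d3 : (gr 1 1 F ^ s 0 * gr 1 1 G ^ s 1).natDegree ≤ n * s 0 + m * s 1 :=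
      Polynomial.natDegree_mul_le_of_le d1 d2
    have d4 : (Polynomial.C (C c) * (gr 1 1 F ^ s 0 * gr 1 1 G ^ s 1)).natDegree ≤
      n * s 0 + m * s 1 := (Polynomial.natDegree_C_mul_le _ _).trans d3
    constructor
    · rw [tdeg, wdeg, e1]; exact d4.trans hs
    · rw [wc_monomial, wc, e1]
      split_ifs with h
      · rw [ev_monomial, Polynomial.coeff_C_mul, ← h, Polynomial.coeff_mul_add_eq_of_natDegree_le d1 d2,
          mul_comm n, mul_comm m, Polynomial.coeff_pow_of_natDegree_le hF,
          Polynomial.coeff_pow_of_natDegree_le hG]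
        rfl
      · rw [map_zero (ev (wc 1 1 n F) (wc 1 1 m G))]
        exact Polynomial.coeff_eq_zero_of_natDegree_lt (by omega)
  have hsum := P.support_sum_monomial_coeff
  have hs : ∀ s ∈ P.support, n * s 0 + m * s 1 ≤ D := fun s hs =>
    (wdeg_le_iff n m D P).1 hP s (mem_support_iff.1 hs)
  generalize P.support = U at hsum hs
  rw [← hsum]
  clear hsum
  induction U using Finset.cons_induction with
  | empty => simp [tdeg, wc]
  | cons s U hU ih =>
    have h1 := key s (coeff s P) (hs s (by simp))
    have h2 := ih (fun t ht => hs t (by simp [ht]))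
    rw [Finset.sum_cons, map_add, wc_add, wc_add, map_add]
    exact ⟨wdeg_add_le h1.1 h2.1, by rw [h1.2, h2.2]⟩

lemma wc_pderiv1 (n m D : ℕ) (P : P2 R) (h : m ≤ D) :
    wc n m (D - m) (pderiv 1 P) = pderiv 1 (wc n m D P) := by
  ext s
  rw [coeff_wc, coeff_pderiv, coeff_pderiv, coeff_wc]
  have : (n * (s + Finsupp.single (1 : Fin 2) 1 : Fin 2 →₀ ℕ) 0 +
      m * (s + Finsupp.single (1 : Fin 2) 1 : Fin 2 →₀ ℕ) 1 = D) ↔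
      (n * s 0 + m * s 1 = D - m) := by
    simp [mul_add]; omega
  by_cases h2 : n * s 0 + m * s 1 = D - m
  · rw [if_pos h2, if_pos (this.2 h2)]
  · rw [if_neg h2, if_neg (fun h3 => h2 (this.1 h3))]; simp

lemma tdeg_pderiv_lt (i : Fin 2) (P : P2 R) (h : pderiv i P ≠ 0) :
    tdeg (pderiv i P) + 1 ≤ tdeg P := by
  obtain ⟨s, hs⟩ := MvPolynomial.ne_zero_iff.1 h
  have hpos : 1 ≤ tdeg P := by
    rw [coeff_pderiv] at hs
    have := le_wdeg (a := 1) (b := 1) (left_ne_zero_of_mul hs)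
    unfold tdeg
    fin_cases i <;> simp at this <;> omega
  have : tdeg (pderiv i P) ≤ tdeg P - 1 := by
    unfold tdeg
    rw [wdeg_le_iff]
    intro t ht
    rw [coeff_pderiv] at ht
    have := le_wdeg (a := 1) (b := 1) (left_ne_zero_of_mul ht)
    fin_cases i <;> simp at this <;> omega
  omega

lemma tdeg_jac [IsDomain R] (F G : P2 R) (h : jac F G ≠ 0) : tdeg (jac F G) + 2 ≤ tdeg F + tdeg G := by
  have key : ∀ i j : Fin 2, pderiv i F * pderiv j G ≠ 0 →
      tdeg (pderiv i F * pderiv j G) + 2 ≤ tdeg F + tdeg G := by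
    intro i j hij
    have h1 := left_ne_zero_of_mul hij
    have h2 := right_ne_zero_of_mul hij
    have e1 := tdeg_pderiv_lt i F h1
    have e2 := tdeg_pderiv_lt j G h2
    have : tdeg (pderiv i F * pderiv j G) = tdeg (pderiv i F) + tdeg (pderiv j G) := wdeg_mul h1 h2
    omega
  have hle : 2 ≤ tdeg F + tdeg G := by
    by_contra hc
    apply h
    have h1 : pderiv 0 F * pderiv 1 G = 0 := by
      by_contra h0; have := key 0 1 h0; omega
    have h2 : pderiv 1 F * pderiv 0 G = 0 := by
      by_contra h0; have := key 1 0 h0; omega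
    simp [jac, h1, h2]
  have : tdeg (jac F G) ≤ tdeg F + tdeg G - 2 := by
    apply wdeg_sub_le
    · by_cases h0 : pderiv 0 F * pderiv 1 G = 0
      · rw [h0]; simp
      · have := key 0 1 h0; unfold tdeg at *; omega
    · by_cases h0 : pderiv 1 F * pderiv 0 G = 0
      · rw [h0]; simp
      · have := key 1 0 h0; unfold tdeg at *; omega
  omega

end grading


lemma rootMult_lt_card {L : Type*} [CommRing L] [IsDomain L] [CharZero L] {g : L} (hg : g ≠ 0) :
    ∀ (k : ℕ) (p : Polynomial L), p ≠ 0 → p.support.card ≤ k → p.rootMultiplicity g + 1 ≤ k := by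
  intro k
  induction k with
  | zero =>
    intro p hp hk
    exact absurd (by simpa using hk) hp
  | succ k ih =>
    intro p hp hk
    by_cases hm : p.rootMultiplicity g = 0
    · omega
    obtain ⟨b, hb⟩ : p.support.Nonempty := by simpa using hp
    set q := Polynomial.X * p.derivative - Polynomial.C (b : L) * p with hq
    have hc : ∀ i, q.coeff i = ((i : L) - b) * p.coeff i := by
      intro i
      rw [hq, Polynomial.coeff_sub, Polynomial.coeff_C_mul]
      cases i with
      | zero => simp
      | succ i => rw [Polynomial.coeff_X_mul, Polynomial.coeff_derivative]; push_cast; ring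
    have hsupp : q.support ⊆ p.support.erase b := by
      intro i hi
      rw [Polynomial.mem_support_iff, hc] at hi
      rw [Finset.mem_erase, Polynomial.mem_support_iff]
      refine ⟨fun h => hi (by simp [h]), right_ne_zero_of_mul hi⟩
    have hcard : q.support.card ≤ k := by
      have := Finset.card_le_card hsupp
      rw [Finset.card_erase_of_mem hb] at this
      omega
    set j := p.rootMultiplicity g with hj
    have hd : (Polynomial.X - Polynomial.C g) ^ j ∣ p := Polynomial.pow_rootMultiplicity_dvd p g
    by_cases hq0 : q = 0
    · exfalso
      -- then p is a monomial
      have hp1 : ∀ i, i ≠ b → p.coeff i = 0 := by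
        intro i hi
        have h0 : q.coeff i = 0 := by simp [hq0]
        rw [hc] at h0
        rcases mul_eq_zero.1 h0 with h | h
        · exact absurd (by exact_mod_cast sub_eq_zero.1 h) hi
        · exact h
      have hp2 : p = Polynomial.monomial b (p.coeff b) := by
        ext i
        rw [Polynomial.coeff_monomial]
        split_ifs with h
        · rw [h]
        · exact hp1 i (fun h' => h h'.symm)
      have hroot : p.eval g = 0 := (Polynomial.rootMultiplicity_pos hp).1 (by omega)
      rw [hp2, Polynomial.eval_monomial] at hroot
      rcases mul_eq_zero.1 hroot with h | h
      · exact (Polynomial.mem_support_iff.1 hb) h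
      · exact pow_ne_zero _ hg h
    · have h1 : (Polynomial.X - Polynomial.C g) ^ (j - 1) ∣ q := by
        rw [hq]
        apply dvd_sub
        · apply Dvd.dvd.mul_left
          exact Polynomial.pow_sub_one_dvd_derivative_of_pow_dvd hd
        · exact Dvd.dvd.mul_left ((pow_dvd_pow _ (by omega)).trans hd) _
      have h2 : j - 1 ≤ q.rootMultiplicity g := (Polynomial.le_rootMultiplicity_iff hq0).2 h1
      have := ih q hq0 hcard
      omega

section theta
variable {R L : Type*} [CommRing R] [CommRing L] [Algebra R L]

noncomputable def theta (f : L) (P : P2 R) : Polynomial L := ev (Polynomial.C f) Polynomial.X P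

lemma theta_eval (f g : L) (P : P2 R) : (theta f P).eval g = ev f g P := by
  have := hom_ev (Polynomial.aeval (R := L) g |>.restrictScalars R) (Polynomial.C f) Polynomial.X P
  simpa [theta, Polynomial.aeval_def] using this

lemma theta_monomial (f : L) (s : Fin 2 →₀ ℕ) (c : R) :
    theta f (monomial s c) = Polynomial.monomial (s 1) (algebraMap R L c * f ^ s 0) := by
  rw [theta, ev_monomial, IsScalarTower.algebraMap_apply R L (Polynomial L), Polynomial.algebraMap_eq,
    ← mul_assoc, ← Polynomial.C_pow, ← Polynomial.C_mul, Polynomial.C_mul_X_pow_eq_monomial]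

lemma theta_derivative (f : L) (P : P2 R) : (theta f P).derivative = theta f (pderiv 1 P) := by
  induction P using MvPolynomial.induction_on' with
  | monomial s c =>
    rw [theta_monomial, Polynomial.derivative_monomial, pderiv_monomial, theta_monomial]
    have h0 : (s - Finsupp.single 1 1 : Fin 2 →₀ ℕ) 0 = s 0 := by simp
    have h1 : (s - Finsupp.single 1 1 : Fin 2 →₀ ℕ) 1 = s 1 - 1 := by simp
    rw [h0, h1]; congr 1; simp; ring
  | add p q hp hq => simp only [theta, map_add] at *; rw [hp, hq]

lemma theta_iter (f : L) (P : P2 R) (j : ℕ) :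
    Polynomial.derivative^[j] (theta f P) = theta f ((pderiv 1)^[j] P) := by
  induction j generalizing P with
  | zero => rfl
  | succ j ih => rw [Function.iterate_succ_apply, theta_derivative, ih, Function.iterate_succ_apply]

lemma theta_coeff (f : L) (P : P2 R) (b : ℕ) :
    (theta f P).coeff b = ∑ s ∈ P.support, if s 1 = b then algebraMap R L (coeff s P) * f ^ s 0 else 0 := by
  conv_lhs => rw [← P.support_sum_monomial_coeff]
  rw [theta, map_sum, Polynomial.finsetSum_coeff]
  apply Finset.sum_congr rfl
  intro s _
  rw [← theta, theta_monomial, Polynomial.coeff_monomial]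

lemma theta_coeff_ne (f : L) (P : P2 R) (b : ℕ) (h : (theta f P).coeff b ≠ 0) :
    ∃ s, coeff s P ≠ 0 ∧ s 1 = b := by
  rw [theta_coeff] at h
  obtain ⟨s, hs, h1⟩ := Finset.exists_ne_zero_of_sum_ne_zero h
  refine ⟨s, mem_support_iff.1 hs, ?_⟩
  by_contra hc
  simp [hc] at h1

lemma theta_ne_zero [IsDomain L] [FaithfulSMul R L] {f : L} (hf : f ≠ 0) {P : P2 R} (hP : P ≠ 0) {n m D : ℕ}
    (hn : 0 < n) (hw : ∀ s, coeff s P ≠ 0 → n * s 0 + m * s 1 = D) : theta f P ≠ 0 := by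
  obtain ⟨s, hs⟩ := MvPolynomial.ne_zero_iff.1 hP
  intro h0
  have h1 : (theta f P).coeff (s 1) = 0 := by rw [h0]; simp
  rw [theta_coeff, Finset.sum_eq_single s] at h1
  · rw [if_pos rfl] at h1
    rcases mul_eq_zero.1 h1 with h | h
    · exact hs ((FaithfulSMul.algebraMap_eq_zero_iff R L).1 h)
    · exact pow_ne_zero _ hf h
  · intro t ht hts
    rw [if_neg]
    intro h2
    apply hts
    have e1 := hw s hs
    have e2 := hw t (mem_support_iff.1 ht)
    rw [h2] at e2
    have e3 : n * t 0 = n * s 0 := by omega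
    have e4 := Nat.eq_of_mul_eq_mul_left hn e3
    ext i; fin_cases i
    · exact e4
    · exact h2
  · intro h; exact absurd (mem_support_iff.2 hs) h
end theta


section jung
variable {R : Type*} [CommRing R]

lemma wc_wc (a b d : ℕ) (P : P2 R) : wc a b d (wc a b d P) = wc a b d P := by
  ext s; rw [coeff_wc, coeff_wc]; split_ifs <;> rfl

lemma wdeg_wc {a b d : ℕ} {P : P2 R} (h : wc a b d P ≠ 0) : wdeg a b (wc a b d P) = d := by
  apply le_antisymm
  · rw [wdeg_le_iff]; intro s hs; rw [coeff_wc] at hs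
    by_contra hc
    rw [if_neg (by omega)] at hs; exact hs rfl
  · apply le_wdeg_of_wc; rwa [wc_wc]

lemma tdeg_lt {P : P2 R} {m : ℕ} (h : tdeg P ≤ m) (h0 : wc 1 1 m P = 0) (hm : 0 < m) :
    tdeg P < m := by
  rcases h.lt_or_eq with h1 | h1
  · exact h1
  · exfalso
    have hP : P ≠ 0 := by rintro rfl; simp [tdeg] at h1; omega
    have := wc_wdeg_ne (a := 1) (b := 1) hP
    rw [← tdeg, h1] at this
    exact this h0

lemma tdeg_le_one {P : P2 R} (h : tdeg P ≤ 1) : ∃ a b c : R, P = C a * X 0 + C b * X 1 + C c := by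
  classical
  refine ⟨coeff (Finsupp.single 0 1) P, coeff (Finsupp.single 1 1) P, coeff 0 P, ?_⟩
  ext s
  simp only [coeff_add, coeff_C_mul, coeff_X, coeff_C]
  have hd := (wdeg_le_iff 1 1 1 P).1 h s
  have e01 : (Finsupp.single 0 1 : Fin 2 →₀ ℕ) ≠ Finsupp.single 1 1 := by
    intro h; have := DFunLike.congr_fun h 0; simp at this
  have e00 : (0 : Fin 2 →₀ ℕ) ≠ Finsupp.single 0 1 := by
    intro h; have := DFunLike.congr_fun h 0; simp at this
  have e10 : (0 : Fin 2 →₀ ℕ) ≠ Finsupp.single 1 1 := by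
    intro h; have := DFunLike.congr_fun h 1; simp at this
  by_cases h0 : Finsupp.single 0 1 = s
  · subst h0; simp [e01.symm, e00]
  by_cases h1 : Finsupp.single 1 1 = s
  · subst h1; simp [e01, e10]
  by_cases h2 : 0 = s
  · subst h2; simp [e00.symm, e10.symm]
  simp only [h0, h1, h2, if_false]
  by_contra hc
  have h3 := hd (by simpa using hc)
  have : s 0 = 0 ∧ s 1 = 0 ∨ s 0 = 1 ∧ s 1 = 0 ∨ s 0 = 0 ∧ s 1 = 1 := by omega
  rcases this with ⟨x, y⟩ | ⟨x, y⟩ | ⟨x, y⟩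
  · exact h2 (by ext i; fin_cases i <;> simp [x, y])
  · exact h0 (by ext i; fin_cases i <;> simp [x, y])
  · exact h1 (by ext i; fin_cases i <;> simp [x, y])

lemma tdeg_eq_zero {P : P2 R} (h : tdeg P = 0) : ∃ c : R, P = C c := by
  refine ⟨coeff 0 P, ?_⟩
  ext s
  have hd := (wdeg_le_iff 1 1 0 P).1 (by rw [← tdeg, h]) s
  rw [coeff_C]
  split_ifs with h2
  · rw [h2]
  · by_contra hc
    have h3 := hd hc
    exact h2 (by ext i; fin_cases i <;> simp <;> omega)

lemma tdeg_X (i : Fin 2) : tdeg (X i : P2 R) ≤ 1 := by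
  rw [tdeg, wdeg_le_iff]
  intro s hs
  rw [coeff_X] at hs
  by_cases h : Finsupp.single i 1 = s
  · subst h; fin_cases i <;> simp
  · simp [h] at hs

lemma wdeg_pderiv1 {n m D : ℕ} {P : P2 R} (h : wdeg n m P ≤ D) : wdeg n m (pderiv 1 P) ≤ D - m := by
  rw [wdeg_le_iff]
  intro s hs
  rw [coeff_pderiv] at hs
  have := (wdeg_le_iff n m D P).1 h _ (left_ne_zero_of_mul hs)
  simp [mul_add] at this
  omega

lemma iter_pderiv1 (n m D : ℕ) (P : P2 R) (h : wdeg n m P ≤ D) (j : ℕ) (hj : j * m ≤ D) :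
    wdeg n m ((pderiv 1)^[j] P) ≤ D - j * m ∧
    wc n m (D - j * m) ((pderiv 1)^[j] P) = (pderiv 1)^[j] (wc n m D P) := by
  induction j with
  | zero => simpa using h
  | succ j ih =>
    rw [add_mul, one_mul] at hj
    obtain ⟨h1, h2⟩ := ih (by omega)
    rw [Function.iterate_succ_apply', Function.iterate_succ_apply', add_mul, one_mul, ← Nat.sub_sub]
    refine ⟨wdeg_pderiv1 h1, ?_⟩
    rw [wc_pderiv1 _ _ _ _ (by omega), h2]

lemma tdeg_aut_pos [IsDomain R] (φ : Aut2 R) (i : Fin 2) : 1 ≤ tdeg (φ (X i)) := by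
  by_contra hc
  obtain ⟨c, hc⟩ := tdeg_eq_zero (P := φ (X i)) (by omega)
  rw [← aut_C φ] at hc
  have := φ.injective hc
  have := congrArg (coeff (Finsupp.single i 1)) this
  rw [coeff_X, coeff_C, if_pos rfl, if_neg] at this
  · exact one_ne_zero this
  · intro h; have := DFunLike.congr_fun h i; simp at this

end jung

section jung2
variable {K : Type*} [Field K] [CharZero K]

lemma jung_H (φ : Aut2 K) (i : Fin 2) (j : ℕ) (h : φ ((pderiv 1)^[j] (φ.symm (X i))) ≠ 0) :
    tdeg (φ ((pderiv 1)^[j] (φ.symm (X i)))) + 2 * j ≤ j * tdeg (φ (X 0)) + 1 := by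
  induction j with
  | zero => simpa using tdeg_X i
  | succ j ih =>
    rw [Function.iterate_succ_apply'] at h ⊢
    set Q := (pderiv 1)^[j] (φ.symm (X i)) with hQ
    have hQ0 : φ Q ≠ 0 := by
      intro h0
      have : Q = 0 := by simpa using h0
      rw [this] at h; simp at h
    have hj := jac_ev_right (φ (X 0)) (φ (X 1)) Q
    rw [← aut_eq_ev, ← aut_eq_ev] at hj
    have hu : jac (φ (X 0)) (φ (X 1)) ≠ 0 := (jac_aut_unit φ).ne_zero
    have hne : jac (φ (X 0)) (φ Q) ≠ 0 := by rw [hj]; exact mul_ne_zero h hu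
    have h1 := tdeg_jac _ _ hne
    rw [hj, tdeg, wdeg_mul h hu] at h1
    have := ih hQ0
    rw [add_mul]
    unfold tdeg at *
    omega

lemma jung_exP (φ : Aut2 K) {n m : ℕ} (hn : 1 ≤ n) (hm : 2 ≤ m) :
    ∃ i, 2 ≤ wdeg n m (φ.symm (X i)) := by
  by_contra hc
  push Not at hc
  have key : ∀ i, pderiv 1 (φ.symm (X i)) = 0 := by
    intro i
    ext s
    rw [coeff_pderiv]
    have : coeff (s + Finsupp.single 1 1) (φ.symm (X i)) = 0 := by
      by_contra h
      have h1 := le_wdeg (a := n) (b := m) h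
      have h2 := hc i
      simp [mul_add] at h1
      omega
    rw [this]; simp
  have := (jac_aut_unit φ.symm).ne_zero
  apply this
  simp [jac, key]

lemma jung_div {f g Φ : P2 K} {n s D : ℕ} (hf : f ≠ 0) (hn : 1 ≤ n)
    (hΦ : Φ ≠ 0) (hw : ∀ t, coeff t Φ ≠ 0 → n * t 0 + (n * s) * t 1 = D) (h0 : ev f g Φ = 0) :
    ∃ q, g = q * f ^ s := by
  let L := FractionRing (P2 K)
  let ι := algebraMap (P2 K) L
  have hι : Function.Injective ι := IsFractionRing.injective (P2 K) L
  have hf' : ι f ≠ 0 := by rwa [Ne, map_eq_zero_iff ι hι]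
  set r : L := ι g / ι f ^ s with hr
  have hg : ι g = r * ι f ^ s := by exact (div_mul_cancel₀ _ (pow_ne_zero _ hf')).symm
  obtain ⟨e, he⟩ : ∃ e, D = n * e := by
    obtain ⟨t, ht⟩ := MvPolynomial.ne_zero_iff.1 hΦ
    exact ⟨t 0 + s * t 1, by rw [← hw t ht]; ring⟩
  have h1 : ev (ι f) (ι g) Φ = ι f ^ e * ev (1 : L) r Φ := by
    rw [← Φ.support_sum_monomial_coeff, map_sum, map_sum, Finset.mul_sum]
    apply Finset.sum_congr rfl
    intro t ht
    have h2 := hw t (mem_support_iff.1 ht)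
    have h3 : e = t 0 + s * t 1 := by
      apply Nat.eq_of_mul_eq_mul_left hn
      rw [← he, ← h2]; ring
    rw [ev_monomial, ev_monomial, hg, h3, mul_pow, ← pow_mul, pow_add]; ring
  have h2 : ev (ι f) (ι g) Φ = 0 := by
    have := hom_ev (IsScalarTower.toAlgHom K (P2 K) L) f g Φ
    rw [h0, map_zero] at this
    exact this.symm
  have h3 : ev (1 : L) r Φ = 0 := by
    rw [h1] at h2
    exact (mul_eq_zero.1 h2).resolve_left (pow_ne_zero _ hf')
  have h4 : theta (1 : K) Φ ≠ 0 := theta_ne_zero one_ne_zero hΦ hn hw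
  have h5 : Polynomial.aeval r (theta (1 : K) Φ) = 0 := by
    rw [theta, hom_ev]; simpa using h3
  have h6 : IsIntegral K r := by
    rw [← isAlgebraic_iff_isIntegral]; exact ⟨_, h4, h5⟩
  have h7 : IsIntegral (P2 K) r := h6.tower_top
  obtain ⟨q, hq⟩ := IsIntegrallyClosed.isIntegral_iff.1 h7
  refine ⟨q, hι ?_⟩
  rw [map_mul, map_pow, hg, ← hq]

lemma jung_step (φ : Aut2 K) (hnm : tdeg (φ (X 0)) ≤ tdeg (φ (X 1))) (hm : 2 ≤ tdeg (φ (X 1))) :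
    ∃ (c : K) (s : ℕ), tdeg (φ (X 1) - C c * φ (X 0) ^ s) < tdeg (φ (X 1)) := by
  set F := φ (X 0) with hF
  set G := φ (X 1) with hG
  set n := tdeg F with hnd
  set m := tdeg G with hmd
  have hn : 1 ≤ n := tdeg_aut_pos φ 0
  obtain ⟨i, hi⟩ := jung_exP φ hn hm
  set P := φ.symm (X i) with hP
  set D := wdeg n m P with hD
  have hF0 : F ≠ 0 := by intro h; rw [hnd, h] at hn; simp [tdeg] at hn
  have hG0 : G ≠ 0 := by intro h; rw [hmd, h] at hm; simp [tdeg] at hm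
  have hP0 : P ≠ 0 := by intro h; rw [hD, h] at hi; simp at hi
  set f := wc 1 1 n F
  set g := wc 1 1 m G
  set Φ := wc n m D P with hΦd
  have hf : f ≠ 0 := wc_wdeg_ne hF0
  have hg : g ≠ 0 := wc_wdeg_ne hG0
  have hΦ : Φ ≠ 0 := wc_wdeg_ne hP0
  have hw : ∀ s, coeff s Φ ≠ 0 → n * s 0 + m * s 1 = D := by
    intro s hs
    rw [hΦd, coeff_wc] at hs
    by_contra hc
    rw [if_neg hc] at hs; exact hs rfl
  have hev : ev F G P = X i := by rw [hF, hG, ← aut_eq_ev, hP, AlgEquiv.apply_symm_apply]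
  have hz : ev f g Φ = 0 := by
    have h0 := (wc_ev (F := F) (G := G) (P := P) (n := n) (m := m) (D := D) le_rfl le_rfl le_rfl).2
    rw [hev] at h0
    rw [← h0]
    by_contra hc
    have h1 := le_wdeg_of_wc hc
    have h2 := tdeg_X (R := K) i
    unfold tdeg at h2
    omega
  by_cases hdvd : n ∣ m
  · obtain ⟨s, hs⟩ := hdvd
    obtain ⟨q, hq⟩ := jung_div (s := s) hf hn hΦ (by rw [← hs]; exact hw) hz
    have hq0 : q ≠ 0 := by rintro rfl; simp at hq; exact hg hq
    have hqd : tdeg q = 0 := by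
      have h1 := wdeg_wc (a := 1) (b := 1) (d := m) (P := G) hg
      have h2 : wdeg 1 1 f = n := wdeg_wc (a := 1) (b := 1) (d := n) (P := F) hf
      change wdeg 1 1 g = m at h1
      rw [hq, wdeg_mul hq0 (pow_ne_zero _ hf), wdeg_pow, h2, hs, mul_comm s] at h1
      unfold tdeg; omega
    obtain ⟨c, rfl⟩ := tdeg_eq_zero hqd
    refine ⟨c, s, ?_⟩
    have hFs : tdeg (C c * F ^ s) ≤ m := by
      rw [← zero_add m, hs, mul_comm n]
      refine wdeg_mul_le (by simp) ?_
      rw [wdeg_pow]; rfl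
    apply tdeg_lt (m := m) (wdeg_sub_le le_rfl hFs) _ (by omega)
    rw [wc_sub]
    have : wc 1 1 m (C c * F ^ s) = C c * f ^ s := by
      have h1 : gr 1 1 (C c * F ^ s) = Polynomial.C (C c) * (gr 1 1 F) ^ s := by
        rw [map_mul, map_pow]; congr 1; exact (gr 1 1).commutes c
      rw [wc, h1, Polynomial.coeff_C_mul, hs, mul_comm n, Polynomial.coeff_pow_of_natDegree_le (n := n) le_rfl]
      rfl
    rw [this, ← hq]; exact sub_self _
  · exfalso
    set θ := theta f Φ with hθd
    have hθ : θ ≠ 0 := theta_ne_zero hf hΦ hn hw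
    have hroot : θ.IsRoot g := by rw [Polynomial.IsRoot, theta_eval]; exact hz
    set j := θ.rootMultiplicity g with hj
    have hj1 : 1 ≤ j := (Polynomial.rootMultiplicity_pos hθ).2 hroot
    have hcard : j + 1 ≤ θ.support.card := rootMult_lt_card hg _ θ hθ le_rfl
    have hinj : Set.InjOn (fun b : ℕ => b / 2) (θ.support : Set ℕ) := by
      have aux : ∀ b, θ.coeff b ≠ 0 → θ.coeff (b + 1) ≠ 0 → False := by
        intro b h1 h2
        obtain ⟨s, hs, rfl⟩ := theta_coeff_ne f Φ _ h1
        obtain ⟨t, ht, ht1⟩ := theta_coeff_ne f Φ _ h2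
        have e1 := hw s hs
        have e2 := hw t ht
        rw [ht1, mul_add] at e2
        apply hdvd
        have : n * s 0 = n * t 0 + m := by omega
        exact (Nat.dvd_add_right (dvd_mul_right n (t 0))).1 (this ▸ dvd_mul_right n (s 0))
      intro b hb b' hb' h
      simp only [SetLike.mem_coe, Polynomial.mem_support_iff] at hb hb' h
      by_contra hne
      rcases lt_or_gt_of_ne hne with hlt | hlt
      · have : b' = b + 1 := by omega
        exact aux b hb (this ▸ hb')
      · have : b = b' + 1 := by omega
        exact aux b' hb' (this ▸ hb)
    have hcard2 : θ.support.card ≤ θ.natDegree / 2 + 1 := by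
      rw [← Finset.card_image_of_injOn hinj, ← Finset.card_range (θ.natDegree / 2 + 1)]
      apply Finset.card_le_card
      intro b hb
      obtain ⟨b', hb', rfl⟩ := Finset.mem_image.1 hb
      have := Polynomial.le_natDegree_of_mem_supp _ hb'
      rw [Finset.mem_range]
      exact Nat.lt_succ_of_le (Nat.div_le_div_right this)
    have hdeg : 2 * j ≤ θ.natDegree := by omega
    obtain ⟨s, hs, hs1⟩ := theta_coeff_ne f Φ θ.natDegree
      (by rw [← hθd, Polynomial.coeff_natDegree]; exact Polynomial.leadingCoeff_ne_zero.2 hθ)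
    have hDs := hw s hs
    rw [hs1] at hDs
    have h2jm : m * (2 * j) ≤ D := by
      have := Nat.mul_le_mul_left m hdeg
      omega
    have hjm : j * m ≤ D := by nlinarith
    obtain ⟨i1, i2⟩ := iter_pderiv1 n m D P le_rfl j hjm
    have hwc := (wc_ev (F := F) (G := G) le_rfl le_rfl i1).2
    rw [i2, hF, hG, ← aut_eq_ev] at hwc
    have hne : ev f g ((pderiv 1)^[j] Φ) ≠ 0 := by
      rw [← theta_eval, ← theta_iter, ← hθd, hj, Polynomial.eval_iterate_derivative_rootMultiplicity]
      rw [nsmul_eq_mul]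
      refine mul_ne_zero (Nat.cast_ne_zero.2 (Nat.factorial_ne_zero _)) ?_
      exact Polynomial.eval_divByMonic_pow_rootMultiplicity_ne_zero g hθ
    change wc 1 1 (D - j * m) (φ ((pderiv 1)^[j] P)) = ev f g ((pderiv 1)^[j] Φ) at hwc
    rw [← hwc] at hne
    have h1 := le_wdeg_of_wc hne
    have h2 := jung_H φ i j (by intro h; rw [← hP] at h; rw [h] at hne; simp [wc] at hne)
    rw [← hP, ← hF, ← hnd] at h2
    unfold tdeg at h2
    have h3 : j * n ≤ j * m := Nat.mul_le_mul_left j hnm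
    have h4 : m * (2 * j) = 2 * (j * m) := by ring
    omega

end jung2


section gens
variable {R : Type*} [CommRing R]
lemma mul_app (f g : Aut2 R) (P : P2 R) : (f * g) P = f (g P) := Eq.trans (AlgEquiv.mul_apply f g P) (Eq.refl _)
lemma one_app (P : P2 R) : (1 : Aut2 R) P = P := Eq.trans (AlgEquiv.one_apply P) (Eq.refl _)
lemma alg_C (a : R) : algebraMap R (P2 R) a = C a := Eq.trans (by rw [MvPolynomial.algebraMap_eq]) (Eq.refl (C a))
lemma elemA_mul_neg (p : Polynomial R) : elemA p * elemA (-p) = 1 :=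
  aut_ext (by simp [aut_aeval]) (by simp)
lemma elemA_neg_mul (p : Polynomial R) : elemA (-p) * elemA p = 1 :=
  aut_ext (by simp [aut_aeval]) (by simp)
lemma swapA_mul : (swapA : Aut2 R) * swapA = 1 := aut_ext (by simp) (by simp)
lemma torusA_mul (a b : R) (h : a * b = 1) (h' : b * a = 1) : torusA a b h * torusA b a h' = 1 := by
  apply aut_ext
  · simp only [AlgEquiv.mul_apply, torusA_X0, map_mul, aut_C, AlgEquiv.one_apply]
    rw [← mul_assoc, ← C_mul, h']; simp
  · simp
end gens

section jung3
variable {K : Type*} [Field K] [CharZero K]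

lemma pderiv0_aeval {R : Type*} [CommRing R] (q : Polynomial R) :
    pderiv 0 (Polynomial.aeval (X 1 : P2 R) q) = 0 := by
  rw [Polynomial.aeval_def, Polynomial.eval₂_eq_sum, Polynomial.sum, map_sum]
  apply Finset.sum_eq_zero
  intro i _
  rw [alg_C, pderiv_C_mul, pderiv_pow, pderiv_X]; simp

lemma tri_ne (φ : Aut2 K) (a b c : K) (q : Polynomial K)
    (h0 : φ (X 0) = C a * X 0 + Polynomial.aeval (X 1) q)
    (h1 : φ (X 1) = C b * X 1 + C c) : a ≠ 0 ∧ b ≠ 0 := by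
  have hu := (jac_aut_unit φ).ne_zero
  rw [h0, h1] at hu
  constructor
  · rintro rfl
    apply hu
    simp [jac, pderiv_X, pderiv0_aeval]
  · rintro rfl
    apply hu
    simp [jac]

lemma tri_word (φ : Aut2 K) (a b c : K) (q : Polynomial K) (ha : a ≠ 0) (hb : b ≠ 0)
    (h0 : φ (X 0) = C a * X 0 + Polynomial.aeval (X 1) q)
    (h1 : φ (X 1) = C b * X 1 + C c) :
    φ * elemA (-(q.comp (Polynomial.C b⁻¹ * (Polynomial.X - Polynomial.C c)))) *
      torusA a⁻¹ a (inv_mul_cancel₀ ha) * swapA * torusA b⁻¹ b (inv_mul_cancel₀ hb) *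
      elemA (Polynomial.C (-(b⁻¹ * c))) * swapA = 1 := by
  have hbb : (C b⁻¹ * (C b * X 1 + C c - C c) : P2 K) = X 1 := by
    rw [add_sub_cancel_right, ← mul_assoc, ← C_mul, inv_mul_cancel₀ hb]; simp
  apply aut_ext
  · simp only [mul_app, torusA_X0, torusA_X1, elemA_X0, elemA_X1, swapA_X0, swapA_X1, map_mul,
      map_add, aut_C, aut_aeval, h0, h1, map_neg, Polynomial.aeval_comp, map_sub, Polynomial.aeval_C,
      Polynomial.aeval_X, alg_C, one_app]
    rw [hbb, add_neg_cancel_right, ← mul_assoc, ← C_mul, inv_mul_cancel₀ ha]; simp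
  · simp only [mul_app, torusA_X0, torusA_X1, elemA_X0, elemA_X1, swapA_X0, swapA_X1, map_mul,
      map_add, aut_C, h1, map_neg, Polynomial.aeval_C,
      alg_C, one_app]
    rw [mul_add, ← mul_assoc, ← C_mul, inv_mul_cancel₀ hb]; simp

lemma aff_word (φ : Aut2 K) (a b c a' b' c' : K) (h0 : φ (X 0) = C a * X 0 + C b * X 1 + C c)
    (h1 : φ (X 1) = C a' * X 0 + C b' * X 1 + C c') (ha : a' ≠ 0) :
    (φ * elemA (Polynomial.C (-(a/a')) * Polynomial.X) * swapA : Aut2 K) (X 1) =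
      C (b - (a/a') * b') * X 1 + C (c - (a/a') * c') := by
  simp only [mul_app, elemA_X0, swapA_X1, map_add, h0, h1, map_mul,
    Polynomial.aeval_X, Polynomial.aeval_C, alg_C, aut_C]
  have : C a = (C (a/a') * C a' : P2 K) := by rw [← C_mul, div_mul_cancel₀ _ ha]
  rw [this]
  simp only [map_sub, map_mul, map_neg]
  ring

lemma red_word (φ : Aut2 K) (c : K) (s : ℕ) :
    (φ * swapA * elemA (-(Polynomial.C c * Polynomial.X ^ s)) * swapA : Aut2 K) (X 0) = φ (X 0) ∧
    (φ * swapA * elemA (-(Polynomial.C c * Polynomial.X ^ s)) * swapA : Aut2 K) (X 1) =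
      φ (X 1) - C c * φ (X 0) ^ s := by
  constructor
  · simp only [mul_app, swapA_X0, elemA_X1, swapA_X1]
  · simp only [mul_app, swapA_X0, elemA_X0, swapA_X1, map_add, map_neg, map_mul, map_pow,
      Polynomial.aeval_X, Polynomial.aeval_C, alg_C, aut_C]
    ring

theorem jung_ind {p : Aut2 K → Prop} (h1 : p 1) (he : ∀ φ q, p φ → p (φ * elemA q))
    (hs : ∀ φ, p φ → p (φ * swapA)) (ht : ∀ φ a b h, p φ → p (φ * torusA a b h)) (φ : Aut2 K) :
    p φ := by
  have he' : ∀ φ q, p (φ * elemA q) → p φ := fun φ q h => by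
    have := he _ (-q) h
    rwa [mul_assoc, elemA_mul_neg, mul_one] at this
  have hs' : ∀ φ, p (φ * swapA) → p φ := fun φ h => by
    have := hs _ h
    rwa [mul_assoc, swapA_mul, mul_one] at this
  have ht' : ∀ φ a b h, p (φ * torusA a b h) → p φ := fun φ a b h hp => by
    have := ht _ b a (by rw [mul_comm, h]) hp
    rwa [mul_assoc, torusA_mul, mul_one] at this
  have tri : ∀ (φ : Aut2 K) (a b c : K) (q : Polynomial K), φ (X 0) = C a * X 0 + Polynomial.aeval (X 1) q →
      φ (X 1) = C b * X 1 + C c → p φ := by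
    intro φ a b c q h0 h1'
    obtain ⟨ha, hb⟩ := tri_ne φ a b c q h0 h1'
    have hw := tri_word φ a b c q ha hb h0 h1'
    rw [← hw] at h1
    exact he' _ _ (ht' _ _ _ _ (hs' _ (ht' _ _ _ _ (he' _ _ (hs' _ h1)))))
  have step : ∀ N, (∀ φ : Aut2 K, tdeg (φ (X 0)) + tdeg (φ (X 1)) ≤ N → p φ) →
      ∀ φ : Aut2 K, tdeg (φ (X 0)) + tdeg (φ (X 1)) ≤ N + 1 →
          tdeg (φ (X 0)) ≤ tdeg (φ (X 1)) → p φ := by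
    intro N ih φ h hle
    by_cases hm : 2 ≤ tdeg (φ (X 1))
    · obtain ⟨c, s, hlt⟩ := jung_step φ hle hm
      refine hs' _ (he' _ (-(Polynomial.C c * Polynomial.X ^ s)) (hs' _ (ih _ ?_)))
      rw [(red_word φ c s).1, (red_word φ c s).2]
      omega
    · obtain ⟨a, b, c, h0⟩ := tdeg_le_one (P := φ (X 0)) (by omega)
      obtain ⟨a', b', c', h1'⟩ := tdeg_le_one (P := φ (X 1)) (by omega)
      by_cases ha : a' = 0
      · apply tri φ a b' c' (Polynomial.C b * Polynomial.X + Polynomial.C c)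
        · rw [h0]; simp only [map_add, map_mul, Polynomial.aeval_X, Polynomial.aeval_C, alg_C]; ring
        · rw [h1', ha]; simp
      · refine he' _ (Polynomial.C (-(a/a')) * Polynomial.X) (hs' _ ?_)
        apply tri _ a' _ _ (Polynomial.C b' * Polynomial.X + Polynomial.C c') _ (aff_word φ a b c a' b' c' h0 h1' ha)
        simp only [mul_app, swapA_X0, elemA_X1, h1', map_add, map_mul, Polynomial.aeval_X,
          Polynomial.aeval_C, alg_C]
        ring
  have main : ∀ N, ∀ φ : Aut2 K, tdeg (φ (X 0)) + tdeg (φ (X 1)) ≤ N → p φ := by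
    intro N
    induction N with
    | zero => intro φ h; have := tdeg_aut_pos φ 0; omega
    | succ N ih =>
      intro φ h
      rcases le_total (tdeg (φ (X 0))) (tdeg (φ (X 1))) with hle | hle
      · exact step N ih φ h hle
      · apply hs'
        apply step N ih
        · simp only [mul_app, swapA_X0, swapA_X1]; omega
        · simpa only [mul_app, swapA_X0, swapA_X1] using hle
  exact main _ φ le_rfl

end jung3


lemma bool_l1 {t u : Bool} (h : t = !u) : u = !t := by rw [h]; simp
lemma bool_l2 {t u : Bool} (h : ¬ t = u) : t = !u := by cases t <;> cases u <;> simp_all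

section amalg
variable {G : Type*} [Group G] (S : Bool → Subgroup G)

def altW : Bool → List G → Prop
  | _, [] => True
  | t, g :: l => (g ∈ S t ∧ g ∉ S (!t)) ∧ altW (!t) l

def nxt : Bool → List G → Bool
  | t, [] => t
  | t, _ :: l => nxt (!t) l

lemma altW_append (t : Bool) (l l' : List G) :
    altW S t (l ++ l') ↔ altW S t l ∧ altW S (nxt t l) l' := by
  induction l generalizing t with
  | nil => simp [altW, nxt]
  | cons g l ih => simp [altW, nxt, ih, and_assoc]

lemma nxt_append (t : Bool) (l l' : List G) : nxt t (l ++ l') = nxt (nxt t l) l' := by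
  induction l generalizing t with
  | nil => simp [nxt]
  | cons g l ih => simp [nxt, ih]

lemma altW_map (bar : G →* G) (hb : ∀ t g, g ∈ S t ↔ bar g ∈ S t) (t : Bool) (l : List G)
    (h : altW S t l) : altW S t (l.map bar) := by
  induction l generalizing t with
  | nil => trivial
  | cons g l ih =>
    exact ⟨⟨(hb _ _).1 h.1.1, fun h' => h.1.2 ((hb _ _).2 h')⟩, ih _ h.2⟩

lemma nxt_map (bar : G → G) (t : Bool) (l : List G) : nxt t (l.map bar) = nxt t l := by
  induction l generalizing t with
  | nil => rfl
  | cons g l ih => exact ih _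

lemma mul_type_left {t : Bool} {c g : G} (hc : c ∈ S t) (hc' : c ∈ S (!t)) (hg : g ∈ S t ∧ g ∉ S (!t)) :
    c * g ∈ S t ∧ c * g ∉ S (!t) :=
  ⟨(S t).mul_mem hc hg.1, fun h => hg.2 ((Subgroup.mul_mem_cancel_left _ hc').1 h)⟩
lemma mul_type_right {t : Bool} {c g : G} (hc : c ∈ S t) (hc' : c ∈ S (!t)) (hg : g ∈ S t ∧ g ∉ S (!t)) :
    g * c ∈ S t ∧ g * c ∉ S (!t) :=
  ⟨(S t).mul_mem hg.1 hc, fun h => hg.2 ((Subgroup.mul_mem_cancel_right _ hc').1 h)⟩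

def NFm (ν : G) : Prop := (ν ∈ S true ∧ ν ∈ S false) ∨ ∃ t l, altW S t l ∧ l ≠ [] ∧ ν = l.prod

lemma NFm_mul {t : Bool} {a ν : G} (ha : a ∈ S t) (h : NFm S ν) : NFm S (a * ν) := by
  have bb : ∀ t g, g ∈ S t → g ∈ S (!t) → (g ∈ S true ∧ g ∈ S false) := by
    intro t g h1 h2; cases t
    · exact ⟨h2, h1⟩
    · exact ⟨h1, h2⟩
  have single : ∀ t g, g ∈ S t → NFm S g := by
    intro t g hg
    by_cases h2 : g ∈ S (!t)
    · exact Or.inl (bb t g hg h2)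
    · exact Or.inr ⟨t, [g], ⟨⟨hg, h2⟩, trivial⟩, by simp, by simp⟩
  have hall : ∀ ν : G, (ν ∈ S true ∧ ν ∈ S false) → ∀ t, ν ∈ S t := by
    intro ν h t; cases t
    · exact h.2
    · exact h.1
  rcases h with h | ⟨u, l, hl, hne, rfl⟩
  · exact single t _ ((S t).mul_mem ha (hall _ h t))
  · cases l with
    | nil => exact absurd rfl hne
    | cons g l =>
      obtain ⟨hg, hl⟩ := hl
      rw [List.prod_cons, ← mul_assoc]
      have absorb : ∀ c : G, (c ∈ S true ∧ c ∈ S false) → NFm S (c * l.prod) := by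
        intro c hc
        cases l with
        | nil => left; simpa using hc
        | cons g' l =>
          refine Or.inr ⟨_, (c * g') :: l, ⟨mul_type_left S (hall c hc _) (hall c hc _) hl.1, hl.2⟩, by simp, ?_⟩
          simp [mul_assoc]
      by_cases hut : u = t
      · subst hut
        by_cases h2 : a * g ∈ S (!u)
        · exact absorb _ (bb u _ ((S u).mul_mem ha hg.1) h2)
        · exact Or.inr ⟨u, (a * g) :: l, ⟨⟨(S u).mul_mem ha hg.1, h2⟩, hl⟩, by simp, by simp⟩
      · have hu : u = !t := by cases u <;> cases t <;> simp_all
        subst hu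
        by_cases h2 : a ∈ S (!t)
        · refine Or.inr ⟨_, (a * g) :: l, ⟨mul_type_left S h2 (by simpa using ha) hg, hl⟩, by simp, by simp⟩
        · refine Or.inr ⟨t, a :: g :: l, ⟨⟨ha, h2⟩, hg, hl⟩, by simp, by simp [mul_assoc]⟩

theorem amalg_coc (bar : G →* G) (hbb : ∀ g, bar (bar g) = g) (hb : ∀ t g, g ∈ S t ↔ bar g ∈ S t)
    (hfree : ∀ t l, altW S t l → l ≠ [] → l.prod ≠ 1) (hNF : ∀ ν, NFm S ν)
    (ν : G) (hν : ν * bar ν = 1) : ∃ g t, g⁻¹ * ν * bar g ∈ S t := by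
  rcases hNF ν with h | ⟨t, l, hl, hne, rfl⟩
  · exact ⟨1, true, by simpa using h.1⟩
  · clear hne
    obtain ⟨n, hn⟩ : ∃ n, l.length = n := ⟨_, rfl⟩
    induction n using Nat.strong_induction_on generalizing t l with
    | _ n ih =>
      match l, hl, hn, hν with
      | [], _, _, _ => exact ⟨1, true, by simp⟩
      | [g], hl, _, _ => exact ⟨1, t, by simpa using hl.1.1⟩
      | g :: g' :: l', hl, hn, hν =>
        obtain ⟨m, h, hm⟩ : ∃ m h, g' :: l' = m ++ [h] := by
          rcases List.eq_nil_or_concat (g' :: l') with h | ⟨m, h, hm⟩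
          · simp at h
          · exact ⟨m, h, by simpa using hm⟩
        rw [hm] at hl hn hν ⊢
        obtain ⟨hg, hl⟩ := hl
        rw [altW_append] at hl
        obtain ⟨hm1, hh, -⟩ := hl
        set t' := nxt (!t) m with ht'
        have hgb : bar g ∈ S t ∧ bar g ∉ S (!t) := ⟨(hb _ _).1 hg.1, fun h' => hg.2 ((hb _ _).2 h')⟩
        have hbl : altW S (!t) ((m ++ [h]).map bar) := altW_map S bar hb _ _ (by
          rw [altW_append]; exact ⟨hm1, hh, trivial⟩)
        have hprod : (g :: (m ++ [h])).prod * bar (g :: (m ++ [h])).prod =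
            ((g :: m) ++ ([h] ++ (bar g :: (m ++ [h]).map bar))).prod := by
          simp [mul_assoc, map_list_prod]
        by_cases htt : t' = t
        · -- same type
          rw [htt] at hh
          by_cases hd : h * bar g ∈ S (!t)
          · have hd1 : h * bar g ∈ S t := (S t).mul_mem hh.1 hgb.1
            have hc' : ∀ m : List G, (g⁻¹ * (g :: (m ++ [h])).prod * bar g) = m.prod * (h * bar g) := by
              intro m; simp [mul_assoc]
            have hcoc : (g⁻¹ * (g :: (m ++ [h])).prod * bar g) * bar (g⁻¹ * (g :: (m ++ [h])).prod * bar g) = 1 := by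
              rw [map_mul, map_mul, hbb, map_inv]
              generalize (g :: (m ++ [h])).prod = ν at hν
              calc _ = g⁻¹ * (ν * bar ν) * g := by group
                _ = 1 := by rw [hν]; group
            have trans : ∀ μ : G, μ = g⁻¹ * (g :: (m ++ [h])).prod * bar g →
                (∃ k t, k⁻¹ * μ * bar k ∈ S t) → ∃ k t, k⁻¹ * (g :: (m ++ [h])).prod * bar k ∈ S t := by
              rintro μ rfl ⟨k, t, hk⟩
              refine ⟨g * k, t, ?_⟩
              rw [mul_inv_rev, map_mul]
              simpa only [mul_assoc] using hk
            rcases List.eq_nil_or_concat m with rfl | ⟨m1, e, rfl⟩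
            · refine trans (h * bar g) (by rw [hc']; simp) ⟨1, t, by simpa using hd1⟩
            · rw [List.concat_eq_append] at *
              rw [altW_append] at hm1
              have hte : nxt (!t) m1 = !t := by
                have : nxt (!t) (m1 ++ [e]) = !(nxt (!t) m1) := by rw [nxt_append]; rfl
                rw [this] at ht'
                rw [htt] at ht'
                exact bool_l1 ht'
              rw [hte] at hm1
              have he := hm1.2.1
              refine trans (m1 ++ [e * (h * bar g)]).prod (by rw [hc']; simp [mul_assoc]) ?_
              apply ih (m1.length + 1) (by simp at hn; omega) (!t) (m1 ++ [e * (h * bar g)])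
              · rw [altW_append, hte]
                exact ⟨hm1.1, mul_type_right S hd (by simpa using hd1) he, trivial⟩
              · rw [hc'] at hcoc
                have : (m1 ++ [e * (h * bar g)]).prod = (m1 ++ [e]).prod * (h * bar g) := by simp [mul_assoc]
                rw [this]; exact hcoc
              · simp
          · exfalso
            refine hfree t (g :: (m ++ ((h * bar g) :: (m ++ [h]).map bar))) ?_ (by simp) ?_
            · refine ⟨hg, ?_⟩
              rw [altW_append, ← ht', htt]
              exact ⟨hm1, ⟨(S t).mul_mem hh.1 hgb.1, hd⟩, hbl⟩
            · rw [← hν, hprod]; simp only [List.prod_cons, List.prod_append, List.prod_nil, mul_assoc, mul_one, one_mul]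
        · exfalso
          refine hfree t (g :: (m ++ (h :: bar g :: (m ++ [h]).map bar))) ?_ (by simp) ?_
          · have h1 : t' = !t := bool_l2 htt
            refine ⟨hg, ?_⟩
            rw [altW_append, ← ht', h1]
            rw [h1] at hh
            refine ⟨hm1, hh, ?_⟩
            rw [Bool.not_not]
            exact ⟨hgb, hbl⟩
          · rw [← hν, hprod]; simp [mul_assoc]
end amalg


section degs
variable {R : Type*} [CommRing R]

lemma ker_pderiv0 [IsDomain R] [CharZero R] {P : P2 R} (h : pderiv 0 P = 0) :
    ∃ p : Polynomial R, P = Polynomial.aeval (X 1) p := by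
  refine ⟨∑ s ∈ P.support, Polynomial.monomial (s 1) (coeff s P), ?_⟩
  conv_lhs => rw [← P.support_sum_monomial_coeff]
  rw [map_sum]
  apply Finset.sum_congr rfl
  intro s hs
  rw [Polynomial.aeval_monomial, monomial_eq2, alg_C]
  have : s 0 = 0 := by
    by_contra h0
    have h1 := congrArg (coeff (s - Finsupp.single 0 1)) h
    rw [coeff_pderiv] at h1
    have h2 : s - Finsupp.single 0 1 + Finsupp.single 0 1 = s := by
      apply tsub_add_cancel_of_le
      rw [Finsupp.single_le_iff]; omega
    rw [h2] at h1
    rcases mul_eq_zero.1 (h1.trans (coeff_zero _)) with h3 | h3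
    · exact (mem_support_iff.1 hs) h3
    · exact Nat.cast_add_one_ne_zero _ h3
  rw [this]; simp

lemma tdeg_C_mul [IsDomain R] {a : R} (ha : a ≠ 0) (P : P2 R) : tdeg (C a * P) = tdeg P := by
  by_cases hP : P = 0
  · simp [hP]
  · rw [tdeg, wdeg_mul (by simpa using ha) hP]; simp [tdeg]

lemma tdeg_add_left {P Q : P2 R} (h : tdeg Q < tdeg P) : tdeg (P + Q) = tdeg P := by
  rw [tdeg, wdeg, map_add]; exact Polynomial.natDegree_add_eq_left_of_natDegree_lt h
lemma tdeg_add_right {P Q : P2 R} (h : tdeg P < tdeg Q) : tdeg (P + Q) = tdeg Q := by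
  rw [add_comm, tdeg_add_left h]
@[simp] lemma tdeg_C (c : R) : tdeg (C c : P2 R) = 0 := wdeg_C _ _ c

lemma tdeg_aeval [IsDomain R] (G : P2 R) (p : Polynomial R) :
    tdeg (Polynomial.aeval G p) = p.natDegree * tdeg G := by
  have h : gr 1 1 (Polynomial.aeval G p) = (p.map (algebraMap R (P2 R))).comp (gr 1 1 G) := by
    rw [← Polynomial.aeval_algHom_apply, Polynomial.aeval_def, Polynomial.comp, Polynomial.eval₂_map]
    rfl
  rw [tdeg, wdeg, h, Polynomial.natDegree_comp, Polynomial.natDegree_map_eq_of_injective]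
  · rfl
  · exact MvPolynomial.C_injective _ _

lemma tdeg_map {S : Type*} [CommRing S] {σ : R →+* S} (hσ : Function.Injective σ) (P : P2 R) :
    tdeg (map σ P) = tdeg P := by
  have h : ∀ D, tdeg (map σ P) ≤ D ↔ tdeg P ≤ D := by
    intro D
    unfold tdeg
    rw [wdeg_le_iff, wdeg_le_iff]
    simp only [coeff_map, ne_eq, map_eq_zero_iff σ hσ]
  exact le_antisymm ((h _).2 le_rfl) ((h _).1 le_rfl)

end degs

section H1
variable {K : Type*} [Field K] [CharZero K]

lemma tri_x (φ : Aut2 K) {b c : K} (h : φ (X 1) = C b * X 1 + C c) :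
    ∃ (a : K) (p : Polynomial K), a ≠ 0 ∧ b ≠ 0 ∧ φ (X 0) = C a * X 0 + Polynomial.aeval (X 1) p := by
  have hu := jac_aut_unit φ
  rw [h] at hu
  have hj : jac (φ (X 0)) (C b * X 1 + C c) = pderiv 0 (φ (X 0)) * C b := by
    simp [jac, pderiv_X]
  rw [hj] at hu
  have h1 := isUnit_of_mul_isUnit_left hu
  rw [MvPolynomial.isUnit_iff_eq_C_of_isReduced] at h1
  obtain ⟨a, -, ha⟩ := h1
  obtain ⟨p, hp⟩ := ker_pderiv0 (P := φ (X 0) - C a * X 0) (by simp [ha, pderiv_X])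
  have hx : φ (X 0) = C a * X 0 + Polynomial.aeval (X 1) p := by rw [← hp]; ring
  obtain ⟨h2, h3⟩ := tri_ne φ a b c p hx h
  exact ⟨a, p, h2, h3, hx⟩

def affA : Subgroup (Aut2 K) where
  carrier := {φ | ∀ P, tdeg P ≤ 1 ↔ tdeg (φ P) ≤ 1}
  mul_mem' := by
    intro f g hf hg P
    rw [mul_app, ← hf, ← hg]
  one_mem' := by intro P; rw [one_app]
  inv_mem' := by
    intro f hf P
    rw [hf (f⁻¹ P), ← mul_app, mul_inv_cancel, one_app]

lemma inv_y (f : Aut2 K) {b c : K} (hb : b ≠ 0) (h : f (X 1) = C b * X 1 + C c) :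
    f⁻¹ (X 1) = C b⁻¹ * X 1 + C (- (b⁻¹ * c)) := by
  apply f.injective
  rw [← mul_app, mul_inv_cancel, one_app, map_add, map_mul, aut_C, aut_C, h, mul_add, ← mul_assoc, ← C_mul,
    inv_mul_cancel₀ hb]
  simp

def triB : Subgroup (Aut2 K) where
  carrier := {φ | ∃ b c, φ (X 1) = C b * X 1 + C c}
  mul_mem' := by
    rintro f g ⟨b, c, hf⟩ ⟨b', c', hg⟩
    refine ⟨b' * b, b' * c + c', ?_⟩
    rw [mul_app, hg, map_add, map_mul, aut_C, aut_C, hf]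
    simp only [map_add, map_mul]; ring
  one_mem' := ⟨1, 0, by rw [one_app]; simp⟩
  inv_mem' := by
    rintro f ⟨b, c, hf⟩
    obtain ⟨a, p, ha, hb, hx⟩ := tri_x f hf
    exact ⟨_, _, inv_y f hb hf⟩

def ABs : Bool → Subgroup (Aut2 K)
  | true => affA
  | false => triB

lemma NFm_all (φ : Aut2 K) : NFm ABs φ := by
  have key : ∀ φ : Aut2 K, NFm ABs φ⁻¹ := by
    intro φ
    induction φ using jung_ind with
    | h1 => left; rw [inv_one]; exact ⟨one_mem _, one_mem _⟩
    | he φ q ih =>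
      rw [mul_inv_rev]
      refine NFm_mul ABs (t := false) (inv_mem ?_) ih
      exact ⟨1, 0, by simp⟩
    | hs φ ih =>
      rw [mul_inv_rev]
      refine NFm_mul ABs (t := true) (inv_mem ?_) ih
      have hsw : ∀ P : P2 K, tdeg P ≤ 1 → tdeg (swapA P) ≤ 1 := by
        intro P hP
        obtain ⟨a, b, c, rfl⟩ := tdeg_le_one hP
        simp only [map_add, map_mul, aut_C, swapA_X0, swapA_X1]
        refine wdeg_add_le (wdeg_add_le ?_ ?_) (by simp)
        · exact wdeg_mul_le (D := 0) (E := 1) (by simp) (tdeg_X 1)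
        · exact wdeg_mul_le (D := 0) (E := 1) (by simp) (tdeg_X 0)
      intro P
      refine ⟨hsw P, fun h => ?_⟩
      have := hsw _ h
      rwa [← mul_app, swapA_mul, one_app] at this
    | ht φ a b h ih =>
      rw [mul_inv_rev]
      refine NFm_mul ABs (t := false) (inv_mem ?_) ih
      exact ⟨1, 0, by simp⟩
  simpa using key φ⁻¹

lemma affA_mk (φ : Aut2 K) {b c : K} (h : φ (X 1) = C b * X 1 + C c) (hx : tdeg (φ (X 0)) ≤ 1) :
    φ ∈ affA (K := K) := by
  have lin : ∀ ψ : Aut2 K, tdeg (ψ (X 0)) ≤ 1 → tdeg (ψ (X 1)) ≤ 1 → ∀ P, tdeg P ≤ 1 → tdeg (ψ P) ≤ 1 := by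
    intro ψ h0 h1 P hP
    obtain ⟨a, b, c, rfl⟩ := tdeg_le_one hP
    simp only [map_add, map_mul, aut_C]
    refine wdeg_add_le (wdeg_add_le ?_ ?_) (by simp)
    · exact wdeg_mul_le (D := 0) (E := 1) (by simp) h0
    · exact wdeg_mul_le (D := 0) (E := 1) (by simp) h1
  have ty : ∀ b c : K, tdeg (C b * X 1 + C c) ≤ 1 := by
    intro b c
    exact wdeg_add_le (wdeg_mul_le (D := 0) (E := 1) (by simp) (tdeg_X 1)) (by simp)
  obtain ⟨a, p, ha, hb, hp⟩ := tri_x φ h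
  have hiy := inv_y φ hb h
  have hpd : tdeg (Polynomial.aeval (X 1 : P2 K) p) ≤ 1 := by
    have : Polynomial.aeval (X 1 : P2 K) p = φ (X 0) - C a * X 0 := by rw [hp]; ring
    rw [this]
    exact wdeg_sub_le hx (wdeg_mul_le (D := 0) (E := 1) (by simp) (tdeg_X 0))
  have hpd' : p.natDegree ≤ 1 := by
    rw [tdeg_aeval] at hpd
    have h1 : 1 ≤ tdeg (X 1 : P2 K) := by simpa using tdeg_aut_pos (1 : Aut2 K) 1
    nlinarith
  have hix : tdeg (φ⁻¹ (X 0)) ≤ 1 := by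
    have : φ⁻¹ (X 0) = C a⁻¹ * (X 0 - Polynomial.aeval (φ⁻¹ (X 1)) p) := by
      apply φ.injective
      rw [← mul_app, mul_inv_cancel, one_app, map_mul, map_sub, aut_aeval, ← mul_app, mul_inv_cancel, one_app,
        aut_C, hp, add_sub_cancel_right, ← mul_assoc, ← C_mul, inv_mul_cancel₀ ha]
      simp
    rw [this]
    refine wdeg_mul_le (D := 0) (E := 1) (by simp) (wdeg_sub_le (tdeg_X 0) ?_)
    change tdeg _ ≤ 1
    rw [tdeg_aeval, hiy]
    have := ty b⁻¹ (-(b⁻¹ * c))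
    nlinarith
  intro P
  constructor
  · exact lin φ hx (by rw [h]; exact ty b c) P
  · intro hP
    have := lin φ⁻¹ hix (by rw [hiy]; exact ty _ _) _ hP
    rwa [← mul_app, inv_mul_cancel, one_app] at this

lemma letB {φ h : Aut2 K} (hB : h ∈ triB (K := K)) (hA : h ∉ affA (K := K))
    (hd : tdeg (φ (X 0)) ≤ tdeg (φ (X 1))) : tdeg ((φ * h) (X 1)) < tdeg ((φ * h) (X 0)) := by
  obtain ⟨b, c, hy⟩ := hB
  obtain ⟨a, p, ha, hb, hx⟩ := tri_x h hy
  have hp : 2 ≤ p.natDegree := by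
    by_contra hc
    apply hA
    apply affA_mk h hy
    rw [hx]
    refine wdeg_add_le (wdeg_mul_le (D := 0) (E := 1) (by simp) (tdeg_X 0)) ?_
    change tdeg _ ≤ 1
    rw [tdeg_aeval]
    have := tdeg_X (R := K) 1
    nlinarith
  have h1 := tdeg_aut_pos φ 1
  rw [mul_app, mul_app, hx, hy]
  simp only [map_add, map_mul, aut_C, aut_aeval]
  rw [tdeg_add_left (by rw [tdeg_C, tdeg_C_mul hb]; omega), tdeg_C_mul hb, tdeg_add_right]
  · rw [tdeg_aeval]; nlinarith
  · rw [tdeg_C_mul ha, tdeg_aeval]; nlinarith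

lemma letA {φ h : Aut2 K} (hA : h ∈ affA (K := K)) (hB : h ∉ triB (K := K))
    (hd : tdeg (φ (X 1)) < tdeg (φ (X 0))) :
    tdeg ((φ * h) (X 0)) ≤ tdeg ((φ * h) (X 1)) ∧ 2 ≤ tdeg ((φ * h) (X 1)) := by
  obtain ⟨a, b, c, h0⟩ := tdeg_le_one ((hA (X 0)).1 (tdeg_X 0))
  obtain ⟨a', b', c', h1⟩ := tdeg_le_one ((hA (X 1)).1 (tdeg_X 1))
  have ha : a' ≠ 0 := by
    rintro rfl
    apply hB
    exact ⟨b', c', by rw [h1]; simp⟩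
  have e1 := tdeg_aut_pos φ 1
  have hb : tdeg (C b' * φ (X 1) + C c') < tdeg (C a' * φ (X 0)) := by
    rw [tdeg_C_mul ha]
    refine lt_of_le_of_lt (wdeg_add_le (wdeg_mul_le (D := 0) (by simp) le_rfl) (by simp)) ?_
    rw [zero_add]; exact hd
  have h2 : tdeg ((φ * h) (X 1)) = tdeg (φ (X 0)) := by
    rw [mul_app, h1]
    simp only [map_add, map_mul, aut_C]
    rw [add_assoc, tdeg_add_left hb, tdeg_C_mul ha]
  rw [h2]
  refine ⟨?_, by omega⟩
  rw [mul_app, h0]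
  simp only [map_add, map_mul, aut_C]
  refine wdeg_add_le (wdeg_add_le ?_ ?_) (by simp)
  · exact (wdeg_mul_le (D := 0) (by simp) le_rfl).trans (by rw [zero_add]; rfl)
  · refine (wdeg_mul_le (D := 0) (by simp) le_rfl).trans ?_
    rw [zero_add]; exact hd.le

lemma altW_inv (t : Bool) (l : List (Aut2 K)) (h : altW ABs t l) :
    (nxt t l = false → tdeg (l.prod (X 0)) ≤ tdeg (l.prod (X 1))) ∧
    (nxt t l = true → l ≠ [] → tdeg (l.prod (X 1)) < tdeg (l.prod (X 0))) ∧
    (l ≠ [] → l.prod ≠ 1) := by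
  have h01 : tdeg (X 0 : P2 K) = 1 ∧ tdeg (X 1 : P2 K) = 1 := by
    refine ⟨le_antisymm (tdeg_X 0) ?_, le_antisymm (tdeg_X 1) ?_⟩
    · simpa using tdeg_aut_pos (1 : Aut2 K) 0
    · simpa using tdeg_aut_pos (1 : Aut2 K) 1
  induction l using List.reverseRecOn with
  | nil =>
    refine ⟨fun _ => ?_, fun _ h => absurd rfl h, fun h => absurd rfl h⟩
    rw [List.prod_nil, one_app, one_app, h01.1, h01.2]
  | append_singleton l g ih =>
    rw [altW_append] at h
    obtain ⟨i1, i2, i3⟩ := ih h.1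
    obtain ⟨h1, h2⟩ := h.2.1
    have hp : (l ++ [g]).prod = l.prod * g := by simp
    have hn : nxt t (l ++ [g]) = !(nxt t l) := by rw [nxt_append]; rfl
    rw [hp, hn]
    cases hu : nxt t l with
    | false =>
      rw [hu] at h1 h2
      have := letB (φ := l.prod) h1 h2 (i1 hu)
      refine ⟨by simp, fun _ _ => this, fun _ h => ?_⟩
      rw [h, one_app, one_app, h01.1, h01.2] at this
      omega
    | true =>
      rw [hu] at h1 h2
      refine ⟨fun _ => ?_, by simp, fun _ h => ?_⟩
      · by_cases hl : l = []
        · subst hl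
          rw [List.prod_nil, one_mul]
          have e1 := tdeg_aut_pos g 1
          have e2 := ((h1 : g ∈ affA (K := K)) (X 0)).1 (tdeg_X 0)
          omega
        · exact (letA (φ := l.prod) h1 h2 (i2 hu hl)).1
      · by_cases hl : l = []
        · subst hl
          rw [List.prod_nil, one_mul] at h
          rw [h] at h2
          exact h2 (one_mem _)
        · have := (letA (φ := l.prod) h1 h2 (i2 hu hl)).2
          rw [h, one_app, h01.2] at this
          omega
end H1


lemma bc_bc {R : Type*} [CommRing R] (σ : R →+* R) (hσ : ∀ a, σ (σ a) = a) (f : Aut2 R) :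
    bc σ (bc σ f) = f := by
  have hc : σ.comp σ = RingHom.id R := RingHom.ext hσ
  apply aut_ext
  · rw [bc_X0, bc_X0, map_map, hc, map_id]
  · rw [bc_X1, bc_X1, map_map, hc, map_id]

lemma map_map_inv {R : Type*} [CommRing R] (σ : R →+* R) (hσ : ∀ a, σ (σ a) = a) (P : P2 R) :
    map σ (map σ P) = P := by
  have hc : σ.comp σ = RingHom.id R := RingHom.ext hσ
  rw [map_map, hc, map_id]

/-- the twisted semilinear map -/
noncomputable def tau {R : Type*} [CommRing R] (σ : R →+* R) (ν : Aut2 R) (P : P2 R) : P2 R := ν (map σ P)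

section
variable {R : Type*} [CommRing R] (σ : R →+* R) (ν : Aut2 R)
lemma tau_add (P Q : P2 R) : tau σ ν (P + Q) = tau σ ν P + tau σ ν Q := by simp [tau]
lemma tau_sub (P Q : P2 R) : tau σ ν (P - Q) = tau σ ν P - tau σ ν Q := by simp [tau]
lemma tau_mul (P Q : P2 R) : tau σ ν (P * Q) = tau σ ν P * tau σ ν Q := by simp [tau]
lemma tau_C (a : R) : tau σ ν (C a) = C (σ a) := by rw [tau, map_C, aut_C]
lemma tau_tau (hσ : ∀ a, σ (σ a) = a) (hν : ν * bc σ ν = 1) (P : P2 R) : tau σ ν (tau σ ν P) = P := by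
  rw [tau, tau, ← bc_map, ← mul_app, hν, one_app, map_map_inv σ hσ]
end


section H1b
variable {K : Type*} [Field K] [CharZero K]

lemma fixed_pair {R : Type*} [CommRing R] (σ : R →+* R) (hσ : ∀ a, σ (σ a) = a) (i : R) (hsi : σ i = -i) (ν : Aut2 R) (hν : ν * bc σ ν = 1) (P : P2 R) :
    tau σ ν (P + tau σ ν P) = P + tau σ ν P ∧
    tau σ ν (C i * (P - tau σ ν P)) = C i * (P - tau σ ν P) := by
  constructor
  · rw [tau_add, tau_tau σ ν hσ hν, add_comm]
  · rw [tau_mul, tau_sub, tau_tau σ ν hσ hν, tau_C, hsi]; simp only [map_neg]; ring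

lemma complete_aff {v : P2 K} (hv : tdeg v ≤ 1) (hc : ¬ ∃ c, v = C c) : ∃ g : Aut2 K, g (X 1) = v := by
  obtain ⟨a, b, c, rfl⟩ := tdeg_le_one hv
  by_cases ha : a = 0
  · subst ha
    have hb : b ≠ 0 := by rintro rfl; apply hc; exact ⟨c, by simp⟩
    refine ⟨swapA * (torusA b b⁻¹ (mul_inv_cancel₀ hb) * elemA (Polynomial.C c)) * swapA, ?_⟩
    simp only [mul_app, swapA_X1, elemA_X0, map_add, Polynomial.aeval_C, alg_C, torusA_X0, aut_C, map_mul, swapA_X0]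
    simp
  · refine ⟨torusA a a⁻¹ (mul_inv_cancel₀ ha) * elemA (Polynomial.C b * Polynomial.X + Polynomial.C c) * swapA, ?_⟩
    simp only [mul_app, swapA_X1, elemA_X0, map_add, Polynomial.aeval_C, alg_C, torusA_X0, aut_C, map_mul,
      torusA_X1, Polynomial.aeval_X]
    ring

theorem H1_field (σ : K →+* K) (hσ : ∀ a, σ (σ a) = a) (i : K) (hi : i ≠ 0)
    (hsi : σ i = - i) (ν : Aut2 K) (hν : ν * bc σ ν = 1) : ∃ β : Aut2 K, ν * bc σ β = β := by
  have hinj : Function.Injective σ := σ.injective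
  have coc : ∀ g : Aut2 K, (g⁻¹ * ν * bc σ g) * bc σ (g⁻¹ * ν * bc σ g) = 1 := by
    intro g
    rw [map_mul, map_mul, bc_bc σ hσ, map_inv]
    calc _ = g⁻¹ * (ν * bc σ ν) * g := by group
      _ = 1 := by rw [hν]; group
  have back : ∀ g : Aut2 K, (∃ β, (g⁻¹ * ν * bc σ g) * bc σ β = β) → ∃ β : Aut2 K, ν * bc σ β = β := by
    rintro g ⟨β, hβ⟩
    refine ⟨g * β, ?_⟩
    rw [map_mul]
    calc ν * (bc σ g * bc σ β) = g * (g⁻¹ * ν * bc σ g * bc σ β) := by group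
      _ = g * β := by rw [hβ]
  have h2 : (2 : K) ≠ 0 := two_ne_zero
  -- step 2
  have step2 : ∀ ν : Aut2 K, ν * bc σ ν = 1 → ν (X 1) = X 1 → ∃ β, ν * bc σ β = β := by
    intro ν hν hy
    obtain ⟨a, p, ha, -, hx⟩ := tri_x ν (b := 1) (c := 0) (by rw [hy]; simp)
    obtain ⟨f1, f2⟩ := fixed_pair σ hσ i hsi ν hν (X 0)
    have hT : tau σ ν (X 0) = C a * X 0 + Polynomial.aeval (X 1) p := by rw [tau, map_X, hx]
    have fin : ∀ (a' : K) (q : Polynomial K), a' ≠ 0 →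
        tau σ ν (C a' * X 0 + Polynomial.aeval (X 1) q) = C a' * X 0 + Polynomial.aeval (X 1) q →
        ∃ β, ν * bc σ β = β := by
      intro a' q ha' hfix
      have hb0 : (torusA a' a'⁻¹ (mul_inv_cancel₀ ha') * elemA q : Aut2 K) (X 0) =
          C a' * X 0 + Polynomial.aeval (X 1) q := by
        simp only [mul_app, elemA_X0, map_add, torusA_X0, aut_aeval, torusA_X1]
      have hb1 : (torusA a' a'⁻¹ (mul_inv_cancel₀ ha') * elemA q : Aut2 K) (X 1) = X 1 := by
        simp only [mul_app, elemA_X1, torusA_X1]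
      refine ⟨torusA a' a'⁻¹ (mul_inv_cancel₀ ha') * elemA q, aut_ext ?_ ?_⟩
      · rw [mul_app, bc_X0, hb0]; exact hfix
      · rw [mul_app, bc_X1, hb1, map_X, hy]
    by_cases h1 : 1 + a = 0
    · have e : C i * (X 0 - tau σ ν (X 0)) = C (i * (1 - a)) * X 0 +
          Polynomial.aeval (X 1) (-(Polynomial.C i * p)) := by
        rw [hT]; simp only [map_neg, map_mul, Polynomial.aeval_C, alg_C, map_sub, map_one]; ring
      rw [e] at f2
      refine fin _ _ (mul_ne_zero hi ?_) f2
      intro h; apply h2; linear_combination h1 + h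
    · have e : X 0 + tau σ ν (X 0) = C (1 + a) * X 0 + Polynomial.aeval (X 1) p := by
        rw [hT]; simp only [map_add, map_one]; ring
      rw [e] at f1
      exact fin _ _ h1 f1
  -- step 1
  have step1 : ∀ ν : Aut2 K, ν * bc σ ν = 1 → ∀ j : Fin 2, tdeg (ν (X j)) ≤ 1 →
      ∃ g : Aut2 K, (g⁻¹ * ν * bc σ g) (X 1) = X 1 := by
    intro ν hν j hj
    obtain ⟨f1, f2⟩ := fixed_pair σ hσ i hsi ν hν (X j)
    have hT : tau σ ν (X j) = ν (X j) := by rw [tau, map_X]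
    rw [hT] at f1 f2
    have fin : ∀ v : P2 K, tdeg v ≤ 1 → (¬ ∃ c, v = C c) → tau σ ν v = v →
        ∃ g : Aut2 K, (g⁻¹ * ν * bc σ g) (X 1) = X 1 := by
      intro v hv hc hfix
      obtain ⟨g, hg⟩ := complete_aff hv hc
      refine ⟨g, ?_⟩
      rw [mul_app, mul_app, bc_X1, hg]
      rw [tau] at hfix
      rw [hfix, ← hg, ← mul_app, inv_mul_cancel, one_app]
    by_cases h1 : ∃ c, X j + ν (X j) = C c
    · refine fin _ ?_ ?_ f2
      · exact wdeg_mul_le (D := 0) (E := 1) (by simp) (wdeg_sub_le (tdeg_X j) hj)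
      · rintro ⟨c', hc'⟩
        obtain ⟨c, hc⟩ := h1
        have e : (X j : P2 K) = C (2⁻¹ * (c + i⁻¹ * c')) := by
          have e1 : X j - ν (X j) = C (i⁻¹ * c') := by
            rw [C_mul, ← hc', ← mul_assoc, ← C_mul, inv_mul_cancel₀ hi]; simp
          have e2 : C (2 : K) * X j = C (c + i⁻¹ * c') := by
            rw [C_add, ← hc, ← e1, show (C (2:K) : P2 K) = 2 from rfl]; ring
          rw [C_mul, ← e2, ← mul_assoc, ← C_mul, inv_mul_cancel₀ h2]; simp
        have := tdeg_aut_pos (1 : Aut2 K) j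
        rw [one_app, e, tdeg_C] at this
        omega
    · exact fin _ (wdeg_add_le (tdeg_X j) hj) h1 f1
  have hb : ∀ t (g : Aut2 K), g ∈ ABs t ↔ bc σ g ∈ ABs t := by
    have hb1 : ∀ t (g : Aut2 K), g ∈ ABs t → bc σ g ∈ ABs t := by
      intro t g hg
      cases t with
      | true =>
        intro P
        have e : bc σ g P = map σ (g (map σ P)) := by rw [← bc_map, map_map_inv σ hσ]
        rw [e, tdeg_map hinj, ← (show g ∈ affA (K := K) from hg) (map σ P), tdeg_map hinj]
      | false =>
        obtain ⟨b, c, h⟩ := hg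
        exact ⟨σ b, σ c, by rw [bc_X1, h]; simp⟩
    intro t g
    refine ⟨hb1 t g, fun h => ?_⟩
    have := hb1 t _ h
    rwa [bc_bc σ hσ] at this
  obtain ⟨g, t, hg⟩ := amalg_coc ABs (bc σ) (bc_bc σ hσ) hb (fun t l h => (altW_inv t l h).2.2) NFm_all ν hν
  apply back g
  have hc := coc g
  generalize g⁻¹ * ν * bc σ g = μ at hg hc
  have : ∃ j, tdeg (μ (X j)) ≤ 1 := by
    cases t with
    | true => exact ⟨0, ((show μ ∈ affA (K := K) from hg) (X 0)).1 (tdeg_X 0)⟩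
    | false =>
      obtain ⟨b, c, h⟩ := hg
      refine ⟨1, ?_⟩
      rw [h]
      exact wdeg_add_le (wdeg_mul_le (D := 0) (E := 1) (by simp) (tdeg_X 1)) (by simp)
  obtain ⟨j, hj⟩ := this
  obtain ⟨k, hk⟩ := step1 μ hc j hj
  have hck : (k⁻¹ * μ * bc σ k) * bc σ (k⁻¹ * μ * bc σ k) = 1 := by
    rw [map_mul, map_mul, bc_bc σ hσ, map_inv]
    calc _ = k⁻¹ * (μ * bc σ μ) * k := by group
      _ = 1 := by rw [hc]; group
  obtain ⟨β, hβ⟩ := step2 _ hck hk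
  refine ⟨k * β, ?_⟩
  rw [map_mul]
  calc μ * (bc σ k * bc σ β) = k * (k⁻¹ * μ * bc σ k * bc σ β) := by group
    _ = k * β := by rw [hβ]
end H1b


section injlem
variable {k : Type*} [CommRing k] [IsDomain k] [CharZero k]

lemma aeval_inj {G : P2 k} (hG : ¬ ∃ c, G = C c) {p : Polynomial k} (hp : Polynomial.aeval G p = 0) : p = 0 := by
  have h1 : tdeg G ≠ 0 := fun h => hG (tdeg_eq_zero h)
  have h2 := tdeg_aeval G p
  rw [hp] at h2
  have h3 : p.natDegree = 0 := by
    simp [tdeg] at h2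
    rcases h2 with h | h
    · exact h
    · exact absurd h h1
  rw [Polynomial.eq_C_of_natDegree_eq_zero h3] at hp ⊢
  rw [Polynomial.aeval_C, alg_C] at hp
  have : p.coeff 0 = 0 := C_injective _ _ (by rw [hp, map_zero])
  rw [this]; simp

lemma X1_nc : ¬ ∃ c, (X 1 : P2 k) = C c := by
  rintro ⟨c, hc⟩
  have := congrArg (pderiv 1) hc
  simp at this

lemma pderiv_zero_const {P : P2 k} (h0 : pderiv 0 P = 0) (h1 : pderiv 1 P = 0) : ∃ c, P = C c := by
  obtain ⟨p, rfl⟩ := ker_pderiv0 h0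
  have e : pderiv 1 (Polynomial.aeval (X 1 : P2 k) p) = Polynomial.aeval (X 1) p.derivative := by
    have := Derivation.map_aeval (pderiv (R := k) (1 : Fin 2)) p (X 1)
    rw [this, pderiv_X_self, smul_eq_mul, mul_one]
  rw [e] at h1
  have h2 : p.derivative = 0 := aeval_inj X1_nc h1
  have h3 := (Polynomial.derivative_eq_zero.1 h2)
  rw [Polynomial.eq_C_of_natDegree_eq_zero h3]
  exact ⟨_, by rw [Polynomial.aeval_C, alg_C]⟩

lemma ev_inj_of_jac {f g : P2 k} (h : jac f g ≠ 0) (P : P2 k) (hP : ev f g P = 0) : P = 0 := by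
  obtain ⟨n, hn⟩ : ∃ n, tdeg P ≤ n := ⟨_, le_rfl⟩
  induction n using Nat.strong_induction_on generalizing P with
  | _ n ih =>
    have hd : ∀ i : Fin 2, pderiv i P = 0 := by
      intro i
      have h0 : ev f g (pderiv i P) = 0 := by
        have e1 := jac_ev_right f g P
        have e2 := jac_ev_right g f (swapA P)
        have e3 : ev g f (swapA P) = ev f g P := by
          rw [aut_eq_ev, hom_ev]; simp
        rw [hP] at e1
        rw [e3, hP] at e2
        have e4 : ev g f (pderiv 1 (swapA P)) = ev f g (pderiv 0 P) := by
          have := der_ev (pderiv 1) (X 1) (X 0) P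
          rw [aut_eq_ev, swapA_X0, swapA_X1, this, pderiv_X_self, pderiv_X]
          simp [hom_ev]
        rw [e4, jac_swap] at e2
        fin_cases i
        · simp [jac] at e2 ⊢
          rcases e2 with e | e
          · exact e
          · exact absurd (by rw [jac]; linear_combination (-1 : P2 k) * e) h
        · simp [jac] at e1 ⊢
          rcases e1 with e | e
          · exact e
          · exact absurd (by rw [jac]; exact e) h
      by_contra hne
      have h1 := tdeg_pderiv_lt i P hne
      exact hne (ih (tdeg (pderiv i P)) (by omega) _ h0 le_rfl)
    obtain ⟨c, rfl⟩ := pderiv_zero_const (hd 0) (hd 1)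
    rwa [ev_C] at hP

end injlem

section autmk0
variable {k : Type*} [CommRing k] [IsDomain k] [CharZero k]
lemma aut_of_surj {f g A B : P2 k} (hA : ev f g A = X 0) (hB : ev f g B = X 1) :
    ∃ ψ : Aut2 k, ψ (X 0) = f ∧ ψ (X 1) = g := by
  have hj : jac f g ≠ 0 := by
    have := jac_comp f g A B
    rw [hA, hB, show jac (X 0 : P2 k) (X 1) = 1 by simp [jac, pderiv_X]] at this
    exact right_ne_zero_of_mul (a := ev f g (jac A B)) (by rw [← this]; exact one_ne_zero)
  have inj : ∀ P Q : P2 k, ev f g P = ev f g Q → P = Q := fun P Q h =>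
    sub_eq_zero.1 (ev_inj_of_jac hj _ (by rw [map_sub, h, sub_self]))
  refine ⟨mkAut f g A B hA hB ?_ ?_, mkAut_X0 .., mkAut_X1 ..⟩
  · apply inj
    have := hom_ev (ev f g) A B f
    rw [hA, hB, ev_id] at this
    rw [this, ev_X0]
  · apply inj
    have := hom_ev (ev f g) A B g
    rw [hA, hB, ev_id] at this
    rw [this, ev_X1]

end autmk0
section autmk
variable {k : Type*} [Field k] [CharZero k]
lemma triA_ex (a b c : k) (ha : a ≠ 0) (hb : b ≠ 0) (p : Polynomial k) :
    ∃ ψ : Aut2 k, ψ (X 0) = C a * X 0 + Polynomial.aeval (X 1) p ∧ ψ (X 1) = C b * X 1 + C c := by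
  have e : C a⁻¹ * C a = (1 : P2 k) := by rw [← C_mul, inv_mul_cancel₀ ha]; simp
  have e' : C b⁻¹ * C b = (1 : P2 k) := by rw [← C_mul, inv_mul_cancel₀ hb]; simp
  have e2 : ev (C a * X 0 + Polynomial.aeval (X 1) p : P2 k) (C b * X 1 + C c : P2 k) (C b⁻¹ * (X 1 - C c) : P2 k) = X 1 := by
    rw [map_mul, map_sub, ev_C, ev_C, ev_X1, add_sub_cancel_right, ← mul_assoc, e', one_mul]
  apply aut_of_surj (A := C a⁻¹ * (X 0 - Polynomial.aeval (C b⁻¹ * (X 1 - C c)) p)) (B := C b⁻¹ * (X 1 - C c))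
  · rw [map_mul, map_sub, ev_C, ev_X0, hom_aeval, e2, add_sub_cancel_right, ← mul_assoc, e, one_mul]
  · exact e2
end autmk

section furter
variable {O K k : Type*} [CommRing O] [IsDomain O] [CharZero O] [Field K] [CharZero K] [Algebra O K]
  [IsFractionRing O K] [Field k] [CharZero k]

def IsUnif (ρ : O →+* k) (π : O) : Prop :=
  Function.Surjective ρ ∧ π ≠ 0 ∧ (∀ a, ρ a = 0 ↔ π ∣ a) ∧ (∀ a, a ≠ 0 → ∃ N : ℕ, ¬ π ^ N ∣ a)

variable {ρ : O →+* k} {π : O}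

lemma IsUnif.dvdP (h : IsUnif ρ π) {P : P2 O} (hP : map ρ P = 0) : ∃ Q, P = C π * Q := by
  have : C π ∣ P := by
    rw [MvPolynomial.C_dvd_iff_dvd_coeff]
    intro s
    rw [← h.2.2.1, ← coeff_map, hP, coeff_zero]
  exact this

lemma IsUnif.dvdp (h : IsUnif ρ π) {P : Polynomial O} (hP : P.map ρ = 0) : ∃ Q, P = Polynomial.C π * Q := by
  have : Polynomial.C π ∣ P := by
    rw [Polynomial.C_dvd_iff_dvd_coeff]
    intro s
    rw [← h.2.2.1, ← Polynomial.coeff_map, hP, Polynomial.coeff_zero]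
  exact this

lemma IsUnif.facP (h : IsUnif ρ π) {P : P2 O} (hP : P ≠ 0) : ∃ (N : ℕ) (Q : P2 O), P = C (π ^ N) * Q ∧ map ρ Q ≠ 0 := by
  classical
  obtain ⟨s, hs⟩ := MvPolynomial.ne_zero_iff.1 hP
  obtain ⟨N, hN⟩ := h.2.2.2 _ hs
  have hN' : ∃ N, ¬ C (π ^ N) ∣ P := ⟨N, fun hd => hN ((MvPolynomial.C_dvd_iff_dvd_coeff _ _).1 hd s)⟩
  have h1 := Nat.find_spec hN'
  have h0 : Nat.find hN' ≠ 0 := by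
    intro h0; rw [h0] at h1; simp at h1
  obtain ⟨M, hM⟩ := Nat.exists_eq_succ_of_ne_zero h0
  have h2 := Nat.find_min hN' (m := M) (by omega)
  rw [not_not] at h2
  obtain ⟨Q, hQ⟩ := h2
  refine ⟨M, Q, hQ, fun hr => ?_⟩
  obtain ⟨Q', rfl⟩ := h.dvdP hr
  apply h1
  rw [hM]
  exact ⟨Q', by rw [hQ, Nat.succ_eq_add_one, pow_succ, C_mul, mul_assoc]⟩

lemma IsUnif.fac (h : IsUnif ρ π) {d : O} (hd : d ≠ 0) : ∃ (N : ℕ) (s : O), d = π ^ N * s ∧ ρ s ≠ 0 := by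
  obtain ⟨N, Q, h1, h2⟩ := h.facP (P := C d) (by simpa using hd)
  refine ⟨N, coeff 0 Q, ?_, ?_⟩
  · have := congrArg (coeff 0) h1
    rwa [coeff_zero_C, coeff_C_mul] at this
  · intro h3
    apply h2
    ext s
    rw [coeff_map, coeff_zero]
    by_cases hs : s = 0
    · rw [hs, h3]
    · have := congrArg (coeff s) h1
      rw [coeff_C, if_neg (fun h => hs h.symm), coeff_C_mul] at this
      rcases mul_eq_zero.1 this.symm with h4 | h4
      · exact absurd h4 (pow_ne_zero _ h.2.1)
      · rw [h4, map_zero]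

lemma clearP (P : P2 K) : ∃ (d : O) (Q : P2 O), d ≠ 0 ∧ map (algebraMap O K) Q = C (algebraMap O K d) * P := by
  induction P using MvPolynomial.induction_on with
  | C a =>
    obtain ⟨n, d, hd, rfl⟩ := IsFractionRing.div_surjective (A := O) a
    have hd0 := nonZeroDivisors.ne_zero hd
    refine ⟨d, C n, hd0, ?_⟩
    rw [map_C, ← C_mul, mul_div_cancel₀]
    rwa [Ne, IsFractionRing.to_map_eq_zero_iff]
  | add p q hp hq =>
    obtain ⟨d, Q, hd, hQ⟩ := hp
    obtain ⟨e, R, he, hR⟩ := hq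
    refine ⟨d * e, C e * Q + C d * R, mul_ne_zero hd he, ?_⟩
    simp only [map_add, map_mul, map_C, hQ, hR]; ring
  | mul_X p i hp =>
    obtain ⟨d, Q, hd, hQ⟩ := hp
    exact ⟨d, Q * X i, hd, by rw [map_mul, hQ, map_X]; ring⟩

lemma clearp (P : Polynomial K) : ∃ (d : O) (Q : Polynomial O), d ≠ 0 ∧
    Q.map (algebraMap O K) = Polynomial.C (algebraMap O K d) * P := by
  induction P using Polynomial.induction_on' with
  | monomial m a =>
    obtain ⟨n, d, hd, rfl⟩ := IsFractionRing.div_surjective (A := O) a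
    have hd0 := nonZeroDivisors.ne_zero hd
    refine ⟨d, Polynomial.monomial m n, hd0, ?_⟩
    rw [Polynomial.map_monomial, Polynomial.C_mul_monomial, mul_div_cancel₀]
    rwa [Ne, IsFractionRing.to_map_eq_zero_iff]
  | add p q hp hq =>
    obtain ⟨d, Q, hd, hQ⟩ := hp
    obtain ⟨e, R, he, hR⟩ := hq
    refine ⟨d * e, Polynomial.C e * Q + Polynomial.C d * R, mul_ne_zero hd he, ?_⟩
    simp only [Polynomial.map_add, Polynomial.map_mul, Polynomial.map_C, hQ, hR, map_mul]; ring

end furter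


section jl
variable {R S : Type*} [CommRing R] [CommRing S]
lemma map_jac (σ : R →+* S) (F G : P2 R) : map σ (jac F G) = jac (map σ F) (map σ G) := by
  simp only [jac, map_sub, map_mul, pderiv_map]
lemma jac_add_left (F F' G : P2 R) : jac (F + F') G = jac F G + jac F' G := by
  simp only [jac, map_add]; ring
lemma jac_C_left (a : R) (F G : P2 R) : jac (C a * F) G = C a * jac F G := by
  simp only [jac, pderiv_C_mul]; ring
lemma jac_aeval_left (G : P2 R) (q : Polynomial R) : jac (Polynomial.aeval G q) G = 0 := by
  rw [jac_swap, ← jd_apply, Derivation.map_aeval, jd_apply, jac_self, smul_zero, neg_zero]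
lemma aeval_C_mul' (a : R) (G : P2 R) (q : Polynomial R) :
    Polynomial.aeval G (Polynomial.C a * q) = C a * Polynomial.aeval G q := by
  rw [map_mul, Polynomial.aeval_C, alg_C]
lemma aut_nc [Nontrivial R] (φ : Aut2 R) : ¬ ∃ c, φ (X 1) = C c := by
  rintro ⟨c, hc⟩
  have h1 : (X 1 : P2 R) = C c := by
    apply φ.injective; rw [hc, aut_C]
  have := congrArg (pderiv 1) h1
  simp at this
end jl

section furter
variable {O K k : Type*} [CommRing O] [IsDomain O] [CharZero O] [Field K] [CharZero K] [Algebra O K]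
  [IsFractionRing O K] [Field k] [CharZero k]
variable {ρ : O →+* k} {π : O}

lemma mapK_inj {P Q : P2 O} (h : map (algebraMap O K) P = map (algebraMap O K) Q) : P = Q :=
  map_injective _ (IsFractionRing.injective O K) h

lemma Cpi_cancel {a : O} (ha : a ≠ 0) {P Q : P2 O} (h : C a * P = C a * Q) : P = Q :=
  mul_left_cancel₀ (by simpa using ha) h

lemma fur1 (hu : IsUnif ρ π) {F : P2 K} (hF : ¬ ∃ c, F = C c) : ∃ (G0 : P2 O) (a b : K), a ≠ 0 ∧
    map (algebraMap O K) G0 = C a * F + C b ∧ ¬ ∃ c, map ρ G0 = C c := by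
  obtain ⟨d, Q, hd, hQ⟩ := clearP (O := O) F
  have hdK : algebraMap O K d ≠ 0 := by rwa [Ne, IsFractionRing.to_map_eq_zero_iff]
  have hQ0 : Q - C (coeff 0 Q) ≠ 0 := by
    intro h
    have h1 := congrArg (map (algebraMap O K)) h
    rw [map_sub, hQ, map_C, map_zero, sub_eq_zero] at h1
    apply hF
    refine ⟨(algebraMap O K d)⁻¹ * algebraMap O K (coeff 0 Q), ?_⟩
    rw [C_mul, ← h1, ← mul_assoc, ← C_mul, inv_mul_cancel₀ hdK, C_1, one_mul]
  obtain ⟨N, G0, h1, h2⟩ := hu.facP hQ0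
  have hp : algebraMap O K (π ^ N) ≠ 0 := by
    rw [Ne, IsFractionRing.to_map_eq_zero_iff]; exact pow_ne_zero _ hu.2.1
  refine ⟨G0, (algebraMap O K (π ^ N))⁻¹ * algebraMap O K d, - (algebraMap O K (π ^ N))⁻¹ * algebraMap O K (coeff 0 Q),
    mul_ne_zero (inv_ne_zero hp) hdK, ?_, ?_⟩
  · have h3 := congrArg (map (algebraMap O K)) h1
    rw [map_sub, hQ, map_C, map_mul, map_C] at h3
    have h4 : C (algebraMap O K (π ^ N))⁻¹ * C (algebraMap O K (π ^ N)) = (1 : P2 K) := by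
      rw [← C_mul, inv_mul_cancel₀ hp, C_1]
    rw [C_mul, C_mul, C_neg]
    linear_combination (-C (algebraMap O K (π ^ N))⁻¹) * h3 - map (algebraMap O K) G0 * h4
  · rintro ⟨c, hc⟩
    have h5 := congrArg (coeff 0) h1
    rw [coeff_sub, coeff_zero_C, sub_self, coeff_C_mul] at h5
    have h6 : coeff 0 G0 = 0 := (mul_eq_zero.1 h5.symm).resolve_left (pow_ne_zero _ hu.2.1)
    have h7 := congrArg (coeff 0) hc
    rw [coeff_map, h6, map_zero, coeff_zero_C] at h7
    rw [← h7, C_0] at hc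
    exact h2 hc

lemma fur2 (hu : IsUnif ρ π) {G0 : P2 O} (hG : ¬ ∃ c, map ρ G0 = C c) (ψ : Aut2 K)
    (hψ : ψ (X 1) = map (algebraMap O K) G0) : ∃ (F : P2 O) (ψ' : Aut2 K),
      ψ' (X 0) = map (algebraMap O K) F ∧ ψ' (X 1) = map (algebraMap O K) G0 ∧
      ¬ ∃ q : Polynomial k, map ρ F = Polynomial.aeval (map ρ G0) q := by
  have key : ∀ (N : ℕ) (F Q : P2 O) (ψ : Aut2 K), ψ (X 0) = map (algebraMap O K) F →
      ψ (X 1) = map (algebraMap O K) G0 → jac F G0 = C (π ^ N) * Q → map ρ Q ≠ 0 →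
      ∃ (F : P2 O) (ψ' : Aut2 K),
      ψ' (X 0) = map (algebraMap O K) F ∧ ψ' (X 1) = map (algebraMap O K) G0 ∧
      ¬ ∃ q : Polynomial k, map ρ F = Polynomial.aeval (map ρ G0) q := by
    intro N
    induction N with
    | zero =>
      intro F Q ψ h0 h1 hj hQ
      refine ⟨F, ψ, h0, h1, ?_⟩
      rintro ⟨q, hq⟩
      apply hQ
      have := congrArg (map ρ) hj
      rw [map_jac, hq, jac_aeval_left] at this
      simpa using this.symm
    | succ N ih =>
      intro F Q ψ h0 h1 hj hQ
      by_cases hF : ∃ q : Polynomial k, map ρ F = Polynomial.aeval (map ρ G0) q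
      · obtain ⟨q, hq⟩ := hF
        obtain ⟨q1, rfl⟩ := Polynomial.map_surjective ρ hu.1 q
        obtain ⟨F', hF'⟩ := hu.dvdP (P := F - Polynomial.aeval G0 q1) (by rw [map_sub, hq, map_aeval1, sub_self])
        have hp : algebraMap O K π ≠ 0 := by
          rw [Ne, IsFractionRing.to_map_eq_zero_iff]; exact hu.2.1
        refine ih F' Q (ψ * elemA (-(q1.map (algebraMap O K))) * torusA (algebraMap O K π)⁻¹ _ (inv_mul_cancel₀ hp)) ?_ ?_ ?_ hQ
        · simp only [mul_app, torusA_X0, map_mul, aut_C, elemA_X0, map_add, aut_aeval, h0, h1, map_neg]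
          rw [← map_aeval1, ← sub_eq_add_neg, ← map_sub, hF', map_mul, map_C, ← mul_assoc, ← C_mul,
            inv_mul_cancel₀ hp, C_1, one_mul]
        · simp only [mul_app, torusA_X1, elemA_X1, h1]
        · have e : F = Polynomial.aeval G0 q1 + C π * F' := by rw [← hF']; ring
          rw [e, jac_add_left, jac_aeval_left, zero_add, jac_C_left] at hj
          apply Cpi_cancel hu.2.1
          rw [hj, pow_succ, C_mul]; ring
      · exact ⟨F, ψ, h0, h1, hF⟩
  obtain ⟨d, F, hd, hF⟩ := clearP (O := O) (ψ (X 0))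
  have hdK : algebraMap O K d ≠ 0 := by rwa [Ne, IsFractionRing.to_map_eq_zero_iff]
  have h0 : (ψ * torusA (algebraMap O K d) _ (mul_inv_cancel₀ hdK)) (X 0) = map (algebraMap O K) F := by
    simp only [mul_app, torusA_X0, map_mul, aut_C, hF]
  have h1 : (ψ * torusA (algebraMap O K d) _ (mul_inv_cancel₀ hdK)) (X 1) = map (algebraMap O K) G0 := by
    simp only [mul_app, torusA_X1, hψ]
  have hj : jac F G0 ≠ 0 := by
    intro h
    have := jac_aut_unit (ψ * torusA (algebraMap O K d) _ (mul_inv_cancel₀ hdK))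
    rw [h0, h1, ← map_jac, h, map_zero] at this
    exact not_isUnit_zero this
  obtain ⟨N, Q, h3, h4⟩ := hu.facP hj
  exact key N F Q _ h0 h1 h3 h4

lemma fur0 (hu : IsUnif ρ π) {F G : P2 O} (hj : jac (map ρ F) (map ρ G) ≠ 0) (s : O) (P : P2 O) (N : ℕ) :
    ∀ Q : P2 O, ev F G Q = C (π ^ N * s) * P → ∃ Q' : P2 O, ev F G Q' = C s * P := by
  induction N with
  | zero => intro Q hQ; exact ⟨Q, by simpa using hQ⟩
  | succ N ih =>
    intro Q hQ
    have h1 : map ρ Q = 0 := by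
      apply ev_inj_of_jac hj
      rw [← map_ev, hQ, map_mul, map_C, (hu.2.2.1 _).2 ⟨π ^ N * s, by ring⟩, C_0, zero_mul]
    obtain ⟨Q', rfl⟩ := hu.dvdP h1
    apply ih Q'
    apply Cpi_cancel hu.2.1
    rw [map_mul, ev_C] at hQ
    rw [hQ]; simp only [pow_succ, C_mul]; ring

lemma fur3 (hu : IsUnif ρ π) {F G : P2 O} (hG : ¬ ∃ c, map ρ G = C c) (ψ : Aut2 K)
    (h0 : ψ (X 0) = map (algebraMap O K) F) (h1 : ψ (X 1) = map (algebraMap O K) G) (g : Aut2 k)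
    (h : Polynomial k) (hgh : map ρ G = Polynomial.aeval (g (X 1)) h) :
    (∃ p : Polynomial k, map ρ F = Polynomial.aeval (g (X 1)) p) ∨
    (∃ χ : Aut2 k, χ (X 0) = map ρ F ∧ χ (X 1) = map ρ G) := by
  by_cases hj : jac (map ρ F) (map ρ G) = 0
  · left
    obtain ⟨f, hf⟩ := g.surjective (map ρ F)
    have e1 : map ρ G = g (Polynomial.aeval (X 1) h) := by rw [hgh, aut_aeval]
    rw [← hf, e1, aut_eq_ev g f, aut_eq_ev g (Polynomial.aeval (X 1) h), jac_comp] at hj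
    have hu' := jac_aut_unit g
    have e2 : jac f (Polynomial.aeval (X 1) h) = 0 := by
      apply g.injective
      rw [map_zero, aut_eq_ev]
      exact (mul_eq_zero.1 hj).resolve_right hu'.ne_zero
    have e3 : pderiv 0 f * Polynomial.aeval (X 1) h.derivative = 0 := by
      rw [jac, Derivation.map_aeval, Derivation.map_aeval] at e2
      simpa [pderiv_X] using e2
    have e4 : Polynomial.aeval (X 1 : P2 k) h.derivative ≠ 0 := by
      intro h2
      have h3 := Polynomial.derivative_eq_zero.1 (aeval_inj X1_nc h2)
      apply hG
      rw [hgh, Polynomial.eq_C_of_natDegree_eq_zero h3]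
      exact ⟨_, by rw [Polynomial.aeval_C, alg_C]⟩
    obtain ⟨p, hp⟩ := ker_pderiv0 ((mul_eq_zero.1 e3).resolve_right e4)
    exact ⟨p, by rw [← hf, hp, aut_aeval]⟩
  · right
    have key : ∀ i : Fin 2, ∃ A : P2 k, ev (map ρ F) (map ρ G) A = X i := by
      intro i
      obtain ⟨d, Q, hd, hQ⟩ := clearP (O := O) (ψ.symm (X i))
      have e : ev F G Q = C d * X i := by
        apply mapK_inj (K := K)
        rw [map_ev, ← h0, ← h1, ← aut_eq_ev, hQ, map_mul, aut_C, AlgEquiv.apply_symm_apply, map_mul, map_C, map_X]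
      obtain ⟨N, s, rfl, hs⟩ := hu.fac hd
      obtain ⟨Q', hQ'⟩ := fur0 hu hj s (X i) N Q e
      refine ⟨C (ρ s)⁻¹ * map ρ Q', ?_⟩
      rw [map_mul, ev_C, ← map_ev, hQ', map_mul, map_C, map_X, ← mul_assoc, ← C_mul, inv_mul_cancel₀ hs, C_1, one_mul]
    obtain ⟨A, hA⟩ := key 0
    obtain ⟨B, hB⟩ := key 1
    exact aut_of_surj hA hB

lemma fur4 (hu : IsUnif ρ π) {F G : P2 O} (hG : ¬ ∃ c, map ρ G = C c)
    (hF : ¬ ∃ q : Polynomial k, map ρ F = Polynomial.aeval (map ρ G) q) (s : O) (H : P2 O) (N : ℕ) :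
    ∀ (α : O) (p : Polynomial O), C (π ^ N * s) * H = C α * F + Polynomial.aeval G p →
      ∃ (α : O) (p : Polynomial O), C s * H = C α * F + Polynomial.aeval G p := by
  induction N with
  | zero => intro α p h; exact ⟨α, p, by simpa using h⟩
  | succ N ih =>
    intro α p h
    have e := congrArg (map ρ) h
    rw [map_add, map_mul (map ρ) (C _) H, map_mul (map ρ) (C _) F, map_C, map_C, map_aeval1,
      (hu.2.2.1 (π ^ (N + 1) * s)).2 ⟨π ^ N * s, by ring⟩, C_0, zero_mul] at e
    have hα : ρ α = 0 := by
      by_contra hα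
      apply hF
      refine ⟨Polynomial.C (-(ρ α)⁻¹) * p.map ρ, ?_⟩
      rw [aeval_C_mul']
      have e1 : C (ρ α)⁻¹ * C (ρ α) = (1 : P2 k) := by rw [← C_mul, inv_mul_cancel₀ hα, C_1]
      rw [C_neg]
      linear_combination (-map ρ F) * e1 - C (ρ α)⁻¹ * e
    rw [hα, C_0, zero_mul, zero_add] at e
    obtain ⟨p', rfl⟩ := hu.dvdp (aeval_inj hG e.symm)
    obtain ⟨α', rfl⟩ := (hu.2.2.1 α).1 hα
    apply ih α' p'
    apply Cpi_cancel hu.2.1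
    rw [aeval_C_mul'] at h
    simp only [pow_succ, C_mul] at h ⊢
    linear_combination h

/-- Furter claim -/
def FClaim (O : Type*) {K k : Type*} [CommRing O] [Field K] [Algebra O K] [Field k] (ρ : O →+* k) (F : P2 K) : Prop :=
  ∀ (a b : K) (H : P2 O), map (algebraMap O K) H = C a * F + C b →
    ∃ (g : Aut2 k) (h : Polynomial k), map ρ H = Polynomial.aeval (g (X 1)) h

lemma fur5 (hu : IsUnif ρ π) (φ : Aut2 K) (hc : FClaim O ρ (φ (X 1))) : FClaim O ρ (φ (X 0)) := by
  obtain ⟨G, a0, b0, ha0, hG0, hG⟩ := fur1 hu (aut_nc φ)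
  obtain ⟨g, h, hgh⟩ := hc a0 b0 G hG0
  obtain ⟨t, ht0, ht1⟩ := triA_ex 1 a0 b0 one_ne_zero ha0 (0 : Polynomial K)
  obtain ⟨F, ψ, h0, h1, hF⟩ := fur2 hu hG (φ * t) (by rw [mul_app, ht1, map_add, map_mul, aut_C, aut_C, hG0])
  have e1 : (ψ⁻¹ * φ) (X 1) = C a0⁻¹ * X 1 + C (-(a0⁻¹ * b0)) := by
    rw [mul_app]
    apply ψ.injective
    rw [← mul_app, mul_inv_cancel, one_app, map_add, map_mul, aut_C, aut_C, h1, hG0]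
    have : C a0⁻¹ * C a0 = (1 : P2 K) := by rw [← C_mul, inv_mul_cancel₀ ha0, C_1]
    rw [C_neg, C_mul]
    linear_combination (-φ (X 1)) * this
  obtain ⟨a1, p1, ha1, -, hx⟩ := tri_x _ e1
  have e2 : φ (X 0) = C a1 * map (algebraMap O K) F + Polynomial.aeval (map (algebraMap O K) G) p1 := by
    have := congrArg ψ hx
    rwa [← mul_app, mul_inv_cancel_left, map_add, map_mul, aut_C, aut_aeval, h0, h1] at this
  intro a b H hH
  obtain ⟨n, d1, hd1, hn⟩ := IsFractionRing.div_surjective (A := O) (a * a1)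
  have hd1 := nonZeroDivisors.ne_zero hd1
  have hd1K : algebraMap O K d1 ≠ 0 := by rwa [Ne, IsFractionRing.to_map_eq_zero_iff]
  obtain ⟨d2, Q, hd2, hQ⟩ := clearp (O := O) (Polynomial.C a * p1 + Polynomial.C b)
  have e3 : C (d1 * d2) * H = C (n * d2) * F + Polynomial.aeval G (Polynomial.C d1 * Q) := by
    apply mapK_inj (K := K)
    simp only [map_add, map_mul, map_C, map_aeval1, hQ, hH, e2, Polynomial.aeval_C, alg_C]
    have e4 : (C (algebraMap O K n) : P2 K) = C (algebraMap O K d1) * C a * C a1 := by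
      rw [← C_mul, ← C_mul]; congr 1; rw [mul_assoc, ← hn]; field_simp
    rw [e4]; ring
  obtain ⟨N, s, hs, hs0⟩ := hu.fac (mul_ne_zero hd1 hd2)
  rw [hs] at e3
  obtain ⟨α, p, e5⟩ := fur4 hu hG hF s H N _ _ e3
  have e6 := congrArg (map ρ) e5
  rw [map_add, map_mul, map_mul, map_C, map_C, map_aeval1] at e6
  have e7 : C (ρ s)⁻¹ * C (ρ s) = (1 : P2 k) := by rw [← C_mul, inv_mul_cancel₀ hs0, C_1]
  have inW : ∀ q : Polynomial k, C (ρ α) * map ρ F = Polynomial.aeval (g (X 1)) q →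
      ∃ (g : Aut2 k) (h : Polynomial k), map ρ H = Polynomial.aeval (g (X 1)) h := by
    intro q hq
    refine ⟨g, Polynomial.C (ρ s)⁻¹ * (q + (p.map ρ).comp h), ?_⟩
    rw [aeval_C_mul', map_add, Polynomial.aeval_comp, ← hgh, ← hq]
    linear_combination (-map ρ H) * e7 + C (ρ s)⁻¹ * e6
  rcases fur3 hu hG ψ h0 h1 g h hgh with ⟨p2, hp2⟩ | ⟨χ, hχ0, hχ1⟩
  · exact inW (Polynomial.C (ρ α) * p2) (by rw [aeval_C_mul', hp2])
  · by_cases hα : ρ α = 0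
    · exact inW 0 (by rw [hα]; simp)
    · obtain ⟨t, ht0, ht1⟩ := triA_ex ((ρ s)⁻¹ * ρ α) 1 0 (mul_ne_zero (inv_ne_zero hs0) hα) one_ne_zero
        (Polynomial.C (ρ s)⁻¹ * p.map ρ)
      refine ⟨χ * t * swapA, Polynomial.X, ?_⟩
      rw [Polynomial.aeval_X, mul_app, mul_app, swapA_X1, ht0, map_add, map_mul, aut_C, aut_aeval, hχ0, hχ1,
        aeval_C_mul', C_mul]
      linear_combination (-map ρ H) * e7 + C (ρ s)⁻¹ * e6

theorem furter (hu : IsUnif ρ π) (φ : Aut2 K) : FClaim O ρ (φ (X 0)) ∧ FClaim O ρ (φ (X 1)) := by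
  have base : ∀ i : Fin 2, (∃ g : Aut2 k, g (X 1) = X i) → FClaim O ρ (X i : P2 K) := by
    intro i ⟨g, hg⟩ a b H hH
    have h1 : H = C (coeff (Finsupp.single i 1) H) * X i + C (coeff 0 H) := by
      apply mapK_inj (K := K)
      rw [map_add, map_mul, map_C, map_C, map_X, ← coeff_map, ← coeff_map, hH]
      have e1 : (0 : Fin 2 →₀ ℕ) ≠ Finsupp.single i 1 := by
        intro h; have := DFunLike.congr_fun h i; simp at this
      have e2 : coeff 0 (map (algebraMap O K) H) = b := by rw [hH]; simp [coeff_C_mul]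
      rw [coeff_map] at e2
      rw [e2]; simp; intro h; exact absurd h e1
    refine ⟨g, Polynomial.C (ρ (coeff (Finsupp.single i 1) H)) * Polynomial.X + Polynomial.C (ρ (coeff 0 H)), ?_⟩
    rw [map_add, aeval_C_mul', Polynomial.aeval_C, alg_C, Polynomial.aeval_X, hg]
    conv_lhs => rw [h1]
    rw [map_add, map_mul, map_C, map_C, map_X]
  induction φ using jung_ind with
  | h1 => exact ⟨base 0 ⟨swapA, swapA_X1⟩, base 1 ⟨1, rfl⟩⟩
  | he φ q ih =>
    have h2 : FClaim O ρ ((φ * elemA q) (X 1)) := by rw [mul_app, elemA_X1]; exact ih.2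
    exact ⟨fur5 hu _ h2, h2⟩
  | hs φ ih => rw [mul_app, mul_app, swapA_X0, swapA_X1]; exact ⟨ih.2, ih.1⟩
  | ht φ a b h ih =>
    rw [mul_app, mul_app, torusA_X0, torusA_X1]
    refine ⟨?_, ih.2⟩
    intro a' b' H hH
    rw [map_mul, aut_C, ← mul_assoc, ← C_mul] at hH
    exact ih.1 _ _ H hH

end furter


section relk
variable {R : Type*} [CommRing R]
lemma div_X1 (c : R) (P : P2 R) : ∃ (Q : P2 R) (p : Polynomial R), P = (X 1 - C c) * Q + Polynomial.aeval (X 0) p := by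
  induction P using MvPolynomial.induction_on with
  | C a => exact ⟨0, Polynomial.C a, by rw [Polynomial.aeval_C, alg_C]; ring⟩
  | add p q hp hq =>
    obtain ⟨Q, a, h⟩ := hp
    obtain ⟨Q', a', h'⟩ := hq
    refine ⟨Q + Q', a + a', ?_⟩
    rw [map_add]; linear_combination h + h'
  | mul_X p i hp =>
    obtain ⟨Q, a, h⟩ := hp
    fin_cases i
    · refine ⟨Q * X 0, a * Polynomial.X, ?_⟩
      rw [map_mul, Polynomial.aeval_X]; change p * X 0 = _; linear_combination h * X 0
    · refine ⟨Q * X 1 + Polynomial.aeval (X 0) a, Polynomial.C c * a, ?_⟩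
      rw [aeval_C_mul']; change p * X 1 = _; linear_combination h * X 1

lemma tau_ev (σ : R →+* R) (ν : Aut2 R) {u v : P2 R} (hu : tau σ ν u = u) (hv : tau σ ν v = v) (P : P2 R) :
    tau σ ν (ev u v P) = ev u v (map σ P) := by
  rw [tau] at *
  rw [map_ev, aut_ev, hu, hv]
end relk

section realcase

lemma half_ne (a : ℂ) : 1 + a ≠ 0 ∨ Complex.I * (1 - a) ≠ 0 := by
  by_contra! h
  obtain ⟨h1, h2⟩ := h
  have h3 : 1 - a = 0 := (mul_eq_zero.1 h2).resolve_left Complex.I_ne_zero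
  have : (2 : ℂ) = 0 := by linear_combination h1 + h3
  exact two_ne_zero this

lemma map_conj2 (P : P2 ℂ) : map (starRingEnd ℂ) (map (starRingEnd ℂ) P) = P := map_map_inv (starRingEnd ℂ) (fun a => Complex.conj_conj a) P

lemma real_pair (w : P2 ℂ) : map (starRingEnd ℂ) (w + map (starRingEnd ℂ) w) = w + map (starRingEnd ℂ) w ∧
    map (starRingEnd ℂ) (C Complex.I * (w - map (starRingEnd ℂ) w)) = C Complex.I * (w - map (starRingEnd ℂ) w) := by
  constructor
  · rw [map_add, map_conj2, add_comm]
  · rw [map_mul, map_sub, map_conj2, map_C, Complex.conj_I, C_neg]; ring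

lemma real_case (ν : Aut2 ℂ) {u v : P2 ℂ} (hu : tau (starRingEnd ℂ) ν u = u) (hv : tau (starRingEnd ℂ) ν v = v) (g : Aut2 ℂ) (c : ℂ)
    (hg : ev u v (g (X 1)) = C c) : (∃ e : ℂ, (starRingEnd ℂ) e = e ∧ v = C e) ∨
    ∃ g2 : Aut2 ℂ, bc (starRingEnd ℂ) g2 = g2 ∧ ev u v (g2 (X 1)) = 0 := by
  by_cases hA : ∃ a, ev u v (g (X 0)) = C a
  · left
    obtain ⟨a, ha⟩ := hA
    have h1 : ∀ P : P2 ℂ, ∃ e, ev u v (g P) = C e := by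
      intro P
      induction P using MvPolynomial.induction_on with
      | C b => exact ⟨b, by rw [aut_C, ev_C]⟩
      | add p q hp hq =>
        obtain ⟨e, he⟩ := hp
        obtain ⟨e', he'⟩ := hq
        exact ⟨e + e', by rw [map_add, map_add, he, he', C_add]⟩
      | mul_X p i hp =>
        obtain ⟨e, he⟩ := hp
        fin_cases i
        · exact ⟨e * a, by rw [map_mul, map_mul, he, C_mul, ← ha]; rfl⟩
        · exact ⟨e * c, by rw [map_mul, map_mul, he, C_mul, ← hg]; rfl⟩
    obtain ⟨e, he⟩ := h1 (g.symm (X 1))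
    rw [AlgEquiv.apply_symm_apply, ev_X1] at he
    refine ⟨e, ?_, he⟩
    rw [he, tau_C] at hv
    exact C_injective _ _ hv
  · right
    have hker : ∀ P : P2 ℂ, ev u v P = 0 → ∃ Q, P = (g (X 1) - C c) * Q := by
      intro P hP
      obtain ⟨Q, p, hQ⟩ := div_X1 c (g.symm P)
      have e1 : P = (g (X 1) - C c) * g Q + Polynomial.aeval (g (X 0)) p := by
        have := congrArg g hQ
        rwa [AlgEquiv.apply_symm_apply, map_add, map_mul, map_sub, aut_C, aut_aeval] at this
      rw [e1, map_add, map_mul, map_sub, hg, ev_C, sub_self, zero_mul, zero_add, hom_aeval] at hP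
      rw [aeval_inj hA hP, map_zero, add_zero] at e1
      exact ⟨_, e1⟩
    obtain ⟨w, hw⟩ : ∃ w, w = g (X 1) - C c := ⟨_, rfl⟩
    have hw0 : ev u v w = 0 := by rw [hw, map_sub, hg, ev_C, sub_self]
    have hwc : ev u v (map (starRingEnd ℂ) w) = 0 := by rw [← tau_ev (starRingEnd ℂ) ν hu hv, hw0]; simp [tau]
    obtain ⟨Q, hQ⟩ := hker _ hwc
    rw [← hw] at hQ
    have hwne : w ≠ 0 := by
      intro h
      exact aut_nc g ⟨c, sub_eq_zero.1 (hw.symm.trans h)⟩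
    have hmne : map (starRingEnd ℂ) w ≠ 0 := by
      intro h; apply hwne; rw [← map_conj2 w, h, map_zero]
    have hQne : Q ≠ 0 := by rintro rfl; exact hmne (by rw [hQ, mul_zero])
    have hd : tdeg Q = 0 := by
      have h1 := tdeg_map (σ := (starRingEnd ℂ)) (starRingEnd ℂ).injective w
      have h2 : tdeg (w * Q) = tdeg w + tdeg Q := wdeg_mul hwne hQne
      rw [hQ] at h1; omega
    obtain ⟨l, rfl⟩ := tdeg_eq_zero hd
    -- real multiple of w
    obtain ⟨w1, m, hm, hw1, hr1⟩ : ∃ (w1 : P2 ℂ) (m : ℂ), m ≠ 0 ∧ w1 = C m * w ∧ map (starRingEnd ℂ) w1 = w1 := by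
      obtain ⟨r1, r2⟩ := real_pair w
      rcases half_ne l with h | h
      · exact ⟨_, _, h, by rw [hQ, C_add, C_1]; ring, r1⟩
      · exact ⟨_, _, h, by rw [hQ, C_mul, C_sub, C_1]; ring, r2⟩
    obtain ⟨t, -, ht1⟩ := triA_ex 1 m (-(m * c)) one_ne_zero hm (0 : Polynomial ℂ)
    obtain ⟨g1, hg1⟩ : ∃ g1 : Aut2 ℂ, g1 (X 1) = w1 := by
      refine ⟨g * t, ?_⟩
      rw [mul_app, ht1, map_add, map_mul, aut_C, aut_C, hw1, hw, C_neg, C_mul]; ring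
    have e1 : (g1⁻¹ * bc (starRingEnd ℂ) g1) (X 1) = C 1 * X 1 + C 0 := by
      apply g1.injective
      rw [← mul_app, mul_inv_cancel_left, bc_X1, hg1, hr1]; simp [hg1]
    obtain ⟨a, p, ha, -, hx⟩ := tri_x _ e1
    have e2 : map (starRingEnd ℂ) (g1 (X 0)) = C a * g1 (X 0) + Polynomial.aeval w1 p := by
      have := congrArg g1 hx
      rwa [← mul_app, mul_inv_cancel_left, bc_X0, map_add, map_mul, aut_C, aut_aeval, hg1] at this
    obtain ⟨s, b, q, hb, hs, hrs⟩ : ∃ (s : P2 ℂ) (b : ℂ) (q : Polynomial ℂ), b ≠ 0 ∧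
        s = C b * g1 (X 0) + Polynomial.aeval w1 q ∧ map (starRingEnd ℂ) s = s := by
      obtain ⟨r1, r2⟩ := real_pair (g1 (X 0))
      rcases half_ne a with h | h
      · exact ⟨_, _, p, h, by rw [e2, C_add, C_1]; ring, r1⟩
      · exact ⟨_, _, Polynomial.C (-Complex.I) * p, h, by
          rw [e2, aeval_C_mul', C_mul, C_sub, C_1, C_neg]; ring, r2⟩
    obtain ⟨t', ht0', ht1'⟩ := triA_ex b 1 0 hb one_ne_zero q
    have f0 : (g1 * t') (X 0) = s := by
      rw [mul_app, ht0', map_add, map_mul, aut_C, aut_aeval, hg1, hs]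
    have f1 : (g1 * t') (X 1) = w1 := by
      rw [mul_app, ht1', C_0, add_zero, C_1, one_mul, hg1]
    refine ⟨g1 * t', aut_ext (by rw [bc_X0, f0, hrs]) (by rw [bc_X1, f1, hr1]), ?_⟩
    rw [f1, hw1, map_mul, hw0, mul_zero]
end realcase

section nonreal

noncomputable def sD : Polynomial ℂ →+* Polynomial ℂ := Polynomial.mapRingHom (starRingEnd ℂ)

lemma sD_C (a : ℂ) : sD (Polynomial.C a) = Polynomial.C ((starRingEnd ℂ) a) := by simp [sD]
lemma sD_X : sD Polynomial.X = Polynomial.X := by simp [sD]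
lemma sD_sD (p : Polynomial ℂ) : sD (sD p) = p := by
  have : (starRingEnd ℂ).comp (starRingEnd ℂ) = RingHom.id ℂ := RingHom.ext fun a => Complex.conj_conj a
  simp only [sD, Polynomial.coe_mapRingHom, Polynomial.map_map, this, Polynomial.map_id]
lemma sD_inj : Function.Injective sD := fun a b h => by rw [← sD_sD a, h, sD_sD]

lemma real_eval (c : ℂ) (hc : (starRingEnd ℂ) c ≠ c) (z : ℂ) : ∃ p : Polynomial ℂ, sD p = p ∧ p.eval c = z := by
  have him : c.im ≠ 0 := fun h => hc (Complex.conj_eq_iff_im.2 h)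
  refine ⟨Polynomial.C ((z.re - z.im / c.im * c.re : ℝ) : ℂ) + Polynomial.C ((z.im / c.im : ℝ) : ℂ) * Polynomial.X, ?_, ?_⟩
  · rw [map_add, map_mul, sD_C, sD_C, sD_X, Complex.conj_ofReal, Complex.conj_ofReal]
  · simp only [Polynomial.eval_add, Polynomial.eval_mul, Polynomial.eval_C, Polynomial.eval_X]
    apply Complex.ext
    · simp
    · simp; field_simp

lemma real_evalp (c : ℂ) (hc : (starRingEnd ℂ) c ≠ c) (q : Polynomial ℂ) : ∃ p : Polynomial (Polynomial ℂ),
    p.map sD = p ∧ p.map (Polynomial.evalRingHom c) = q := by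
  induction q using Polynomial.induction_on' with
  | add p q hp hq =>
    obtain ⟨a, ha, ha'⟩ := hp
    obtain ⟨b, hb, hb'⟩ := hq
    exact ⟨a + b, by rw [Polynomial.map_add, ha, hb], by rw [Polynomial.map_add, ha', hb']⟩
  | monomial n z =>
    obtain ⟨p, hp, hp'⟩ := real_eval c hc z
    exact ⟨Polynomial.monomial n p, by rw [Polynomial.map_monomial, hp],
      by rw [Polynomial.map_monomial, Polynomial.coe_evalRingHom, hp']⟩

lemma bc_elemA {R S : Type*} [CommRing R] [CommRing S] (σ : R →+* S) (p : Polynomial R) :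
    bc σ (elemA p) = elemA (p.map σ) := by
  apply aut_ext
  · rw [bc_X0, elemA_X0, elemA_X0, map_add, map_aeval1, map_X, map_X]
  · rw [bc_X1, elemA_X1, elemA_X1, map_X]
lemma bc_swapA {R S : Type*} [CommRing R] [CommRing S] (σ : R →+* S) :
    bc σ swapA = swapA := by
  apply aut_ext
  · rw [bc_X0, swapA_X0, swapA_X0, map_X]
  · rw [bc_X1, swapA_X1, swapA_X1, map_X]

lemma nonreal_case (c : ℂ) (hc : (starRingEnd ℂ) c ≠ c) (g : Aut2 ℂ) : ∃ (γ : Aut2 (Polynomial ℂ)) (a b : ℂ), a ≠ 0 ∧ b ≠ 0 ∧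
    bc sD γ = γ ∧ g (X 0) = C a * bc (Polynomial.evalRingHom c) γ (X 0) ∧
    g (X 1) = C b * bc (Polynomial.evalRingHom c) γ (X 1) := by
  induction g using jung_ind with
  | h1 =>
    refine ⟨1, 1, 1, one_ne_zero, one_ne_zero, map_one _, ?_, ?_⟩ <;> rw [C_1, one_mul, map_one]
  | he φ q ih =>
    obtain ⟨γ, a, b, ha, hb, hr, h0, h1⟩ := ih
    obtain ⟨p, hp, hp'⟩ := real_evalp c hc (Polynomial.C a⁻¹ * q.comp (Polynomial.C b * Polynomial.X))
    refine ⟨γ * elemA p, a, b, ha, hb, by rw [map_mul, hr, bc_elemA, hp], ?_, ?_⟩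
    · rw [map_mul, bc_elemA, hp', mul_app, mul_app, elemA_X0, elemA_X0, map_add, map_add, aut_aeval, aut_aeval,
        aeval_C_mul', Polynomial.aeval_comp, aeval_C_mul', Polynomial.aeval_X, h0, h1]
      have : C a * C a⁻¹ = (1 : P2 ℂ) := by rw [← C_mul, mul_inv_cancel₀ ha, C_1]
      linear_combination (-Polynomial.aeval (C b * (bc (Polynomial.evalRingHom c)) γ (X 1)) q) * this
    · rw [map_mul, bc_elemA, mul_app, mul_app, elemA_X1, elemA_X1, h1]
  | hs φ ih =>
    obtain ⟨γ, a, b, ha, hb, hr, h0, h1⟩ := ih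
    refine ⟨γ * swapA, b, a, hb, ha, by rw [map_mul, hr, bc_swapA], ?_, ?_⟩
    · rw [map_mul, bc_swapA, mul_app, mul_app, swapA_X0, h1]
    · rw [map_mul, bc_swapA, mul_app, mul_app, swapA_X1, h0]
  | ht φ a' b' h ih =>
    obtain ⟨γ, a, b, ha, hb, hr, h0, h1⟩ := ih
    refine ⟨γ, a' * a, b, mul_ne_zero (left_ne_zero_of_mul_eq_one h) ha, hb, hr, ?_, ?_⟩
    · rw [mul_app, torusA_X0, map_mul, aut_C, h0, C_mul, mul_assoc]
    · rw [mul_app, torusA_X1, h1]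
end nonreal


lemma unif_ev (c : ℂ) : IsUnif (Polynomial.evalRingHom c) (Polynomial.X - Polynomial.C c) := by
  refine ⟨fun a => ⟨Polynomial.C a, by simp⟩, Polynomial.X_sub_C_ne_zero c, fun a => ?_, fun a ha => ?_⟩
  · rw [Polynomial.dvd_iff_isRoot]; rfl
  · refine ⟨a.natDegree + 1, fun h => ha (Polynomial.eq_zero_of_dvd_of_natDegree_lt h ?_)⟩
    rw [Polynomial.natDegree_pow, Polynomial.natDegree_X_sub_C]; omega

lemma eval_sD (c : ℂ) (p : Polynomial ℂ) : (sD p).eval ((starRingEnd ℂ) c) = (starRingEnd ℂ) (p.eval c) := by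
  rw [sD, Polynomial.coe_mapRingHom, Polynomial.eval_map, Polynomial.eval₂_hom]

section desc
variable {K : Type*} [Field K] [CharZero K] [Algebra (Polynomial ℂ) K] [IsFractionRing (Polynomial ℂ) K]

lemma rel_ex {u v : P2 (Polynomial ℂ)} (ψ : Aut2 K) (h0 : ψ (X 0) = map (algebraMap _ K) u)
    (h1 : ψ (X 1) = map (algebraMap _ K) v) (i : Fin 2) : (∃ Q : P2 (Polynomial ℂ), ev u v Q = X i) ∨
    ∃ (c : ℂ) (g : Aut2 ℂ) (e : ℂ), ev (map (Polynomial.evalRingHom c) u) (map (Polynomial.evalRingHom c) v) (g (X 1)) = C e := by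
  have key : ∀ (n : ℕ) (d : Polynomial ℂ) (Q : P2 (Polynomial ℂ)), d ≠ 0 → d.natDegree ≤ n → ev u v Q = C d * X i →
      (∃ Q : P2 (Polynomial ℂ), ev u v Q = X i) ∨
    ∃ (c : ℂ) (g : Aut2 ℂ) (e : ℂ), ev (map (Polynomial.evalRingHom c) u) (map (Polynomial.evalRingHom c) v) (g (X 1)) = C e := by
    intro n
    induction n with
    | zero =>
      intro d Q hd hn hQ
      left
      obtain ⟨a, rfl⟩ := Polynomial.natDegree_eq_zero.1 (Nat.le_zero.1 hn)
      have ha : a ≠ 0 := by rintro rfl; simp at hd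
      refine ⟨C (Polynomial.C a⁻¹) * Q, ?_⟩
      rw [map_mul, ev_C, hQ, ← mul_assoc, ← C_mul, ← Polynomial.C_mul, inv_mul_cancel₀ ha, Polynomial.C_1, C_1, one_mul]
    | succ n ih =>
      intro d Q hd hn hQ
      by_cases hn' : d.natDegree ≤ n
      · exact ih d Q hd hn' hQ
      obtain ⟨c, hc⟩ := IsAlgClosed.exists_root d (by
        rw [Polynomial.degree_eq_natDegree hd]; exact_mod_cast (by omega))
      have hu := unif_ev c
      by_cases hr : map (Polynomial.evalRingHom c) Q = 0
      · obtain ⟨Q', rfl⟩ := hu.dvdP hr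
        obtain ⟨d', rfl⟩ := Polynomial.dvd_iff_isRoot.2 hc
        have hd' : d' ≠ 0 := right_ne_zero_of_mul hd
        refine ih d' Q' hd' ?_ ?_
        · rw [Polynomial.natDegree_mul (Polynomial.X_sub_C_ne_zero c) hd', Polynomial.natDegree_X_sub_C] at hn; omega
        · apply Cpi_cancel (Polynomial.X_sub_C_ne_zero c)
          rw [map_mul, ev_C] at hQ
          rw [hQ, C_mul, mul_assoc]
      · right
        have hrel : ev (map (Polynomial.evalRingHom c) u) (map (Polynomial.evalRingHom c) v)
            (map (Polynomial.evalRingHom c) Q) = 0 := by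
          rw [← map_ev, hQ, map_mul, map_C, Polynomial.coe_evalRingHom, hc, C_0, zero_mul]
        have hF : FClaim (Polynomial ℂ) (Polynomial.evalRingHom c) (ψ⁻¹ (X i)) := by
          have := furter (K := K) hu ψ⁻¹
          fin_cases i
          · exact this.1
          · exact this.2
        obtain ⟨g, h, hgh⟩ := hF (algebraMap _ K d) 0 Q (by
          apply ψ.injective
          rw [aut_eq_ev ψ (map _ Q), h0, h1, ← map_ev, hQ, C_0, add_zero, map_mul ψ, aut_C, ← mul_app, mul_inv_cancel,
            one_app, map_mul, map_C, map_X])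
        rw [hgh, hom_aeval] at hrel
        refine ⟨c, g, ?_⟩
        by_contra hne
        rw [aeval_inj hne hrel, map_zero] at hgh
        exact hr hgh
  obtain ⟨d, Q, hd, hQ⟩ := clearP (O := Polynomial ℂ) (ψ⁻¹ (X i))
  refine key _ d Q hd le_rfl ?_
  apply mapK_inj (K := K)
  rw [map_ev, ← h0, ← h1, ← aut_eq_ev, hQ, map_mul, aut_C, ← mul_app, mul_inv_cancel, one_app, map_mul, map_C, map_X]

lemma real_div (ν : Aut2 (Polynomial ℂ)) {u v : P2 (Polynomial ℂ)} (hu : tau sD ν u = u) (hv : tau sD ν v = v)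
    (c : ℂ) (g : Aut2 ℂ) (e : ℂ)
    (hg : ev (map (Polynomial.evalRingHom c) u) (map (Polynomial.evalRingHom c) v) (g (X 1)) = C e) :
    ∃ (γ : Aut2 (Polynomial ℂ)) (m r : Polynomial ℂ) (v' : P2 (Polynomial ℂ)), bc sD γ = γ ∧ m ≠ 0 ∧ 1 ≤ m.natDegree ∧
      sD m = m ∧ sD r = r ∧ ev u v (γ (X 1)) - C r = C m * v' := by
  have hun := unif_ev c
  by_cases hc : (starRingEnd ℂ) c = c
  · have hcomp : (starRingEnd ℂ).comp (Polynomial.evalRingHom c) = (Polynomial.evalRingHom c).comp sD := by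
      apply RingHom.ext
      intro p
      have := eval_sD c p
      rw [hc] at this
      exact this.symm
    have htau : ∀ P : P2 (Polynomial ℂ), tau sD ν P = P → tau (starRingEnd ℂ) (bc (Polynomial.evalRingHom c) ν)
        (map (Polynomial.evalRingHom c) P) = map (Polynomial.evalRingHom c) P := by
      intro P hP
      rw [tau, map_map, hcomp, ← map_map, bc_map]
      rw [tau] at hP
      rw [hP]
    have fm : sD (Polynomial.X - Polynomial.C c) = Polynomial.X - Polynomial.C c := by
      rw [map_sub, sD_X, sD_C, hc]
    rcases real_case _ (htau u hu) (htau v hv) g e hg with ⟨b, hb, hvb⟩ | ⟨g2, hg2, hz⟩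
    · obtain ⟨v', hv'⟩ := hun.dvdP (P := v - C (Polynomial.C b)) (by rw [map_sub, hvb, map_C]; simp)
      exact ⟨1, _, Polynomial.C b, v', map_one _, hun.2.1, by rw [Polynomial.natDegree_X_sub_C], fm,
        by rw [sD_C, hb], by rw [one_app, ev_X1, hv']⟩
    · have hid : (Polynomial.evalRingHom c).comp Polynomial.C = RingHom.id ℂ := by ext <;> simp
      have hcs : sD.comp Polynomial.C = (Polynomial.C).comp (starRingEnd ℂ) := RingHom.ext fun a => sD_C a
      obtain ⟨v', hv'⟩ := hun.dvdP (P := ev u v (bc Polynomial.C g2 (X 1)) - C 0) (by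
        rw [map_sub, map_ev, bc_X1, map_map, hid, map_id, hz]; simp)
      refine ⟨bc Polynomial.C g2, _, 0, v', ?_, hun.2.1, by rw [Polynomial.natDegree_X_sub_C], fm, map_zero _, hv'⟩
      have a0 := congrArg (fun f => f (X 0)) hg2
      have a1 := congrArg (fun f => f (X 1)) hg2
      simp only [bc_X0, bc_X1] at a0 a1
      apply aut_ext
      · rw [bc_X0, bc_X0, map_map, hcs, ← map_map, a0]
      · rw [bc_X1, bc_X1, map_map, hcs, ← map_map, a1]
  · obtain ⟨γ, a, b, ha, hb, hr, -, h1⟩ := nonreal_case c hc g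
    obtain ⟨r, hrr, hre⟩ := real_eval c hc (b⁻¹ * e)
    obtain ⟨T, hT⟩ : ∃ T, T = ev u v (γ (X 1)) - C r := ⟨_, rfl⟩
    have hTf : tau sD ν T = T := by
      have : map sD (γ (X 1)) = γ (X 1) := by rw [← bc_X1, hr]
      rw [hT, tau_sub, tau_ev sD ν hu hv, tau_C, hrr, this]
    have hT0 : map (Polynomial.evalRingHom c) T = 0 := by
      rw [h1, map_mul, ev_C, bc_X1] at hg
      rw [hT, map_sub, map_ev, map_C, Polynomial.coe_evalRingHom, hre, C_mul, ← hg, ← mul_assoc, ← C_mul,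
        inv_mul_cancel₀ hb, C_1, one_mul, sub_self]
    obtain ⟨T1, hT1⟩ := hun.dvdP hT0
    have hT2 : T = C (Polynomial.X - Polynomial.C ((starRingEnd ℂ) c)) * tau sD ν T1 := by
      rw [← hTf]
      conv_lhs => rw [hT1]
      rw [tau_mul, tau_C, map_sub, sD_X, sD_C]
    have hT3 : map (Polynomial.evalRingHom c) (tau sD ν T1) = 0 := by
      have := congrArg (map (Polynomial.evalRingHom c)) hT2
      rw [hT0, map_mul, map_C] at this
      refine (mul_eq_zero.1 this.symm).resolve_left ?_
      intro h
      have h := C_eq_zero.1 h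
      simp [sub_eq_zero] at h
      exact hc h.symm
    obtain ⟨T2, hT4⟩ := hun.dvdP hT3
    refine ⟨γ, (Polynomial.X - Polynomial.C ((starRingEnd ℂ) c)) * (Polynomial.X - Polynomial.C c), r, T2, hr,
      mul_ne_zero (Polynomial.X_sub_C_ne_zero _) (Polynomial.X_sub_C_ne_zero _), ?_, ?_, hrr, ?_⟩
    · rw [Polynomial.natDegree_mul (Polynomial.X_sub_C_ne_zero _) (Polynomial.X_sub_C_ne_zero _),
        Polynomial.natDegree_X_sub_C, Polynomial.natDegree_X_sub_C]; omega
    · rw [map_mul, map_sub, map_sub, sD_X, sD_C, sD_C, Complex.conj_conj, mul_comm]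
    · rw [← hT, hT2, hT4, C_mul, mul_assoc]

lemma descent (ν : Aut2 (Polynomial ℂ)) (n : ℕ) : ∀ (u v : P2 (Polynomial ℂ)) (j : Polynomial ℂ) (ψ : Aut2 K),
    tau sD ν u = u → tau sD ν v = v → ψ (X 0) = map (algebraMap _ K) u → ψ (X 1) = map (algebraMap _ K) v →
    jac u v = C j → j.natDegree ≤ n → ∃ γ : Aut2 (Polynomial ℂ), ν * bc sD γ = γ := by
  induction n using Nat.strong_induction_on with
  | _ n ih =>
  intro u v j ψ hu hv h0 h1 hj hn
  have hj0 : j ≠ 0 := by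
    rintro rfl
    have := jac_aut_unit ψ
    rw [h0, h1, ← map_jac, hj, C_0, map_zero] at this
    exact not_isUnit_zero this
  have step : (∃ (c : ℂ) (g : Aut2 ℂ) (e : ℂ), ev (map (Polynomial.evalRingHom c) u) (map (Polynomial.evalRingHom c) v) (g (X 1)) = C e) →
      ∃ γ : Aut2 (Polynomial ℂ), ν * bc sD γ = γ := by
    rintro ⟨c, g, e, hg⟩
    obtain ⟨γ, m, r, v', hγ, hm, hm1, hsm, hsr, hv'⟩ := real_div ν hu hv c g e hg
    have hγ0 : map sD (γ (X 0)) = γ (X 0) := by rw [← bc_X0, hγ]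
    have hγ1 : map sD (γ (X 1)) = γ (X 1) := by rw [← bc_X1, hγ]
    have hmK : algebraMap _ K m ≠ 0 := by rwa [Ne, IsFractionRing.to_map_eq_zero_iff]
    have hjj : jac (ev u v (γ (X 0))) (C m * v') = ev u v (jac (γ (X 0)) (γ (X 1))) * jac u v := by
      rw [← jac_comp, ← hv', jac_swap, sub_eq_add_neg, ← C_neg, jac_add_left, jac_swap]
      simp [jac]
    obtain ⟨a, ha, hja⟩ := isUnit_iff_eq_C_of_isReduced.1 (jac_aut_unit γ)
    rw [hja, ev_C, hj, jac_swap, jac_C_left, ← C_mul] at hjj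
    have hvf : tau sD ν v' = v' := by
      apply Cpi_cancel hm
      rw [← hv']
      have := congrArg (tau sD ν) hv'
      rw [tau_mul, tau_C, hsm, tau_sub, tau_ev sD ν hu hv, tau_C, hsr, hγ1] at this
      exact this.symm
    obtain ⟨t, ht0, ht1⟩ := triA_ex (1 : K) (algebraMap _ K m)⁻¹ (-((algebraMap _ K m)⁻¹ * algebraMap _ K r)) one_ne_zero
      (inv_ne_zero hmK) 0
    have hψ0 : (ψ * bc (algebraMap _ K) γ * t) (X 0) = map (algebraMap _ K) (ev u v (γ (X 0))) := by
      rw [mul_app, mul_app, ht0, map_zero, add_zero, C_1, one_mul, bc_X0, aut_eq_ev, h0, h1, ← map_ev]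
    have hψ1 : (ψ * bc (algebraMap _ K) γ * t) (X 1) = map (algebraMap _ K) v' := by
      rw [mul_app, mul_app, ht1, map_add, map_add, map_mul, map_mul, aut_C, aut_C, aut_C, aut_C, bc_X1,
        aut_eq_ev, h0, h1, ← map_ev]
      have e1 := congrArg (map (algebraMap _ K)) hv'
      rw [map_sub, map_mul, map_C, map_C] at e1
      have e2 : C (algebraMap _ K m)⁻¹ * C (algebraMap _ K m) = (1 : P2 K) := by
        rw [← C_mul, inv_mul_cancel₀ hmK, C_1]
      rw [C_neg, C_mul]
      linear_combination C (algebraMap _ K m)⁻¹ * e1 + map (algebraMap _ K) v' * e2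
    have hjc : jac (ev u v (γ (X 0))) v' = C (coeff 0 (jac (ev u v (γ (X 0))) v')) := by
      apply mapK_inj (K := K)
      have := jac_aut_unit (ψ * bc (algebraMap _ K) γ * t)
      rw [hψ0, hψ1, ← map_jac] at this
      obtain ⟨b, -, hb⟩ := isUnit_iff_eq_C_of_isReduced.1 this
      rw [map_C, ← coeff_map, hb, coeff_zero_C]
    obtain ⟨j', hj'⟩ : ∃ j', jac (ev u v (γ (X 0))) v' = C j' := ⟨_, hjc⟩
    have e3 : m * j' = a * j := by
      apply C_injective (Fin 2)
      rw [← hjj, C_mul, ← hj', jac_swap _ v']; ring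
    have hj'0 : j' ≠ 0 := by
      rintro rfl
      rw [mul_zero] at e3
      exact mul_ne_zero ha.ne_zero hj0 e3.symm
    have e4 := congrArg Polynomial.natDegree e3
    rw [Polynomial.natDegree_mul hm hj'0, Polynomial.natDegree_mul ha.ne_zero hj0,
      Polynomial.natDegree_eq_zero_of_isUnit ha] at e4
    refine ih j'.natDegree (by omega) _ v' j' _ ?_ hvf hψ0 hψ1 hj' le_rfl
    rw [tau_ev sD ν hu hv, hγ0]
  rcases rel_ex ψ h0 h1 0 with ⟨A, hA⟩ | h
  · rcases rel_ex ψ h0 h1 1 with ⟨B, hB⟩ | h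
    · obtain ⟨γ, g0, g1⟩ := aut_of_surj hA hB
      refine ⟨γ, aut_ext ?_ ?_⟩
      · rw [mul_app, bc_X0, g0]; exact hu
      · rw [mul_app, bc_X1, g1]; exact hv
    · exact step h
  · exact step h
end desc

section H1D
abbrev KK := FractionRing (Polynomial ℂ)

theorem H1_D (ν : Aut2 (Polynomial ℂ)) (hν : ν * bc sD ν = 1) : ∃ γ : Aut2 (Polynomial ℂ), ν * bc sD γ = γ := by
  obtain ⟨s, hs⟩ : ∃ s : KK →+* KK, ∀ a, s (algebraMap _ KK a) = algebraMap _ KK (sD a) := by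
    have hinj : Function.Injective ((algebraMap (Polynomial ℂ) KK).comp sD) :=
      (IsFractionRing.injective (Polynomial ℂ) KK).comp sD_inj
    exact ⟨IsFractionRing.lift hinj, fun a => IsFractionRing.lift_algebraMap hinj a⟩
  have hcs : s.comp (algebraMap _ KK) = (algebraMap _ KK).comp sD := RingHom.ext hs
  have hss : ∀ a, s (s a) = a := by
    intro a
    obtain ⟨n, d, hd, rfl⟩ := IsFractionRing.div_surjective (A := Polynomial ℂ) a
    rw [map_div₀, map_div₀, hs, hs, hs, hs, sD_sD, sD_sD]
  have hbc : ∀ f : Aut2 (Polynomial ℂ), bc s (bc (algebraMap _ KK) f) = bc (algebraMap _ KK) (bc sD f) := by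
    intro f
    apply aut_ext
    · rw [bc_X0, bc_X0, bc_X0, bc_X0, map_map, hcs, ← map_map]
    · rw [bc_X1, bc_X1, bc_X1, bc_X1, map_map, hcs, ← map_map]
  have hI : algebraMap _ KK (Polynomial.C Complex.I) ≠ 0 := by
    rw [Ne, IsFractionRing.to_map_eq_zero_iff]; simp
  obtain ⟨β, hβ⟩ := H1_field s hss (algebraMap _ KK (Polynomial.C Complex.I)) hI
    (by rw [hs, sD_C, Complex.conj_I, Polynomial.C_neg, map_neg]) (bc (algebraMap _ KK) ν)
    (by rw [hbc, ← map_mul, hν, map_one])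
  have cl : ∀ i : Fin 2, ∃ (d : Polynomial ℂ) (u : P2 (Polynomial ℂ)), d ≠ 0 ∧ tau sD ν u = u ∧
      map (algebraMap _ KK) u = C (algebraMap _ KK d) * β (X i) := by
    intro i
    obtain ⟨d, Q, hd, hQ⟩ := clearP (O := Polynomial ℂ) (β (X i))
    have hM : map (algebraMap _ KK) (C (sD d) * Q) = C (algebraMap _ KK (d * sD d)) * β (X i) := by
      rw [map_mul, hQ, map_C, map_mul, C_mul]; ring
    refine ⟨d * sD d, C (sD d) * Q, mul_ne_zero hd ((map_ne_zero_iff _ sD_inj).2 hd), ?_, hM⟩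
    apply mapK_inj (K := KK)
    rw [tau, ← bc_map, map_map, ← hcs, ← map_map, hM, map_mul, map_mul, map_C, aut_C, hs, map_mul, sD_sD, mul_comm (sD d)]
    congr 1
    have h : bc (algebraMap _ KK) ν (bc s β (X i)) = β (X i) := by rw [← mul_app, hβ]
    have h2 := bc_map s β (X i)
    rw [map_X] at h2
    rw [← h2, h]
  obtain ⟨d0, u, hd0, hu, hu'⟩ := cl 0
  obtain ⟨d1, v, hd1, hv, hv'⟩ := cl 1
  have hd0K : algebraMap _ KK d0 ≠ 0 := by rwa [Ne, IsFractionRing.to_map_eq_zero_iff]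
  have hd1K : algebraMap _ KK d1 ≠ 0 := by rwa [Ne, IsFractionRing.to_map_eq_zero_iff]
  obtain ⟨t, ht0, ht1⟩ := triA_ex (algebraMap _ KK d0) (algebraMap _ KK d1) 0 hd0K hd1K 0
  have h0 : (β * t) (X 0) = map (algebraMap _ KK) u := by
    rw [mul_app, ht0, map_zero, add_zero, map_mul, aut_C, hu']
  have h1 : (β * t) (X 1) = map (algebraMap _ KK) v := by
    rw [mul_app, ht1, C_0, add_zero, map_mul, aut_C, hv']
  have hjc : jac u v = C (coeff 0 (jac u v)) := by
    apply mapK_inj (K := KK)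
    have := jac_aut_unit (β * t)
    rw [h0, h1, ← map_jac] at this
    obtain ⟨b, -, hb⟩ := isUnit_iff_eq_C_of_isReduced.1 this
    rw [map_C, ← coeff_map, hb, coeff_zero_C]
  exact descent ν _ u v _ (β * t) hu hv h0 h1 hjc le_rfl
end H1D


section ach
variable {k : Type*} [Field k] [CharZero k]

/-- evaluation at zero -/
noncomputable def ez (k : Type*) [Field k] : Polynomial k →+* k := Polynomial.evalRingHom 0

lemma ez_C (a : k) : ez k (Polynomial.C a) = a := by simp [ez]
lemma ez_X : ez k Polynomial.X = 0 := by simp [ez]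
lemma ez_pow {s : ℕ} (hs : 1 ≤ s) : ez k (Polynomial.X ^ s) = 0 := by
  rw [map_pow, ez_X, zero_pow (by omega)]
lemma ez_mapC (q : Polynomial k) : (q.map Polynomial.C).map (ez k) = q := by
  rw [Polynomial.map_map]
  have : (ez k).comp Polynomial.C = RingHom.id k := RingHom.ext ez_C
  rw [this, Polynomial.map_id]

def Ach (s : ℕ) (a b : P2 k) : Prop := ∃ (ε : Aut2 (Polynomial k)) (A B : P2 (Polynomial k)),
  ε (X 0) = X 0 + C (Polynomial.X ^ s) * A ∧ ε (X 1) = X 1 + C (Polynomial.X ^ s) * B ∧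
  map (ez k) A = a ∧ map (ez k) B = b

lemma bc_ez_one {s : ℕ} (hs : 1 ≤ s) {ε : Aut2 (Polynomial k)} {A B : P2 (Polynomial k)}
    (h0 : ε (X 0) = X 0 + C (Polynomial.X ^ s) * A) (h1 : ε (X 1) = X 1 + C (Polynomial.X ^ s) * B) :
    bc (ez k) ε = 1 := by
  apply aut_ext
  · rw [bc_X0, h0, map_add, map_mul, map_X, map_C, ez_pow hs, one_app, C_0, zero_mul, add_zero]
  · rw [bc_X1, h1, map_add, map_mul, map_X, map_C, ez_pow hs, one_app, C_0, zero_mul, add_zero]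

lemma Ach.add {s : ℕ} (hs : 1 ≤ s) {a b a' b' : P2 k} (h : Ach s a b) (h' : Ach s a' b') :
    Ach s (a + a') (b + b') := by
  obtain ⟨ε, A, B, h0, h1, hA, hB⟩ := h
  obtain ⟨ε', A', B', h0', h1', hA', hB'⟩ := h'
  have hb := bc_ez_one hs h0 h1
  refine ⟨ε * ε', A + ε A', B + ε B', ?_, ?_, ?_, ?_⟩
  · rw [mul_app, h0', map_add, map_mul, aut_C, h0]; ring
  · rw [mul_app, h1', map_add, map_mul, aut_C, h1]; ring
  · rw [map_add, hA, ← bc_map, hb, one_app, hA']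
  · rw [map_add, hB, ← bc_map, hb, one_app, hB']

lemma Ach.tri (s : ℕ) (q : Polynomial k) : Ach s (Polynomial.aeval (X 1 : P2 k) q) 0 := by
  refine ⟨elemA (Polynomial.C (Polynomial.X ^ s) * q.map Polynomial.C), Polynomial.aeval (X 1) (q.map Polynomial.C), 0, ?_, ?_, ?_, ?_⟩
  · rw [elemA_X0, aeval_C_mul']
  · rw [elemA_X1]; simp
  · rw [map_aeval1, ez_mapC, map_X]
  · simp

def AchH (s : ℕ) (H : P2 k) : Prop := Ach s (pderiv 1 H) (- pderiv 0 H)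

lemma AchH.add {s : ℕ} (hs : 1 ≤ s) {H H' : P2 k} (h : AchH s H) (h' : AchH s H') : AchH s (H + H') := by
  have := Ach.add hs h h'
  unfold AchH
  rw [map_add, map_add, neg_add]
  exact this

lemma ach_shear (s : ℕ) (t : k) (q : Polynomial k) :
    Ach s (C t * Polynomial.aeval (X 0 + C t * X 1 : P2 k) q) (- Polynomial.aeval (X 0 + C t * X 1 : P2 k) q) := by
  have hneg : ∀ p : Polynomial (Polynomial k), ∀ G : P2 (Polynomial k), Polynomial.aeval G (-p) = - Polynomial.aeval G p :=
    fun p G => map_neg _ p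
  have hl : ∀ G : P2 (Polynomial k), Polynomial.aeval G (Polynomial.C (Polynomial.C t) * Polynomial.X : Polynomial (Polynomial k)) = C (Polynomial.C t) * G := by
    intro G; rw [aeval_C_mul', Polynomial.aeval_X]
  set l : P2 (Polynomial k) := X 0 + C (Polynomial.C t) * X 1 with hldef
  have e0 : ∀ P : P2 (Polynomial k), (swapA * elemA (-(Polynomial.C (Polynomial.X ^ s) * q.map Polynomial.C)) * swapA : Aut2 (Polynomial k)) P
    = ev (X 0) (X 1 - C (Polynomial.X ^ s) * Polynomial.aeval (X 0) (q.map Polynomial.C)) P := by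
    intro P
    rw [aut_eq_ev]
    congr 2
    · rw [mul_app, mul_app, swapA_X0, elemA_X1, swapA_X1]
    · rw [mul_app, mul_app, swapA_X1, elemA_X0, hneg, aeval_C_mul', map_add, map_neg, map_mul, aut_C, aut_aeval, swapA_X0, swapA_X1]
      ring
  refine ⟨elemA (Polynomial.C (Polynomial.C t) * Polynomial.X) * (swapA * elemA (-(Polynomial.C (Polynomial.X ^ s) * q.map Polynomial.C)) * swapA)
    * elemA (-(Polynomial.C (Polynomial.C t) * Polynomial.X)), C (Polynomial.C t) * Polynomial.aeval l (q.map Polynomial.C), - Polynomial.aeval l (q.map Polynomial.C), ?_, ?_, ?_, ?_⟩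
  · rw [mul_app, mul_app, elemA_X0, hneg, hl, e0, map_add, map_neg, map_mul, ev_X0, ev_C, ev_X1]
    rw [map_add, map_neg, map_mul, map_sub, map_mul, aut_C, aut_C, aut_aeval, elemA_X0, elemA_X1, hl, ← hldef]
    rw [hldef]; ring
  · rw [mul_app, mul_app, elemA_X1, e0, ev_X1]
    rw [map_sub, map_mul, aut_C, aut_aeval, elemA_X0, elemA_X1, hl, ← hldef]
    ring
  · rw [map_mul, map_C, ez_C, map_aeval1, ez_mapC, hldef, map_add, map_mul, map_C, ez_C, map_X, map_X]
  · rw [map_neg, map_aeval1, ez_mapC, hldef, map_add, map_mul, map_C, ez_C, map_X, map_X]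

lemma achH_aeval (s : ℕ) (t : k) (p : Polynomial k) : AchH s (Polynomial.aeval (X 0 + C t * X 1 : P2 k) p) := by
  have h := ach_shear s t (Polynomial.derivative p)
  unfold AchH
  have h1 : pderiv 1 (X 0 + C t * X 1 : P2 k) = C t := by simp [pderiv_X]
  have h0 : pderiv 0 (X 0 + C t * X 1 : P2 k) = 1 := by simp [pderiv_X]
  rw [Derivation.map_aeval, Derivation.map_aeval, h1, h0, smul_eq_mul, smul_eq_mul, mul_one, mul_comm]
  exact h

lemma span_top : Submodule.span k (Set.range fun p : k × ℕ => (X 0 + C p.1 * X 1 : P2 k) ^ p.2) = ⊤ := by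
  by_contra hne
  obtain ⟨f, hf0, hf⟩ := Submodule.exists_le_ker_of_lt_top _ (lt_top_iff_ne_top.2 hne)
  apply hf0
  have hv : ∀ (t : k) (n : ℕ), f ((X 0 + C t * X 1 : P2 k) ^ n) = 0 := fun t n =>
    LinearMap.mem_ker.1 (hf (Submodule.subset_span ⟨(t, n), rfl⟩))
  have hm : ∀ n m : ℕ, m ≤ n → f (X 0 ^ (n - m) * X 1 ^ m : P2 k) = 0 := by
    intro n
    have hp : (∑ m ∈ Finset.range (n+1), Polynomial.monomial m (f (X 0 ^ (n - m) * X 1 ^ m : P2 k) * (n.choose m : k))) = 0 := by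
      apply Polynomial.funext
      intro t
      rw [Polynomial.eval_zero, ← hv t n, add_comm (X 0 : P2 k), add_pow, map_sum, Polynomial.eval_finsetSum]
      apply Finset.sum_congr rfl
      intro m _
      have : (C t * X 1 : P2 k) ^ m * X 0 ^ (n - m) * (n.choose m : P2 k) = (t ^ m * (n.choose m : k)) • (X 0 ^ (n - m) * X 1 ^ m : P2 k) := by
        rw [smul_eq_C_mul, mul_pow, C_mul, C_pow, map_natCast]; ring
      rw [this, map_smul, Polynomial.eval_monomial, smul_eq_mul]; ring
    intro m hmn
    have := congrArg (fun p => Polynomial.coeff p m) hp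
    simp only [Polynomial.finsetSum_coeff, Polynomial.coeff_monomial, Polynomial.coeff_zero] at this
    rw [Finset.sum_ite_eq' , if_pos (by simp; omega)] at this
    exact (mul_eq_zero.1 this).resolve_right (by exact_mod_cast (Nat.choose_pos hmn).ne')
  refine LinearMap.ext fun P => ?_
  rw [LinearMap.zero_apply]
  induction P using MvPolynomial.induction_on' with
  | monomial d c =>
    have := hm (d 0 + d 1) (d 1) (by omega)
    rw [Nat.add_sub_cancel] at this
    rw [monomial_eq2, ← smul_eq_C_mul, map_smul, this, smul_zero]
  | add p q hp hq => rw [map_add, hp, hq, add_zero]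

lemma achH_all {s : ℕ} (hs : 1 ≤ s) (H : P2 k) : AchH s H := by
  have hz : AchH s (0 : P2 k) := by
    have := achH_aeval (k := k) s 0 0
    rwa [map_zero] at this
  have hH : H ∈ Submodule.span k (Set.range fun p : k × ℕ => (X 0 + C p.1 * X 1 : P2 k) ^ p.2) := by
    rw [span_top]; trivial
  have : ∀ c : k, AchH s (C c * H) := by
    induction hH using Submodule.span_induction with
    | mem x hx =>
      obtain ⟨⟨t, n⟩, rfl⟩ := hx
      intro c
      have := achH_aeval s t (Polynomial.C c * Polynomial.X ^ n)
      rwa [aeval_C_mul', map_pow, Polynomial.aeval_X] at this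
    | zero => intro c; rwa [mul_zero]
    | add x y _ _ hx hy => intro c; rw [mul_add]; exact (hx c).add hs (hy c)
    | smul a x _ hx => intro c; rw [smul_eq_C_mul, ← mul_assoc, ← C_mul]; exact hx _
  simpa using this 1

lemma pderiv_comm2 (P : P2 k) : pderiv 0 (pderiv 1 P) = pderiv 1 (pderiv 0 P) := by
  induction P using MvPolynomial.induction_on with
  | C a => simp
  | add p q hp hq => simp [hp, hq]
  | mul_X p i hp =>
    fin_cases i
    · simp [pderiv_X, hp]; ring
    · simp [pderiv_X, hp]; ring

lemma antider (b : P2 k) : ∃ H : P2 k, pderiv 0 H = b := by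
  induction b using MvPolynomial.induction_on' with
  | monomial u a =>
    refine ⟨monomial (u + Finsupp.single 0 1) (a / (u 0 + 1)), ?_⟩
    rw [pderiv_monomial]
    have hne : (u 0 : k) + 1 ≠ 0 := by exact_mod_cast Nat.succ_ne_zero (u 0)
    congr 1
    · simp
    · simp; field_simp
  | add p q hp hq =>
    obtain ⟨H, hH⟩ := hp
    obtain ⟨H', hH'⟩ := hq
    exact ⟨H + H', by rw [map_add, hH, hH']⟩

theorem ach_div {s : ℕ} (hs : 1 ≤ s) {a b : P2 k} (h : pderiv 0 a + pderiv 1 b = 0) : Ach s a b := by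
  obtain ⟨H, hH⟩ := antider (-b)
  have : pderiv 0 (a - pderiv 1 H) = 0 := by
    rw [map_sub, pderiv_comm2, hH, map_neg, sub_neg_eq_add, h]
  obtain ⟨q, hq⟩ := ker_pderiv0 this
  have h1 := (achH_all hs H)
  unfold AchH at h1
  have h2 := Ach.add hs h1 (Ach.tri s q)
  rw [← hq, hH] at h2
  simpa using h2

end ach


lemma unz : IsUnif (ez ℂ) Polynomial.X := by
  have := unif_ev 0
  rwa [Polynomial.C_0, sub_zero] at this

lemma ez_sD (p : Polynomial ℂ) : ez ℂ (sD p) = (starRingEnd ℂ) (ez ℂ p) := by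
  have := eval_sD 0 p
  rw [map_zero] at this
  exact this

lemma bc_comp {R S T : Type*} [CommRing R] [CommRing S] [CommRing T] (f : S →+* T) (g : R →+* S) (x : Aut2 R) :
    bc f (bc g x) = bc (f.comp g) x := by
  apply aut_ext
  · rw [bc_X0, bc_X0, bc_X0, map_map]
  · rw [bc_X1, bc_X1, bc_X1, map_map]

lemma bc_idd {R : Type*} [CommRing R] (x : Aut2 R) : bc (RingHom.id R) x = x := by
  apply aut_ext
  · rw [bc_X0, map_id]
  · rw [bc_X1, map_id]

def Cong (s : ℕ) (γ : Aut2 (Polynomial ℂ)) : Prop := ∃ A B : P2 (Polynomial ℂ),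
  γ (X 0) = X 0 + C (Polynomial.X ^ s) * A ∧ γ (X 1) = X 1 + C (Polynomial.X ^ s) * B

lemma Cong.all {s : ℕ} {γ : Aut2 (Polynomial ℂ)} (h : Cong s γ) (P : P2 (Polynomial ℂ)) :
    ∃ Q, γ P = P + C (Polynomial.X ^ s) * Q := by
  obtain ⟨A, B, h0, h1⟩ := h
  induction P using MvPolynomial.induction_on with
  | C a => exact ⟨0, by rw [aut_C]; ring⟩
  | add p q hp hq =>
    obtain ⟨Q, hQ⟩ := hp
    obtain ⟨Q', hQ'⟩ := hq
    exact ⟨Q + Q', by rw [map_add, hQ, hQ']; ring⟩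
  | mul_X p i hp =>
    obtain ⟨Q, hQ⟩ := hp
    have : ∃ E, γ (X i) = X i + C (Polynomial.X ^ s) * E := by
      fin_cases i
      · exact ⟨A, h0⟩
      · exact ⟨B, h1⟩
    obtain ⟨E, hE⟩ := this
    exact ⟨p * E + Q * X i + C (Polynomial.X ^ s) * Q * E, by rw [map_mul, hQ, hE]; ring⟩

lemma real_desc {a : P2 ℂ} (h : map (starRingEnd ℂ) a = a) : ∃ a' : P2 ℝ, map Complex.ofRealHom a' = a := by
  have : a ∈ Set.range (map (σ := Fin 2) Complex.ofRealHom) := by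
    rw [mem_range_map_iff_coeffs_subset]
    intro c hc
    rw [Finset.mem_coe, mem_coeffs_iff] at hc
    obtain ⟨n, _, rfl⟩ := hc
    have h2 := congrArg (coeff n) h
    rw [coeff_map] at h2
    obtain ⟨x, hx⟩ := Complex.conj_eq_iff_real.1 h2
    exact ⟨x, hx.symm⟩
  exact this

lemma corr0 {r : ℕ} (hr : 1 ≤ r) {ν γ : Aut2 (Polynomial ℂ)} (hν : Cong r ν) (hγ : ν * bc sD γ = γ) :
    ∃ γ', ν * bc sD γ' = γ' ∧ Cong 1 γ' := by
  have hez : (ez ℂ).comp sD = (starRingEnd ℂ).comp (ez ℂ) := RingHom.ext ez_sD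
  have hsC : sD.comp Polynomial.C = Polynomial.C.comp (starRingEnd ℂ) := RingHom.ext sD_C
  have hzC : (ez ℂ).comp Polynomial.C = RingHom.id ℂ := RingHom.ext ez_C
  obtain ⟨A, B, h0, h1⟩ := hν
  have hb := bc_ez_one hr h0 h1
  have hreal : bc (starRingEnd ℂ) (bc (ez ℂ) γ) = bc (ez ℂ) γ := by
    have := congrArg (bc (ez ℂ)) hγ
    rw [map_mul, hb, one_mul, bc_comp, hez, ← bc_comp] at this
    exact this
  have hone : bc (ez ℂ) (γ * bc Polynomial.C (bc (ez ℂ) γ)⁻¹) = 1 := by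
    rw [map_mul, bc_comp, hzC, bc_idd, mul_inv_cancel]
  refine ⟨γ * bc Polynomial.C (bc (ez ℂ) γ)⁻¹, ?_, ?_⟩
  · rw [map_mul, ← mul_assoc, hγ, bc_comp, hsC, ← bc_comp, map_inv (bc (starRingEnd ℂ)), hreal]
  · generalize γ * bc Polynomial.C (bc (ez ℂ) γ)⁻¹ = δ at hone
    have e0 : map (ez ℂ) (δ (X 0) - X 0) = 0 := by
      rw [map_sub, ← bc_X0, hone, one_app, map_X, sub_self]
    have e1 : map (ez ℂ) (δ (X 1) - X 1) = 0 := by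
      rw [map_sub, ← bc_X1, hone, one_app, map_X, sub_self]
    obtain ⟨Q, hQ⟩ := unz.dvdP e0
    obtain ⟨Q', hQ'⟩ := unz.dvdP e1
    exact ⟨Q, Q', by rw [pow_one, ← hQ]; ring, by rw [pow_one, ← hQ']; ring⟩

lemma corr_real {r s : ℕ} (hs : s < r) {ν γ : Aut2 (Polynomial ℂ)} (hν : Cong r ν) (hγ : ν * bc sD γ = γ)
    (i : Fin 2) {A : P2 (Polynomial ℂ)} (hA : γ (X i) = X i + C (Polynomial.X ^ s) * A) :
    map (starRingEnd ℂ) (map (ez ℂ) A) = map (ez ℂ) A := by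
  have hez : (ez ℂ).comp sD = (starRingEnd ℂ).comp (ez ℂ) := RingHom.ext ez_sD
  have h1 : ν (map sD (γ (X i))) = γ (X i) := by
    rw [← bc_map, map_X, ← mul_app, hγ]
  obtain ⟨Q, hQ⟩ := hν.all (map sD (γ (X i)))
  rw [h1, hA, map_add, map_mul, map_X, map_C, map_pow sD, sD_X] at hQ
  have h2 : A = map sD A + C (Polynomial.X ^ (r - s)) * Q := by
    apply Cpi_cancel (a := (Polynomial.X ^ s : Polynomial ℂ)) (pow_ne_zero _ Polynomial.X_ne_zero)
    rw [mul_add, ← mul_assoc, ← C_mul, ← pow_add, Nat.add_sub_cancel' hs.le]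
    linear_combination hQ
  have h3 := congrArg (map (ez ℂ)) h2
  rw [map_add, map_mul, map_C, ez_pow (by omega), C_0, zero_mul, add_zero, map_map, hez, ← map_map] at h3
  exact h3.symm

lemma corr_div {s : ℕ} (hs : 1 ≤ s) {γ : Aut2 (Polynomial ℂ)} {A B : P2 (Polynomial ℂ)}
    (h0 : γ (X 0) = X 0 + C (Polynomial.X ^ s) * A) (h1 : γ (X 1) = X 1 + C (Polynomial.X ^ s) * B) :
    pderiv 0 (map (ez ℂ) A) + pderiv 1 (map (ez ℂ) B) = 0 := by
  have hu := jac_aut_unit γ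
  have hj : jac (γ (X 0)) (γ (X 1)) = 1 + C (Polynomial.X ^ s) * (pderiv 0 A + pderiv 1 B + C (Polynomial.X ^ s) * jac A B) := by
    rw [h0, h1]
    simp only [jac, map_add, pderiv_C_mul, pderiv_X]
    simp
    ring
  obtain ⟨e, he, hje⟩ := isUnit_iff_eq_C_of_isReduced.1 hu
  obtain ⟨c, hc, rfl⟩ := Polynomial.isUnit_iff.1 he
  rw [hj] at hje
  have h2 := congrArg (map (ez ℂ)) hje
  rw [map_add, map_mul, map_C, ez_pow hs, C_0, zero_mul, add_zero, map_one, map_C, ez_C] at h2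
  have hc1 : c = 1 := by
    rw [← C_1] at h2
    exact (C_injective _ _ h2).symm
  rw [hc1, Polynomial.C_1, C_1] at hje
  have h3 : pderiv 0 A + pderiv 1 B + C (Polynomial.X ^ s) * jac A B = 0 := by
    apply Cpi_cancel (a := (Polynomial.X ^ s : Polynomial ℂ)) (pow_ne_zero _ Polynomial.X_ne_zero)
    linear_combination hje
  have h4 := congrArg (map (ez ℂ)) h3
  rw [map_add, map_add, map_mul, map_C, ez_pow hs, C_0, zero_mul, add_zero, map_zero] at h4
  rw [pderiv_map, pderiv_map, h4]

lemma corr_step {r s : ℕ} (hs1 : 1 ≤ s) (hs : s < r) {ν γ : Aut2 (Polynomial ℂ)} (hν : Cong r ν) (hγ : ν * bc sD γ = γ)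
    (hC : Cong s γ) : ∃ γ', ν * bc sD γ' = γ' ∧ Cong (s+1) γ' := by
  obtain ⟨A, B, h0, h1⟩ := hC
  obtain ⟨a, ha⟩ := real_desc (corr_real hs hν hγ 0 h0)
  obtain ⟨b, hb⟩ := real_desc (corr_real hs hν hγ 1 h1)
  have hd := corr_div hs1 h0 h1
  have hd' : pderiv 0 (-a) + pderiv 1 (-b) = 0 := by
    rw [← ha, ← hb, pderiv_map, pderiv_map, ← map_add] at hd
    have := (map_eq_zero_iff _ (map_injective Complex.ofRealHom Complex.ofRealHom.injective)).1 hd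
    rw [map_neg, map_neg, ← neg_add, this, neg_zero]
  obtain ⟨ε, A', B', e0, e1, hA', hB'⟩ := ach_div hs1 hd'
  have hcr : sD.comp (Polynomial.mapRingHom Complex.ofRealHom) = Polynomial.mapRingHom Complex.ofRealHom := by
    apply Polynomial.ringHom_ext
    · intro x; simp [sD_C]
    · simp [sD_X]
  have hez : (ez ℂ).comp (Polynomial.mapRingHom Complex.ofRealHom) = Complex.ofRealHom.comp (ez ℝ) := by
    apply Polynomial.ringHom_ext
    · intro x; simp [ez]
    · simp [ez]
  have hone := bc_ez_one hs1 h0 h1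
  have key : ∀ (i : Fin 2) (A : P2 (Polynomial ℂ)) (A' : P2 (Polynomial ℝ)) (a : P2 ℝ),
      map Complex.ofRealHom a = map (ez ℂ) A → map (ez ℝ) A' = -a →
      γ (X i) = X i + C (Polynomial.X ^ s) * A → ε (X i) = X i + C (Polynomial.X ^ s) * A' →
      ∃ Q, (γ * bc (Polynomial.mapRingHom Complex.ofRealHom) ε) (X i) = X i + C (Polynomial.X ^ (s+1)) * Q := by
    intro i A A' a ha hA' h0 e0
    have hz : map (ez ℂ) (A + γ (map (Polynomial.mapRingHom Complex.ofRealHom) A')) = 0 := by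
      rw [map_add, ← bc_map, hone, one_app, map_map, hez, ← map_map, hA', ← ha, map_neg, add_neg_cancel]
    obtain ⟨Q, hQ⟩ := unz.dvdP hz
    refine ⟨Q, ?_⟩
    have hX := bc_map (Polynomial.mapRingHom Complex.ofRealHom) ε (X i)
    rw [map_X] at hX
    rw [mul_app, hX, e0, map_add, map_mul, map_X, map_C, map_add, map_mul, aut_C, h0, map_pow (Polynomial.mapRingHom Complex.ofRealHom), Polynomial.coe_mapRingHom, Polynomial.map_X, pow_succ, C_mul, mul_assoc (C _), ← hQ]
    ring
  refine ⟨γ * bc (Polynomial.mapRingHom Complex.ofRealHom) ε, ?_, ?_⟩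
  · rw [map_mul, ← mul_assoc, hγ, bc_comp, hcr]
  · obtain ⟨Q, hQ⟩ := key 0 A A' a ha hA' h0 e0
    obtain ⟨Q', hQ'⟩ := key 1 B B' b hb hB' h1 e1
    exact ⟨Q, Q', hQ, hQ'⟩

theorem H1_Dr {r : ℕ} (hr : 1 ≤ r) {ν : Aut2 (Polynomial ℂ)} (hν : Cong r ν) (hcoc : ν * bc sD ν = 1) :
    ∃ γ : Aut2 (Polynomial ℂ), ν * bc sD γ = γ ∧ Cong r γ := by
  obtain ⟨γ0, h0⟩ := H1_D ν hcoc
  have : ∀ s, 1 ≤ s → s ≤ r → ∃ γ : Aut2 (Polynomial ℂ), ν * bc sD γ = γ ∧ Cong s γ := by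
    intro s hs
    induction s, hs using Nat.le_induction with
    | base => intro _; exact corr0 hr hν h0
    | succ s hs ih =>
      intro hsr
      obtain ⟨γ, hγ, hC⟩ := ih (by omega)
      exact corr_step hs (by omega) hν hγ hC
  exact this r hr le_rfl




noncomputable def PhiH : MvPolynomial (Fin 3) ℂ →ₐ[ℂ] P2 (Polynomial ℂ) :=
  aeval ![X 0, X 1, C Polynomial.X]
noncomputable def PsiH : P2 (Polynomial ℂ) →ₐ[ℂ] MvPolynomial (Fin 3) ℂ :=
  aevalTower (Polynomial.aeval (X 2 : MvPolynomial (Fin 3) ℂ)) ![X 0, X 1]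

lemma PhiH_C (a : ℂ) : PhiH (C a) = C (Polynomial.C a) := by
  rw [PhiH, aeval_C]; rfl
lemma PhiH_X0 : PhiH (X 0) = X 0 := by simp [PhiH]
lemma PhiH_X1 : PhiH (X 1) = X 1 := by simp [PhiH]
lemma PhiH_X2 : PhiH (X 2) = C Polynomial.X := by simp [PhiH]
lemma PsiH_C (a : Polynomial ℂ) : PsiH (C a) = Polynomial.aeval (X 2 : MvPolynomial (Fin 3) ℂ) a := by
  rw [PsiH, aevalTower_C]
lemma PsiH_X0 : PsiH (X 0) = X 0 := by simp [PsiH]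
lemma PsiH_X1 : PsiH (X 1) = X 1 := by simp [PsiH]

lemma PhiPsi (P : P2 (Polynomial ℂ)) : PhiH (PsiH P) = P := by
  have hX : ∀ i : Fin 2, PhiH (PsiH (X i)) = X i := by
    intro i
    fin_cases i
    · exact (congrArg PhiH PsiH_X0).trans PhiH_X0
    · exact (congrArg PhiH PsiH_X1).trans PhiH_X1
  induction P using MvPolynomial.induction_on with
  | C a =>
    rw [PsiH_C]
    induction a using Polynomial.induction_on' with
    | add p q hp hq => rw [map_add, map_add, hp, hq, C_add]
    | monomial n c =>
      rw [Polynomial.aeval_monomial, MvPolynomial.algebraMap_eq, map_mul, map_pow, PhiH_C, PhiH_X2, ← C_pow, ← C_mul, Polynomial.C_mul_X_pow_eq_monomial]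
  | add p q hp hq => rw [map_add, map_add, hp, hq]
  | mul_X p i hp =>
    rw [map_mul, map_mul, hp, hX i]

lemma PsiPhi (P : MvPolynomial (Fin 3) ℂ) : PsiH (PhiH P) = P := by
  have hX : ∀ i : Fin 3, PsiH (PhiH (X i)) = X i := by
    intro i
    fin_cases i
    · exact (congrArg PsiH PhiH_X0).trans PsiH_X0
    · exact (congrArg PsiH PhiH_X1).trans PsiH_X1
    · exact (congrArg PsiH PhiH_X2).trans ((PsiH_C _).trans (Polynomial.aeval_X _))
  induction P using MvPolynomial.induction_on with
  | C a => rw [PhiH_C, PsiH_C, Polynomial.aeval_C, MvPolynomial.algebraMap_eq]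
  | add p q hp hq => rw [map_add, map_add, hp, hq]
  | mul_X p i hp =>
    rw [map_mul, map_mul, hp, hX i]

lemma Phi_conj (P : MvPolynomial (Fin 3) ℂ) : PhiH (coeffConj18 P) = map sD (PhiH P) := by
  have hX : ∀ i : Fin 3, PhiH (X i) = map sD (PhiH (X i)) := by
    intro i
    fin_cases i
    · change PhiH (X 0) = map sD (PhiH (X 0)); rw [PhiH_X0, map_X]
    · change PhiH (X 1) = map sD (PhiH (X 1)); rw [PhiH_X1, map_X]
    · change PhiH (X 2) = map sD (PhiH (X 2)); rw [PhiH_X2, map_C, sD_X]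
  unfold coeffConj18
  induction P using MvPolynomial.induction_on with
  | C a => rw [map_C, PhiH_C, PhiH_C, map_C, sD_C]
  | add p q hp hq => rw [map_add, map_add, hp, hq, map_add, map_add]
  | mul_X p i hp =>
    rw [map_mul, map_mul, hp, map_mul, map_mul, map_X, ← hX i]

lemma Phi_ev (g : MvPolynomial (Fin 3) ℂ ≃ₐ[ℂ] MvPolynomial (Fin 3) ℂ) (hg : g (X 2) = X 2) (P : MvPolynomial (Fin 3) ℂ) :
    ev (PhiH (g (X 0))) (PhiH (g (X 1))) (PhiH P) = PhiH (g P) := by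
  have hX : ∀ i : Fin 3, ev (PhiH (g (X 0))) (PhiH (g (X 1))) (PhiH (X i)) = PhiH (g (X i)) := by
    intro i
    fin_cases i
    · change ev _ _ (PhiH (X 0)) = PhiH (g (X 0)); rw [PhiH_X0, ev_X0]
    · change ev _ _ (PhiH (X 1)) = PhiH (g (X 1)); rw [PhiH_X1, ev_X1]
    · change ev _ _ (PhiH (X 2)) = PhiH (g (X 2)); rw [hg, PhiH_X2, ev_C]
  induction P using MvPolynomial.induction_on with
  | C a =>
    have : g (C a) = C a := g.commutes a
    rw [this, PhiH_C, ev_C]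
  | add p q hp hq => rw [map_add, map_add, hp, hq, map_add, map_add]
  | mul_X p i hp =>
    rw [map_mul, map_mul, hp, map_mul, map_mul, hX i]

lemma to_aut2 (g : MvPolynomial (Fin 3) ℂ ≃ₐ[ℂ] MvPolynomial (Fin 3) ℂ) (hg : g (X 2) = X 2) :
    ∃ f : Aut2 (Polynomial ℂ), ∀ P, f (PhiH P) = PhiH (g P) := by
  have hg' : g.symm (X 2) = X 2 := by rw [AlgEquiv.symm_apply_eq, hg]
  refine ⟨mkAut (PhiH (g (X 0))) (PhiH (g (X 1))) (PhiH (g.symm (X 0))) (PhiH (g.symm (X 1))) ?_ ?_ ?_ ?_, fun P => ?_⟩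
  · rw [Phi_ev g hg, AlgEquiv.apply_symm_apply, PhiH_X0]
  · rw [Phi_ev g hg, AlgEquiv.apply_symm_apply, PhiH_X1]
  · rw [Phi_ev g.symm hg', AlgEquiv.symm_apply_apply, PhiH_X0]
  · rw [Phi_ev g.symm hg', AlgEquiv.symm_apply_apply, PhiH_X1]
  · rw [aut_eq_ev, mkAut_X0, mkAut_X1, Phi_ev g hg]

lemma of_aut2 (γ : Aut2 (Polynomial ℂ)) :
    ∃ β : MvPolynomial (Fin 3) ℂ ≃ₐ[ℂ] MvPolynomial (Fin 3) ℂ, (∀ P, PhiH (β P) = γ.symm (PhiH P)) ∧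
      (∀ P, PhiH (β.symm P) = γ (PhiH P)) := by
  let β : MvPolynomial (Fin 3) ℂ ≃ₐ[ℂ] MvPolynomial (Fin 3) ℂ :=
    AlgEquiv.ofRingEquiv (f := 
      { toFun := fun P => PsiH (γ.symm (PhiH P))
        invFun := fun P => PsiH (γ (PhiH P))
        left_inv := fun P => by beta_reduce; rw [PhiPsi, AlgEquiv.apply_symm_apply, PsiPhi]
        right_inv := fun P => by beta_reduce; rw [PhiPsi, AlgEquiv.symm_apply_apply, PsiPhi]
        map_mul' := fun P Q => by rw [map_mul, map_mul, map_mul]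
        map_add' := fun P Q => by rw [map_add, map_add, map_add] }) (by
      intro a
      change PsiH (γ.symm (PhiH (C a))) = C a
      rw [PhiH_C, aut_C, ← PhiH_C, PsiPhi])
  exact ⟨β, fun P => PhiPsi _, fun P => PhiPsi _⟩

theorem H1_Gr_trivial (r : ℕ) (hr : 1 ≤ r)
    (ν : MvPolynomial (Fin 3) ℂ ≃ₐ[ℂ] MvPolynomial (Fin 3) ℂ) (hν : MemGr r ν)
    (hcoc : ∀ P : MvPolynomial (Fin 3) ℂ, ν (coeffConj18 (ν (coeffConj18 P))) = P) :
    ∃ β : MvPolynomial (Fin 3) ℂ ≃ₐ[ℂ] MvPolynomial (Fin 3) ℂ,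
      MemGr r β ∧
      ∀ P : MvPolynomial (Fin 3) ℂ, ν P = β.symm (coeffConj18 (β (coeffConj18 P))) := by
  obtain ⟨h2, h0, h1⟩ := hν
  obtain ⟨f, hf⟩ := to_aut2 ν h2
  have inj : Function.Injective PhiH := fun a b h => by rw [← PsiPhi a, h, PsiPhi]
  have hC : Cong r f := by
    rw [Ideal.mem_span_singleton] at h0 h1
    obtain ⟨A, hA⟩ := h0
    obtain ⟨B, hB⟩ := h1
    refine ⟨PhiH A, PhiH B, ?_, ?_⟩
    · have e := hf (X 0)
      rw [PhiH_X0] at e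
      rw [e, sub_eq_iff_eq_add.1 hA, map_add, map_mul, map_pow, PhiH_X2, PhiH_X0, C_pow]; ring
    · have e := hf (X 1)
      rw [PhiH_X1] at e
      rw [e, sub_eq_iff_eq_add.1 hB, map_add, map_mul, map_pow, PhiH_X2, PhiH_X1, C_pow]; ring
  have hc : ∀ P, f (map sD (f (map sD (PhiH P)))) = PhiH P := by
    intro P
    rw [← Phi_conj, hf, ← Phi_conj, hf, hcoc]
  have hcoc' : f * bc sD f = 1 := by
    apply aut_ext
    · have e := hc (X 0)
      rw [PhiH_X0, map_X] at e
      rw [mul_app, bc_X0, one_app, e]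
    · have e := hc (X 1)
      rw [PhiH_X1, map_X] at e
      rw [mul_app, bc_X1, one_app, e]
  obtain ⟨γ, hγ, A, B, hA, hB⟩ := H1_Dr hr hC hcoc'
  obtain ⟨β, hβ, hβ'⟩ := of_aut2 γ
  have sub : ∀ (i : Fin 2) (j : Fin 3) (A : P2 (Polynomial ℂ)), PhiH (X j) = X i → γ (X i) = X i + C (Polynomial.X ^ r) * A →
      β (X j) - X j ∈ Ideal.span {(X 2 : MvPolynomial (Fin 3) ℂ) ^ r} := by
    intro i j A hij hA
    rw [Ideal.mem_span_singleton]
    refine ⟨- PsiH (γ.symm A), inj ?_⟩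
    have e := congrArg γ.symm hA
    rw [AlgEquiv.symm_apply_apply, map_add, map_mul, aut_C] at e
    rw [map_sub, hβ, hij, map_mul, map_pow, PhiH_X2, map_neg, PhiPsi, ← C_pow]
    linear_combination -e
  refine ⟨β, ⟨?_, sub 0 0 A PhiH_X0 hA, sub 1 1 B PhiH_X1 hB⟩, fun P => ?_⟩
  · apply inj
    rw [hβ, PhiH_X2, aut_C]
  · apply inj
    rw [hβ', Phi_conj, hβ, Phi_conj, ← hf]
    obtain ⟨S, hS⟩ := γ.surjective (map sD (PhiH P))
    have e : PhiH P = bc sD γ (map sD S) := by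
      rw [bc_map, hS, map_map_inv sD sD_sD]
    rw [← hS, AlgEquiv.symm_apply_apply, e, ← mul_app, hγ]
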